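/- Let A be a homologically smooth and proper dg algebra over F₂, and suppose that the operations d^{2i} on HH_*(A) (Hochschild homology of the diagonal bimodule) vanish for all i ≥ 2. Then every neutral dg (A,A)-bimodule is π-formal. -/

import Mathlib

noncomputable section
open TensorProduct

namespace LT

/-- A differential graded (dg) algebra over a commutative ring `k`: a chain complex with a
degree `-1` differential together with an associative unital multiplication satisfying the
(signed) Leibniz rule; over `𝔽₂` the signs are invisible. The grading is given by an internal
direct sum decomposition into submodules. -/
structure DGA (k : Type) [CommRing k] : Type 1 where
  V : Type
  [acg : AddCommGroup V]
  [mod : Module k V]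
  gr : ℤ → Submodule k V
  internal : DirectSum.IsInternal gr
  d : V →ₗ[k] V
  d_d : ∀ x, d (d x) = 0
  d_gr : ∀ i, ∀ x ∈ gr i, d x ∈ gr (i - 1)
  mul : V →ₗ[k] V →ₗ[k] V
  mul_assoc' : ∀ x y z, mul (mul x y) z = mul x (mul y z)
  one : V
  one_gr : one ∈ gr 0
  one_mul' : ∀ x, mul one x = x
  mul_one' : ∀ x, mul x one = x
  mul_gr : ∀ i j, ∀ x ∈ gr i, ∀ y ∈ gr j, mul x y ∈ gr (i + j)
  leibniz : ∀ i, ∀ x ∈ gr i, ∀ y, d (mul x y) = mul (d x) y + (Int.negOnePow i : ℤ) • mul x (d y)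

attribute [instance] DGA.acg
attribute [instance 2000] DGA.mod

variable {k : Type} [CommRing k]

/-- A dg `(A,A)`-bimodule over a dg algebra `A`. -/
structure DGBimod (A : DGA k) : Type 1 where
  V : Type
  [acg : AddCommGroup V]
  [mod : Module k V]
  gr : ℤ → Submodule k V
  internal : DirectSum.IsInternal gr
  d : V →ₗ[k] V
  d_d : ∀ x, d (d x) = 0
  d_gr : ∀ i, ∀ x ∈ gr i, d x ∈ gr (i - 1)
  actL : A.V →ₗ[k] V →ₗ[k] V
  actR : V →ₗ[k] A.V →ₗ[k] V
  actL_one : ∀ m, actL A.one m = m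
  actR_one : ∀ m, actR m A.one = m
  actL_mul : ∀ a b m, actL (A.mul a b) m = actL a (actL b m)
  actR_mul : ∀ m a b, actR (actR m a) b = actR m (A.mul a b)
  actLR : ∀ a m b, actR (actL a m) b = actL a (actR m b)
  actL_gr : ∀ i j, ∀ a ∈ A.gr i, ∀ m ∈ gr j, actL a m ∈ gr (i + j)
  actR_gr : ∀ i j, ∀ m ∈ gr i, ∀ a ∈ A.gr j, actR m a ∈ gr (i + j)
  leibnizL : ∀ i, ∀ a ∈ A.gr i, ∀ m, d (actL a m) = actL (A.d a) m + (Int.negOnePow i : ℤ) • actL a (d m)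
  leibnizR : ∀ j, ∀ m ∈ gr j, ∀ a, d (actR m a) = actR (d m) a + (Int.negOnePow j : ℤ) • actR m (A.d a)

attribute [instance] DGBimod.acg
attribute [instance 2000] DGBimod.mod

/-- The diagonal bimodule: `A` viewed as a bimodule over itself. -/
def DGA.diag (A : DGA k) : DGBimod A where
  V := A.V
  gr := A.gr
  internal := A.internal
  d := A.d
  d_d := A.d_d
  d_gr := A.d_gr
  actL := A.mul
  actR := A.mul
  actL_one := A.one_mul'
  actR_one := A.mul_one'
  actL_mul := fun a b m => A.mul_assoc' a b m
  actR_mul := fun m a b => A.mul_assoc' m a b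
  actLR := fun a m b => A.mul_assoc' a m b
  actL_gr := A.mul_gr
  actR_gr := A.mul_gr
  leibnizL := A.leibniz
  leibnizR := A.leibniz

variable {A : DGA k}

/-- A homomorphism of dg bimodules of degree `s`: a linear map raising degree by `s`,
commuting with the differentials and the two actions. -/
def IsBHom (M N : DGBimod A) (s : ℤ) (f : M.V →ₗ[k] N.V) : Prop :=
  (∀ i, ∀ x ∈ M.gr i, f x ∈ N.gr (i + s)) ∧
  (∀ x, f (M.d x) = N.d (f x)) ∧
  (∀ a m, f (M.actL a m) = N.actL a (f m)) ∧
  (∀ m a, f (M.actR m a) = N.actR (f m) a)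

/-- Graded maps of degree `s` compatible with the bimodule actions (no compatibility with the
differential required); these are used as homotopies. -/
def grHomSub (M N : DGBimod A) (s : ℤ) : Submodule k (M.V →ₗ[k] N.V) where
  carrier := {f | (∀ i, ∀ x ∈ M.gr i, f x ∈ N.gr (i + s)) ∧
    (∀ a m, f (M.actL a m) = N.actL a (f m)) ∧
    (∀ m a, f (M.actR m a) = N.actR (f m) a)}
  add_mem' := by
    rintro f g ⟨hf1, hf2, hf3⟩ ⟨hg1, hg2, hg3⟩
    refine ⟨fun i x hx => ?_, fun a m => ?_, fun m a => ?_⟩ <;>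
      simp [LinearMap.add_apply, hf2, hg2, hf3, hg3]
    exact Submodule.add_mem _ (hf1 i x hx) (hg1 i x hx)
  zero_mem' := by
    refine ⟨fun i x hx => ?_, fun a m => ?_, fun m a => ?_⟩ <;> simp
  smul_mem' := by
    rintro c f ⟨hf1, hf2, hf3⟩
    refine ⟨fun i x hx => ?_, fun a m => ?_, fun m a => ?_⟩ <;>
      simp [LinearMap.smul_apply, hf2, hf3]
    exact Submodule.smul_mem _ _ (hf1 i x hx)

/-- Bimodule chain maps of degree `s`, as a submodule of all linear maps. -/
def bcmSub (M N : DGBimod A) (s : ℤ) : Submodule k (M.V →ₗ[k] N.V) where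
  carrier := {f | IsBHom M N s f}
  add_mem' := by
    rintro f g ⟨hf1, hf0, hf2, hf3⟩ ⟨hg1, hg0, hg2, hg3⟩
    refine ⟨fun i x hx => ?_, fun x => ?_, fun a m => ?_, fun m a => ?_⟩ <;>
      simp [LinearMap.add_apply, hf0, hg0, hf2, hg2, hf3, hg3]
    exact Submodule.add_mem _ (hf1 i x hx) (hg1 i x hx)
  zero_mem' := by
    refine ⟨fun i x hx => ?_, fun x => ?_, fun a m => ?_, fun m a => ?_⟩ <;> simp
  smul_mem' := by
    rintro c f ⟨hf1, hf0, hf2, hf3⟩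
    refine ⟨fun i x hx => ?_, fun x => ?_, fun a m => ?_, fun m a => ?_⟩ <;>
      simp [LinearMap.smul_apply, hf0, hf2, hf3]
    exact Submodule.smul_mem _ _ (hf1 i x hx)

/-- The nullhomotopic degree-`s` maps `d ∘ h + h ∘ d` for `h` a degree `s+1` bimodule map. -/
def nullHtpSub (M N : DGBimod A) (s : ℤ) : Submodule k (M.V →ₗ[k] N.V) :=
  Submodule.map
    ((LinearMap.llcomp k M.V N.V N.V N.d) + (LinearMap.lcomp k N.V M.d))
    (grHomSub M N (s + 1))

/-- Homotopy classes of degree-`s` bimodule chain maps `M → N`; for `M` a cell retract this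
computes morphisms `Σ^s M → N` in the derived category of dg bimodules. -/
def HtpyHom (M N : DGBimod A) (s : ℤ) :=
  bcmSub M N s ⧸ Submodule.comap (bcmSub M N s).subtype (nullHtpSub M N s)

instance (M N : DGBimod A) (s : ℤ) : AddCommGroup (HtpyHom M N s) :=
  inferInstanceAs (AddCommGroup (_ ⧸ _))
instance (M N : DGBimod A) (s : ℤ) : Module k (HtpyHom M N s) :=
  inferInstanceAs (Module k (_ ⧸ _))


/-- Homology in degree `n` of a graded module with "relations": the degree-`n` part of the
homology of the quotient complex `(T/N, d)` where the grading of `T/N` is induced by `gr`.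
Taking `N = ⊥` gives ordinary graded homology. -/
def Hgr (T : Type) [AddCommGroup T] [Module k T] (gr : ℤ → Submodule k T)
    (N : Submodule k T) (d : T →ₗ[k] T) (n : ℤ) : Type :=
  ↥((gr n ⊔ N) ⊓ Submodule.comap d N) ⧸
    Submodule.comap ((gr n ⊔ N) ⊓ Submodule.comap d N).subtype
      (Submodule.map d (gr (n + 1) ⊔ N) ⊔ N)

instance (T : Type) [AddCommGroup T] [Module k T] (gr : ℤ → Submodule k T)
    (N : Submodule k T) (d : T →ₗ[k] T) (n : ℤ) : AddCommGroup (Hgr T gr N d n) :=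
  inferInstanceAs (AddCommGroup (_ ⧸ _))
instance (T : Type) [AddCommGroup T] [Module k T] (gr : ℤ → Submodule k T)
    (N : Submodule k T) (d : T →ₗ[k] T) (n : ℤ) : Module k (Hgr T gr N d n) :=
  inferInstanceAs (Module k (_ ⧸ _))

/-- `f` induces an isomorphism on (graded) homology, with a degree shift `s`; stated
elementarily: the induced map on homology classes is surjective and injective. -/
def IsQIsoDeg (T S : Type) [AddCommGroup T] [Module k T] [AddCommGroup S] [Module k S]
    (grT : ℤ → Submodule k T) (grS : ℤ → Submodule k S)
    (dT : T →ₗ[k] T) (dS : S →ₗ[k] S) (s : ℤ) (f : T →ₗ[k] S) : Prop :=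
  ∀ n : ℤ,
    (∀ y ∈ grS (n + s), dS y = 0 →
      ∃ x ∈ grT n, dT x = 0 ∧ f x - y ∈ Submodule.map dS (grS (n + s + 1))) ∧
    (∀ x ∈ grT n, dT x = 0 → f x ∈ Submodule.map dS (grS (n + s + 1)) →
      x ∈ Submodule.map dT (grT (n + 1)))

variable {A : DGA k}

/-- The bilinear "sandwich" map `(a, b) ↦ a · m · b` for a fixed element `m` of a bimodule. -/
def sandwich (M : DGBimod A) (m : M.V) : A.V →ₗ[k] A.V →ₗ[k] M.V :=
  LinearMap.mk₂ k (fun a b => M.actR (M.actL a m) b)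
    (fun a₁ a₂ b => by simp)
    (fun c a b => by simp)
    (fun a b₁ b₂ => by simp)
    (fun c a b => by simp)

/-- The bimodule map `A ⊗ A → M`, `a ⊗ b ↦ a · m · b`. -/
def sandwichT (M : DGBimod A) (m : M.V) : (A.V ⊗[k] A.V) →ₗ[k] M.V :=
  TensorProduct.lift (sandwich M m)

/-- `S'/S` is a free dg bimodule: there is a family of "generators" `g i` of degrees `deg i`,
closed cycles modulo `S`, which generate `S'` freely over `A ⊗ A` modulo `S`. -/
def IsFreeStep (M : DGBimod A) (S S' : Submodule k M.V) : Prop :=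
  ∃ (I : Type) (g : I → M.V) (deg : I → ℤ),
    (∀ i, g i ∈ S') ∧ (∀ i, M.d (g i) ∈ S) ∧
    (∀ i p q, ∀ a ∈ A.gr p, ∀ b ∈ A.gr q, M.actR (M.actL a (g i)) b ∈ M.gr (p + q + deg i)) ∧
    S' ≤ S ⊔ (⨆ i, LinearMap.range (sandwichT M (g i))) ∧
    (∀ (u : Finset I) (c : I → A.V ⊗[k] A.V),
      (∑ i ∈ u, sandwichT M (g i) (c i)) ∈ S → ∀ i ∈ u, c i = 0)

/-- As `IsFreeStep`, with a finite generating family. -/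
def IsFreeStepFin (M : DGBimod A) (S S' : Submodule k M.V) : Prop :=
  ∃ (I : Type) (_ : Finite I) (g : I → M.V) (deg : I → ℤ),
    (∀ i, g i ∈ S') ∧ (∀ i, M.d (g i) ∈ S) ∧
    (∀ i p q, ∀ a ∈ A.gr p, ∀ b ∈ A.gr q, M.actR (M.actL a (g i)) b ∈ M.gr (p + q + deg i)) ∧
    S' ≤ S ⊔ (⨆ i, LinearMap.range (sandwichT M (g i))) ∧
    (∀ (u : Finset I) (c : I → A.V ⊗[k] A.V),
      (∑ i ∈ u, sandwichT M (g i) (c i)) ∈ S → ∀ i ∈ u, c i = 0)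

/-- A filtration exhibiting `M` as a cell bimodule. -/
def IsCellFiltration (M : DGBimod A) (Fil : ℕ → Submodule k M.V) : Prop :=
  Fil 0 = ⊥ ∧ Monotone Fil ∧ (⨆ n, Fil n) = ⊤ ∧
  (∀ n, ∀ x ∈ Fil n, M.d x ∈ Fil n) ∧
  (∀ n a, ∀ x ∈ Fil n, M.actL a x ∈ Fil n) ∧
  (∀ n a, ∀ x ∈ Fil n, M.actR x a ∈ Fil n) ∧
  (∀ n, IsFreeStep M (Fil n) (Fil (n + 1)))

/-- A cell bimodule: admits a filtration with free subquotients. -/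
def IsCellBimod (M : DGBimod A) : Prop := ∃ Fil, IsCellFiltration M Fil

/-- A finite cell bimodule: a finite filtration with finite-rank free subquotients. -/
def IsFiniteCellBimod (M : DGBimod A) : Prop :=
  ∃ Fil, (Fil 0 = ⊥ ∧ Monotone Fil ∧ (⨆ n, Fil n) = ⊤ ∧
    (∀ n, ∀ x ∈ Fil n, M.d x ∈ Fil n) ∧
    (∀ n a, ∀ x ∈ Fil n, M.actL a x ∈ Fil n) ∧
    (∀ n a, ∀ x ∈ Fil n, M.actR x a ∈ Fil n) ∧
    (∀ n, IsFreeStepFin M (Fil n) (Fil (n + 1)))) ∧ (∃ n₀, Fil n₀ = ⊤)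

/-- A (finite) cell retract: a subcomplex of a (finite) cell bimodule whose inclusion admits
a bimodule retraction. -/
def IsCellRetract (P : DGBimod A) : Prop :=
  ∃ (C : DGBimod A), IsCellBimod C ∧
    ∃ (ι : P.V →ₗ[k] C.V) (r : C.V →ₗ[k] P.V),
      IsBHom P C 0 ι ∧ IsBHom C P 0 r ∧ Function.Injective ι ∧ r.comp ι = LinearMap.id

def IsFiniteCellRetract (P : DGBimod A) : Prop :=
  ∃ (C : DGBimod A), IsFiniteCellBimod C ∧
    ∃ (ι : P.V →ₗ[k] C.V) (r : C.V →ₗ[k] P.V),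
      IsBHom P C 0 ι ∧ IsBHom C P 0 r ∧ Function.Injective ι ∧ r.comp ι = LinearMap.id

/-- `ρ : R → M` is a resolution: a quasi-isomorphism of dg bimodules from a cell retract. -/
def IsResolution (R M : DGBimod A) (ρ : R.V →ₗ[k] M.V) : Prop :=
  IsCellRetract R ∧ IsBHom R M 0 ρ ∧ IsQIsoDeg R.V M.V R.gr M.gr R.d M.d 0 ρ

/-- A bimodule is perfect if it admits a resolution by a finite cell retract. -/
def IsPerfect (M : DGBimod A) : Prop :=
  ∃ (R : DGBimod A) (ρ : R.V →ₗ[k] M.V),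
    IsFiniteCellRetract R ∧ IsBHom R M 0 ρ ∧ IsQIsoDeg R.V M.V R.gr M.gr R.d M.d 0 ρ

/-- `A` is homologically smooth: perfect as a bimodule over itself. -/
def HomSmooth (A : DGA k) : Prop := IsPerfect A.diag

/-- The homology of the dg algebra `A` in degree `n`. -/
abbrev AlgH (A : DGA k) (n : ℤ) := Hgr A.V A.gr ⊥ A.d n

/-- `A` is homologically proper: its total homology is finitely generated. -/
def HomProper (A : DGA k) : Prop :=
  (∀ n, Module.Finite k (AlgH A n)) ∧ (Set.Finite {n : ℤ | Nontrivial (AlgH A n)})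

/-- A dg bimodule is bounded if it is supported in finitely many gradings. -/
def BoundedBimod (M : DGBimod A) : Prop := ∃ u : Finset ℤ, ∀ i ∉ u, M.gr i = ⊥

/-! ### Bicomplexes and the spectral sequences of their two filtrations -/

/-- A bicomplex of `k`-modules "with relations", presented as one ambient module with a
bigrading by submodules, a horizontal differential `dh` (of bidegree `(-1,0)`), a vertical
differential `dv` (of bidegree `(0,-1)`) and a submodule `N` of relations (so that the actual
bicomplex is the quotient by `N`; take `N = ⊥` for an honest bicomplex). -/
structure RelBicx (k : Type) [CommRing k] : Type 1 where
  T : Type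
  [acg : AddCommGroup T]
  [mod : Module k T]
  gr : ℤ → ℤ → Submodule k T
  N : Submodule k T
  dh : T →ₗ[k] T
  dv : T →ₗ[k] T

attribute [instance] RelBicx.acg RelBicx.mod

namespace RelBicx

variable {k : Type} [CommRing k] (B : RelBicx k)

/-- The total differential. -/
def D : B.T →ₗ[k] B.T := B.dh + B.dv

/-- The column filtration (by the first index `p`) of the total complex, in total degree `n`. -/
def Fcol (p n : ℤ) : Submodule k B.T := ⨆ (i : ℤ) (_ : i ≤ p), B.gr i (n - i)

/-- The row filtration (by the second index `q`) of the total complex, in total degree `n`. -/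
def Frow (q n : ℤ) : Submodule k B.T := ⨆ (j : ℤ) (_ : j ≤ q), B.gr (n - j) j

/-- Approximate cycles for the spectral sequence of the filtration `F`:
elements of filtration `p` (mod `N`) whose total differential drops filtration by `r`. -/
def Zpage (F : ℤ → ℤ → Submodule k B.T) (r p n : ℤ) : Submodule k B.T :=
  (F p n ⊔ B.N) ⊓ Submodule.comap B.D (F (p - r) (n - 1) ⊔ B.N)

/-- The boundaries subobject for the `r`-th page at filtration `p`, total degree `n`. -/
def Bpage (F : ℤ → ℤ → Submodule k B.T) (r p n : ℤ) : Submodule k B.T :=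
  Submodule.map B.D (B.Zpage F (r - 1) (p + r - 1) (n + 1)) ⊔ B.Zpage F (r - 1) (p - 1) n ⊔ B.N

/-- The `r`-th page of the spectral sequence of the filtration `F`, at filtration degree `p`
and total degree `n` (the classical subquotient description `Z^r/B^r`). -/
def Epage (F : ℤ → ℤ → Submodule k B.T) (r p n : ℤ) : Type :=
  ↥(B.Zpage F r p n) ⧸
    Submodule.comap (B.Zpage F r p n).subtype (B.Bpage F r p n)

instance (F : ℤ → ℤ → Submodule k B.T) (r p n : ℤ) : AddCommGroup (B.Epage F r p n) :=
  inferInstanceAs (AddCommGroup (_ ⧸ _))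
instance (F : ℤ → ℤ → Submodule k B.T) (r p n : ℤ) : Module k (B.Epage F r p n) :=
  inferInstanceAs (Module k (_ ⧸ _))

/-- The spectral sequence `ᵛʰE` (filtration by columns; one first takes homology with respect
to the vertical differential). Indexing: `vhE r p q` is `ᵛʰE^r_{p,q}`. -/
def vhE (r p q : ℤ) : Type := B.Epage B.Fcol r p (p + q)

/-- The spectral sequence `ʰᵛE` (filtration by rows; one first takes homology with respect to
the horizontal differential), in the transposed indexing of Lipshitz–Treumann:
`hvE r p q` is `ʰᵛE^r_{p,q}`, whose filtration index is the row `q`. -/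
def hvE (r p q : ℤ) : Type := B.Epage B.Frow r q (p + q)

instance (r p q : ℤ) : AddCommGroup (B.vhE r p q) := inferInstanceAs (AddCommGroup (Epage _ _ _ _ _))
instance (r p q : ℤ) : Module k (B.vhE r p q) := inferInstanceAs (Module k (Epage _ _ _ _ _))
instance (r p q : ℤ) : AddCommGroup (B.hvE r p q) := inferInstanceAs (AddCommGroup (Epage _ _ _ _ _))
instance (r p q : ℤ) : Module k (B.hvE r p q) := inferInstanceAs (Module k (Epage _ _ _ _ _))

/-- Vanishing of the differential leaving the `r`-th page at position `(p, n)`: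
the total differential of any approximate cycle is, up to boundaries of earlier pages and
relations, an approximate cycle of deeper filtration. -/
def zeroDiff (F : ℤ → ℤ → Submodule k B.T) (r p n : ℤ) : Prop :=
  Submodule.map B.D (B.Zpage F r p n) ≤
    Submodule.map B.D (B.Zpage F (r - 1) (p - 1) n) ⊔ B.Zpage F (r - 1) (p - r - 1) (n - 1) ⊔ B.N

/-- The spectral sequence of the filtration `F` collapses at the `r₀`-th page. -/
def collapsesAt (F : ℤ → ℤ → Submodule k B.T) (r₀ : ℤ) : Prop :=
  ∀ r : ℤ, r₀ ≤ r → ∀ p n : ℤ, B.zeroDiff F r p n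

/-- The part of total degree `n` of the bicomplex. -/
def totGr (n : ℤ) : Submodule k B.T := ⨆ p : ℤ, B.gr p (n - p)

/-- The degree-`n` homology of the total complex (of the quotient by `N`). -/
def Htot (n : ℤ) : Type :=
  ↥((B.totGr n ⊔ B.N) ⊓ Submodule.comap B.D B.N) ⧸
    Submodule.comap ((B.totGr n ⊔ B.N) ⊓ Submodule.comap B.D B.N).subtype
      (Submodule.map B.D (B.totGr (n + 1) ⊔ B.N) ⊔ B.N)

instance (n : ℤ) : AddCommGroup (B.Htot n) := inferInstanceAs (AddCommGroup (_ ⧸ _))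
instance (n : ℤ) : Module k (B.Htot n) := inferInstanceAs (Module k (_ ⧸ _))

/-- The graded piece `F_p H_n / F_{p-1} H_n` of the filtration induced by `F` on the homology
of the total complex. -/
def grHtot (F : ℤ → ℤ → Submodule k B.T) (p n : ℤ) : Type :=
  ↥((F p n ⊔ B.N) ⊓ Submodule.comap B.D B.N) ⧸
    Submodule.comap ((F p n ⊔ B.N) ⊓ Submodule.comap B.D B.N).subtype
      (((F (p - 1) n ⊔ B.N) ⊓ Submodule.comap B.D B.N) ⊔
        Submodule.map B.D (B.totGr (n + 1) ⊔ B.N) ⊔ B.N)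

instance (F : ℤ → ℤ → Submodule k B.T) (p n : ℤ) : AddCommGroup (B.grHtot F p n) :=
  inferInstanceAs (AddCommGroup (_ ⧸ _))
instance (F : ℤ → ℤ → Submodule k B.T) (p n : ℤ) : Module k (B.grHtot F p n) :=
  inferInstanceAs (Module k (_ ⧸ _))

/-- The spectral sequence of the filtration `F` converges to the homology of the total
complex: for every position the pages eventually stabilize and agree with the associated
graded of the induced filtration on the homology of the total complex. -/
def convergesTo (F : ℤ → ℤ → Submodule k B.T) : Prop :=
  ∀ p n : ℤ, ∃ r₀ : ℤ, ∀ r : ℤ, r₀ ≤ r →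
    Nonempty (B.Epage F r p n ≃ₗ[k] B.grHtot F p n)

end RelBicx
/-! ### Hochschild chains, the involution `τ`, and the Hochschild–Tate bicomplex (over `𝔽₂`) -/

section Hochschild

variable {A : DGA (ZMod 2)} (R M : DGBimod A)

/-- The ambient space `R ⊗ M` of the Hochschild chain complex `HC(A, M)` (with respect to the
resolution `R` of the diagonal bimodule): `HC(A,M) = (R ⊗ M)/rel2`. -/
abbrev T2 := R.V ⊗[ZMod 2] M.V

/-- The differential `∂(r ⊗ m) = ∂r ⊗ m + r ⊗ ∂m` (char. 2). -/
def d2 : T2 R M →ₗ[ZMod 2] T2 R M :=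
  TensorProduct.map R.d LinearMap.id + TensorProduct.map LinearMap.id M.d

/-- The grading of `R ⊗ M`. -/
def gr2 (n : ℤ) : Submodule (ZMod 2) (T2 R M) :=
  Submodule.span (ZMod 2)
    {z | ∃ i j, ∃ r ∈ R.gr i, ∃ m ∈ M.gr j, i + j = n ∧ z = r ⊗ₜ[ZMod 2] m}

/-- The Hochschild relations `ra ⊗ m ∼ r ⊗ am` and `ar ⊗ m ∼ r ⊗ ma` (char. 2). -/
def rel2 : Submodule (ZMod 2) (T2 R M) :=
  Submodule.span (ZMod 2)
    ({z | ∃ r a m, z = (R.actR r a) ⊗ₜ[ZMod 2] m + r ⊗ₜ[ZMod 2] (M.actL a m)} ∪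
     {z | ∃ r a m, z = (R.actL a r) ⊗ₜ[ZMod 2] m + r ⊗ₜ[ZMod 2] (M.actR m a)})

/-- The underlying space of the Hochschild chain complex `HC(A, M)`. -/
abbrev HCQ := T2 R M ⧸ rel2 R M

/-- The Hochschild homology `HH_n(A, M)` (computed from the chosen resolution `R → A`). -/
abbrev HH (n : ℤ) := Hgr (T2 R M) (gr2 R M) (rel2 R M) (d2 R M) n

/-- The ambient space `R ⊗ (M ⊗ (R ⊗ M))` of the Hochschild chain complex of the derived
tensor product: `HC(A, M ⊗̃_A M) = (R ⊗ (M ⊠ R ⊠ M))/∼ = (R ⊗ M ⊗ R ⊗ M)/rel4`. -/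
abbrev T4 := R.V ⊗[ZMod 2] (M.V ⊗[ZMod 2] (R.V ⊗[ZMod 2] M.V))

/-- The differential of `R ⊗ M ⊗ R ⊗ M` (char. 2; no signs). -/
def d4 : T4 R M →ₗ[ZMod 2] T4 R M :=
  TensorProduct.map R.d LinearMap.id +
  TensorProduct.map LinearMap.id (TensorProduct.map M.d LinearMap.id +
    TensorProduct.map LinearMap.id (TensorProduct.map R.d LinearMap.id +
      TensorProduct.map LinearMap.id M.d))

/-- The grading of `R ⊗ M ⊗ R ⊗ M`. -/
def gr4 (n : ℤ) : Submodule (ZMod 2) (T4 R M) :=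
  Submodule.span (ZMod 2)
    {z | ∃ i₁ j₁ i₂ j₂, ∃ r ∈ R.gr i₁, ∃ m ∈ M.gr j₁, ∃ r' ∈ R.gr i₂, ∃ m' ∈ M.gr j₂,
      i₁ + j₁ + i₂ + j₂ = n ∧ z = r ⊗ₜ[ZMod 2] (m ⊗ₜ[ZMod 2] (r' ⊗ₜ[ZMod 2] m'))}

/-- The combined relations presenting `HC(A, M ⊗̃_A M)` as a quotient of `R ⊗ M ⊗ R ⊗ M`:
the two relations of the naive tensor products `M ⊠_A R ⊠_A M` and the two outer Hochschild
relations (char. 2). -/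
def rel4 : Submodule (ZMod 2) (T4 R M) :=
  Submodule.span (ZMod 2)
    ({z | ∃ r a m r' m', z = (R.actR r a) ⊗ₜ[ZMod 2] (m ⊗ₜ[ZMod 2] (r' ⊗ₜ[ZMod 2] m')) +
        r ⊗ₜ[ZMod 2] ((M.actL a m) ⊗ₜ[ZMod 2] (r' ⊗ₜ[ZMod 2] m'))} ∪
     {z | ∃ r a m r' m', z = (R.actL a r) ⊗ₜ[ZMod 2] (m ⊗ₜ[ZMod 2] (r' ⊗ₜ[ZMod 2] m')) +
        r ⊗ₜ[ZMod 2] (m ⊗ₜ[ZMod 2] (r' ⊗ₜ[ZMod 2] (M.actR m' a)))} ∪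
     {z | ∃ r a m r' m', z = r ⊗ₜ[ZMod 2] ((M.actR m a) ⊗ₜ[ZMod 2] (r' ⊗ₜ[ZMod 2] m')) +
        r ⊗ₜ[ZMod 2] (m ⊗ₜ[ZMod 2] ((R.actL a r') ⊗ₜ[ZMod 2] m'))} ∪
     {z | ∃ r a m r' m', z = r ⊗ₜ[ZMod 2] (m ⊗ₜ[ZMod 2] ((R.actR r' a) ⊗ₜ[ZMod 2] m')) +
        r ⊗ₜ[ZMod 2] (m ⊗ₜ[ZMod 2] (r' ⊗ₜ[ZMod 2] (M.actL a m')))})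


instance {A : DGA (ZMod 2)} (R M : DGBimod A) :
    HasQuotient (T4 R M) (Submodule (ZMod 2) (T4 R M)) := Submodule.hasQuotient

/-- The underlying space of the Hochschild chain complex `HC(A, M ⊗̃_A M)`. -/
abbrev HCQ4 := T4 R M ⧸ rel4 R M

/-- The Hochschild homology `HH_n(A, M ⊗̃_A M)` of the derived tensor square. -/
abbrev HH4 (n : ℤ) := Hgr (T4 R M) (gr4 R M) (rel4 R M) (d4 R M) n

/-- The involution `τ` of `R ⊗ (M ⊗ (R ⊗ M))` exchanging the two halves:
`r ⊗ (m ⊗ (r' ⊗ m')) ↦ r' ⊗ (m' ⊗ (r ⊗ m))`. -/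
def tau4 : T4 R M →ₗ[ZMod 2] T4 R M :=
  ((TensorProduct.assoc (ZMod 2) R.V M.V (R.V ⊗[ZMod 2] M.V)).toLinearMap).comp
    (((TensorProduct.comm (ZMod 2) (R.V ⊗[ZMod 2] M.V) (R.V ⊗[ZMod 2] M.V)).toLinearMap).comp
      ((TensorProduct.assoc (ZMod 2) R.V M.V (R.V ⊗[ZMod 2] M.V)).symm.toLinearMap))

/-- The Hochschild–Tate bicomplex `HC^{Tate}(A, M ⊗̃_A M)`: the `ℤ`-periodic bicomplex whose
columns are the Hochschild complex of `M ⊗̃_A M` and whose horizontal differential is `1 + τ`. -/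
def TateBicx : RelBicx (ZMod 2) where
  T := ℤ →₀ T4 R M
  gr := fun p q => Submodule.map (Finsupp.lsingle p) (gr4 R M q)
  N := ⨅ p : ℤ, Submodule.comap (Finsupp.lapply p) (rel4 R M)
  dv := Finsupp.mapRange.linearMap (d4 R M)
  dh := (Finsupp.lmapDomain (T4 R M) (ZMod 2) (fun p => p - 1)).comp
    (Finsupp.mapRange.linearMap (LinearMap.id + tau4 R M))


/-- An element of the Hochschild–Tate bicomplex concentrated in column `p`. -/
def tateSingle (p : ℤ) (x : T4 R M) : (TateBicx R M).T := Finsupp.single p x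

/-- A dg bimodule `M` is `π`-formal (with respect to the resolution `R` of the diagonal
bimodule) if the spectral sequence `ʰᵛE` of the Hochschild–Tate bicomplex of `M ⊗̃_A M`
collapses at the `E³`-page; equivalently, all the induced operations
`d^{2i} : HH_k(A,M) → HH_{k-i}(A,M)`, `i ≥ 2`, vanish. -/
def PiFormalBimod : Prop := (TateBicx R M).collapsesAt (TateBicx R M).Frow 3

/-- A dg algebra is `π`-formal if every dg bimodule over it is `π`-formal. -/
def PiFormalAlg (R : DGBimod A) : Prop := ∀ M : DGBimod A, PiFormalBimod R M

end Hochschild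

/-- `M` is `d`-neutral: there is a class `f ∈ HH_d(A) = Hom(Σ^d A^!, A)` (represented by a
degree-`d` bimodule chain map `f : A^! → R`, with `R ≃ A` the chosen resolution of the
diagonal) such that precomposition with `f` induces an isomorphism
`f^* : HH^k(M) → HH_{d-k}(M)` for every `k`; here `HH^k(M) = Hom(Σ^{-k}A, M)` is modeled by
homotopy classes of degree-`(-k)` bimodule chain maps `R → M`, and `HH_{d-k}(M)` by homotopy
classes of degree-`(d-k)` bimodule chain maps `A^! → M`. -/
def IsDNeutral {A : DGA (ZMod 2)} (R Ab M : DGBimod A) (d : ℤ) : Prop :=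
  ∃ f : Ab.V →ₗ[ZMod 2] R.V, IsBHom Ab R d f ∧
    ∀ s : ℤ,
      (∀ g, IsBHom R M s g → (g.comp f) ∈ nullHtpSub Ab M (s + d) →
        g ∈ nullHtpSub R M s) ∧
      (∀ h, IsBHom Ab M (s + d) h →
        ∃ g, IsBHom R M s g ∧ h - g.comp f ∈ nullHtpSub Ab M (s + d))

/-- `M` is neutral if it is `d`-neutral for some `d`. -/
def IsNeutral {A : DGA (ZMod 2)} (R Ab M : DGBimod A) : Prop :=
  ∃ d : ℤ, IsDNeutral R Ab M d


section piece1
/-! ### Part 1: abstract Tate data -/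

/-- Abstract package for the Hochschild–Tate spectral sequence. -/
structure TD : Type 1 where
  T2 : Type
  K : Type
  [a2 : AddCommGroup T2]
  [m2 : Module (ZMod 2) T2]
  [aK : AddCommGroup K]
  [mK : Module (ZMod 2) K]
  rel2 : Submodule (ZMod 2) T2
  gr2 : ℤ → Submodule (ZMod 2) T2
  d2 : T2 →ₗ[ZMod 2] T2
  gr : ℤ → Submodule (ZMod 2) K
  d : K →ₗ[ZMod 2] K
  tau : K →ₗ[ZMod 2] K
  mul : T2 →ₗ[ZMod 2] T2 →ₗ[ZMod 2] K
  d_d : ∀ x, d (d x) = 0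
  d_gr : ∀ n, ∀ x ∈ gr n, d x ∈ gr (n - 1)
  tau_tau : ∀ x, tau (tau x) = x
  tau_gr : ∀ n, ∀ x ∈ gr n, tau x ∈ gr n
  tau_d : ∀ x, tau (d x) = d (tau x)
  tau_mul : ∀ x y, tau (mul x y) = mul y x
  d_mul : ∀ x y, d (mul x y) = mul (d2 x) y + mul x (d2 y)
  mul_gr : ∀ i j, ∀ x ∈ gr2 i, ∀ y ∈ gr2 j, mul x y ∈ gr (i + j)
  d2_gr : ∀ n, ∀ x ∈ gr2 n, d2 x ∈ gr2 (n - 1)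
  d2_d2 : ∀ x, d2 (d2 x) = 0
  surj_even : ∀ k, ∀ x ∈ gr (2 * k), x + tau x = 0 →
    ∃ z ∈ gr2 k, ∃ y ∈ gr (2 * k), x = mul z z + (y + tau y)
  surj_odd : ∀ k, ∀ x ∈ gr (2 * k + 1), x + tau x = 0 →
    ∃ y ∈ gr (2 * k + 1), x = y + tau y
  inj : ∀ z y, mul z z = y + tau y → z ∈ rel2
  homog : ∀ k, ∀ z ∈ gr2 k, z ∈ rel2 → ∃ y ∈ gr (2 * k), mul z z = y + tau y

attribute [instance] TD.a2 TD.aK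
attribute [instance 2000] TD.m2 TD.mK

theorem z2_add_self {V : Type*} [AddCommGroup V] [Module (ZMod 2) V] (x : V) : x + x = 0 :=
  ZModModule.add_self x

theorem z2_eq_of_add {V : Type*} [AddCommGroup V] [Module (ZMod 2) V] {x y : V}
    (h : x + y = 0) : x = y := by
  have := ZModModule.neg_eq_self y
  rw [← this]; exact eq_neg_of_add_eq_zero_left h

theorem z2_add_cancel {V : Type*} [AddCommGroup V] [Module (ZMod 2) V] (x y : V) :
    x + (x + y) = y := by
  rw [← add_assoc, z2_add_self, zero_add]

theorem z2_neg {V : Type*} [AddCommGroup V] [Module (ZMod 2) V] (x : V) : -x = x :=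
  ZModModule.neg_eq_self x

theorem z2_sub {V : Type*} [AddCommGroup V] [Module (ZMod 2) V] (x y : V) : x - y = x + y :=
  ZModModule.sub_eq_add x y

namespace TD

variable (E : TD)

/-- The total differential, as a function. -/
def dd (x : ℤ →₀ E.K) (c : ℤ) : E.K := E.d (x c) + (x (c + 1) + E.tau (x (c + 1)))

theorem dd_add (x y : ℤ →₀ E.K) (c : ℤ) : E.dd (x + y) c = E.dd x c + E.dd y c := by
  simp only [dd, Finsupp.add_apply, map_add]; abel

theorem dd_single_self (a : ℤ) (u : E.K) : E.dd (Finsupp.single a u) a = E.d u := by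
  simp [dd]

theorem dd_single_pred (a : ℤ) (u : E.K) : E.dd (Finsupp.single a u) (a - 1) = u + E.tau u := by
  simp [dd]

theorem dd_single_ne (a c : ℤ) (u : E.K) (h1 : c ≠ a) (h2 : c + 1 ≠ a) :
    E.dd (Finsupp.single a u) c = 0 := by
  simp [dd, Finsupp.single_apply, h1.symm, h2.symm]

theorem dd_single (a c : ℤ) (u : E.K) : E.dd (Finsupp.single a u) c =
    (if c = a then E.d u else 0) + (if c + 1 = a then u + E.tau u else 0) := by
  by_cases h1 : c = a
  · subst h1; simp [dd]
  · by_cases h2 : c + 1 = a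
    · subst h2; simp [dd]
    · rw [E.dd_single_ne a c u h1 h2]; simp [h1, h2]

theorem dd_gr (n : ℤ) (x : ℤ →₀ E.K) (hx : ∀ c, x c ∈ E.gr (n - c)) (c : ℤ) :
    E.dd x c ∈ E.gr (n - 1 - c) := by
  refine Submodule.add_mem _ ?_ (Submodule.add_mem _ ?_ ?_)
  · have := E.d_gr _ _ (hx c); rwa [show n - c - 1 = n - 1 - c by ring] at this
  · have := hx (c + 1); rwa [show n - (c + 1) = n - 1 - c by ring] at this
  · have := E.tau_gr _ _ (hx (c + 1)); rwa [show n - (c + 1) = n - 1 - c by ring] at this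

/-- Approximate cycles. -/
def Zp (r p n : ℤ) (x : ℤ →₀ E.K) : Prop :=
  (∀ c, x c ∈ E.gr (n - c)) ∧ (∀ c, p < n - c → x c = 0) ∧
    (∀ c, p - r < n - 1 - c → E.dd x c = 0)

variable {E}

theorem Zp.add {r p n : ℤ} {x y : ℤ →₀ E.K} (hx : E.Zp r p n x) (hy : E.Zp r p n y) :
    E.Zp r p n (x + y) := by
  refine ⟨fun c => Submodule.add_mem _ (hx.1 c) (hy.1 c), fun c hc => ?_, fun c hc => ?_⟩
  · simp [hx.2.1 c hc, hy.2.1 c hc]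
  · rw [dd_add, hx.2.2 c hc, hy.2.2 c hc, add_zero]

theorem Zp.mono {r r' p n : ℤ} {x : ℤ →₀ E.K} (hx : E.Zp r p n x) (h : r' ≤ r) :
    E.Zp r' p n x :=
  ⟨hx.1, hx.2.1, fun c hc => hx.2.2 c (by omega)⟩

variable (E)

/-- Collapse at the third page. -/
def Collapse : Prop := ∀ r : ℤ, 3 ≤ r → ∀ p n : ℤ, ∀ x, E.Zp r p n x →
  ∃ x', E.Zp (r - 1) (p - 1) n x' ∧ E.Zp (r + 1) p n (x + x')

def Good (k : ℤ) (z : E.T2) : Prop := ∀ r n : ℤ, ∃ x, E.Zp r (2 * k) n x ∧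
  ∃ y ∈ E.gr (2 * k), x (n - 2 * k) = E.mul z z + (y + E.tau y)

variable {E}

theorem mul_sq_add (z w : E.T2) : E.mul (z + w) (z + w) =
    E.mul z z + E.mul w w + (E.mul z w + E.tau (E.mul z w)) := by
  rw [E.tau_mul]; simp only [map_add, LinearMap.add_apply]; abel

theorem tau_sum_inv (y : E.K) : (y + E.tau y) + E.tau (y + E.tau y) = 0 := by
  rw [map_add, E.tau_tau, add_comm (E.tau y) y]; exact z2_add_self _

/-- Leading term analysis in an even row. -/
theorem lead_even {k n : ℤ} {x : ℤ →₀ E.K} (hx : E.Zp 2 (2 * k) n x) :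
    ∃ z ∈ E.gr2 k, ∃ y ∈ E.gr (2 * k), x (n - 2 * k) = E.mul z z + (y + E.tau y) ∧
      ∃ y3 : E.K, E.dd x (n - 2 * k + 1) = E.mul (E.d2 z) (E.d2 z) + (y3 + E.tau y3) := by
  obtain ⟨h1, h2, h3⟩ := hx
  have e0 := h3 (n - 2 * k - 1) (by omega)
  have e1 := h3 (n - 2 * k) (by omega)
  have e2 : x (n - 2 * k - 1) = 0 := h2 _ (by omega)
  rw [dd, e2, map_zero, zero_add, sub_add_cancel] at e0
  have hg : x (n - 2 * k) ∈ E.gr (2 * k) := by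
    have := h1 (n - 2 * k); rwa [show n - (n - 2 * k) = 2 * k by ring] at this
  obtain ⟨z, hz, y, hy, hxy⟩ := E.surj_even k _ hg e0
  refine ⟨z, hz, y, hy, hxy, ?_⟩
  have hg1 : x (n - 2 * k + 1) ∈ E.gr (2 * (k - 1) + 1) := by
    have := h1 (n - 2 * k + 1)
    rwa [show n - (n - 2 * k + 1) = 2 * (k - 1) + 1 by ring] at this
  set t : E.K := E.mul z (E.d2 z) + E.d y + x (n - 2 * k + 1) with ht
  have htg : t ∈ E.gr (2 * (k - 1) + 1) := by
    refine Submodule.add_mem _ (Submodule.add_mem _ ?_ ?_) hg1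
    · have := E.mul_gr _ _ _ hz _ (E.d2_gr _ _ hz)
      rwa [show k + (k - 1) = 2 * (k - 1) + 1 by ring] at this
    · have := E.d_gr _ _ hy
      rwa [show 2 * k - 1 = 2 * (k - 1) + 1 by ring] at this
  have htt : t + E.tau t = 0 := by
    rw [dd, hxy] at e1
    rw [← e1, ht]
    simp only [map_add, E.d_mul, E.tau_mul, E.tau_d]
    abel
  obtain ⟨y2, -, hy2⟩ := E.surj_odd _ _ htg htt
  have hx1 : x (n - 2 * k + 1) = E.mul z (E.d2 z) + E.d y + (y2 + E.tau y2) := by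
    rw [← hy2, ht, z2_add_cancel]
  refine ⟨E.d y2 + x (n - 2 * k + 1 + 1), ?_⟩
  rw [dd, hx1]
  simp only [map_add, E.d_mul, E.d_d, E.d2_d2, E.tau_d, map_zero, add_zero]
  abel

theorem lead_even3 {k n : ℤ} {x : ℤ →₀ E.K} (hx : E.Zp 3 (2 * k) n x) :
    ∃ z ∈ E.gr2 k, E.d2 z ∈ E.rel2 ∧ ∃ y ∈ E.gr (2 * k),
      x (n - 2 * k) = E.mul z z + (y + E.tau y) := by
  obtain ⟨z, hz, y, hy, h, y3, h3⟩ := lead_even (hx.mono (by norm_num))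
  refine ⟨z, hz, ?_, y, hy, h⟩
  rw [hx.2.2 _ (by omega)] at h3
  exact E.inj _ y3 (z2_eq_of_add h3.symm)

theorem lead_odd {k n r : ℤ} (hr : 1 ≤ r) {x : ℤ →₀ E.K} (hx : E.Zp r (2 * k + 1) n x) :
    ∃ y ∈ E.gr (2 * k + 1), x (n - (2 * k + 1)) = y + E.tau y := by
  obtain ⟨h1, h2, h3⟩ := hx
  have e0 := h3 (n - (2 * k + 1) - 1) (by omega)
  have e2 : x (n - (2 * k + 1) - 1) = 0 := h2 _ (by omega)
  rw [dd, e2, map_zero, zero_add, sub_add_cancel] at e0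
  have hg : x (n - (2 * k + 1)) ∈ E.gr (2 * k + 1) := by
    have := h1 (n - (2 * k + 1))
    rwa [show n - (n - (2 * k + 1)) = 2 * k + 1 by ring] at this
  exact E.surj_odd k _ hg e0

theorem single_gr {n c : ℤ} {u : E.K} (hu : u ∈ E.gr (n - c)) (c' : ℤ) :
    (Finsupp.single c u) c' ∈ E.gr (n - c') := by
  by_cases h : c = c'
  · subst h; simpa using hu
  · simp [Finsupp.single_apply, h]

theorem boundary_Zp {p n : ℤ} (r : ℤ) {y : E.K} (hy : y ∈ E.gr p) :
    E.Zp r p n (Finsupp.single (n - p) (y + E.tau y) + Finsupp.single (n - p + 1) (E.d y)) := by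
  refine ⟨fun c => Submodule.add_mem _ (single_gr ?_ c) (single_gr ?_ c), fun c hc => ?_,
    fun c hc => ?_⟩
  · rw [show n - (n - p) = p by ring]
    exact Submodule.add_mem _ hy (E.tau_gr _ _ hy)
  · rw [show n - (n - p + 1) = p - 1 by ring]
    exact E.d_gr _ _ hy
  · have h1 : n - p ≠ c := by omega
    have h2 : n - p + 1 ≠ c := by omega
    simp [Finsupp.single_apply, h1, h2]
  · rw [dd_add, dd_single, dd_single]
    by_cases h1 : c = n - p
    · have h2 : ¬ c = n - p + 1 := by omega
      have h3 : ¬ c + 1 = n - p := by omega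
      have h4 : c + 1 = n - p + 1 := by omega
      rw [if_pos h1, if_neg h2, if_neg h3, if_pos h4]
      simp only [map_add, E.tau_d, add_zero, zero_add]
      exact z2_add_self _
    · by_cases h2 : c = n - p + 1
      · have h3 : ¬ c + 1 = n - p := by omega
        have h4 : ¬ c + 1 = n - p + 1 := by omega
        rw [if_neg h1, if_pos h2, if_neg h3, if_neg h4]
        simp [E.d_d]
      · have h4 : ¬ c + 1 = n - p + 1 := by omega
        rw [if_neg h1, if_neg h2, if_neg h4]
        by_cases h3 : c + 1 = n - p
        · rw [if_pos h3, tau_sum_inv]; simp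
        · rw [if_neg h3]; simp

theorem collapse_step {r p n : ℤ} {x w : ℤ →₀ E.K} (hx : E.Zp r p n x)
    (hw : E.Zp (r + 1) p n w) {y : E.K} (hy : y ∈ E.gr p)
    (h : x (n - p) + w (n - p) = y + E.tau y) :
    ∃ x', E.Zp (r - 1) (p - 1) n x' ∧ E.Zp (r + 1) p n (x + x') := by
  have hb := boundary_Zp (E := E) (n := n) (r + 1) hy
  set b := Finsupp.single (n - p) (y + E.tau y) + Finsupp.single (n - p + 1) (E.d y) with hbdef
  have hwb := hw.add hb
  refine ⟨x + (w + b), ?_, ?_⟩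
  · have hs := hx.add (hwb.mono (by omega : r ≤ r + 1))
    refine ⟨hs.1, fun c hc => ?_, fun c hc => hs.2.2 c (by omega)⟩
    by_cases hc' : p < n - c
    · exact hs.2.1 c hc'
    · obtain rfl : c = n - p := by omega
      have : b (n - p) = y + E.tau y := by
        simp [hbdef, Finsupp.single_apply]
      rw [Finsupp.add_apply, Finsupp.add_apply, this, ← add_assoc, h]
      exact z2_add_self _
  · rw [z2_add_cancel]; exact hwb

theorem collapse_of_good
    (H : ∀ k, ∀ z ∈ E.gr2 k, E.d2 z ∈ E.rel2 → E.Good k z) : E.Collapse := by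
  intro r hr p n x hx
  rcases Int.even_or_odd' p with ⟨k, rfl | rfl⟩
  · obtain ⟨z, hz, hdz, y, hy, h⟩ := lead_even3 (hx.mono hr)
    obtain ⟨w, hw, y', hy', h'⟩ := H k z hz hdz (r + 1) n
    refine collapse_step hx hw (Submodule.add_mem _ hy hy') ?_
    rw [h, h', map_add]
    have := z2_add_self (E.mul z z)
    calc _ = (E.mul z z + E.mul z z) + ((y + y') + (E.tau y + E.tau y')) := by abel
      _ = _ := by rw [this, zero_add]
  · obtain ⟨y, hy, h⟩ := lead_odd (by omega) hx
    refine collapse_step (w := 0) hx ⟨?_, ?_, ?_⟩ hy ?_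
    · intro c; simp
    · intro c _; simp
    · intro c _; simp [dd]
    · simpa using h

theorem good_of_collapse (H : E.Collapse) {k : ℤ} {z : E.T2} (hz : z ∈ E.gr2 k)
    (hdz : E.d2 z ∈ E.rel2) : E.Good k z := by
  intro r n
  have key : ∀ m : ℕ, ∃ x, E.Zp (3 + m) (2 * k) n x ∧ x (n - 2 * k) = E.mul z z := by
    intro m
    induction m with
    | zero =>
      obtain ⟨y, hy, hyz⟩ := E.homog _ _ (E.d2_gr _ _ hz) hdz
      refine ⟨Finsupp.single (n - 2 * k) (E.mul z z) +
        Finsupp.single (n - 2 * k + 1) (E.mul z (E.d2 z)) +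
        Finsupp.single (n - 2 * k + 2) y, ⟨fun c => ?_, fun c hc => ?_, fun c hc => ?_⟩, ?_⟩
      · refine Submodule.add_mem _ (Submodule.add_mem _ (single_gr ?_ c) (single_gr ?_ c))
          (single_gr ?_ c)
        · rw [show n - (n - 2 * k) = k + k by ring]; exact E.mul_gr _ _ _ hz _ hz
        · rw [show n - (n - 2 * k + 1) = k + (k - 1) by ring]
          exact E.mul_gr _ _ _ hz _ (E.d2_gr _ _ hz)
        · rw [show n - (n - 2 * k + 2) = 2 * (k - 1) by ring]; exact hy
      · have h1 : n - 2 * k ≠ c := by omega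
        have h2 : n - 2 * k + 1 ≠ c := by omega
        have h3 : n - 2 * k + 2 ≠ c := by omega
        simp [Finsupp.single_apply, h1, h2, h3]
      · have hc' : c < n - 2 * k + 2 := by push_cast at hc; omega
        simp only [dd_add, dd_single]
        by_cases a1 : c = n - 2 * k - 1
        · subst a1
          have b1 : ¬ (n - 2 * k - 1 = n - 2 * k) := by omega
          have b2 : ¬ (n - 2 * k - 1 = n - 2 * k + 1) := by omega
          have b3 : ¬ (n - 2 * k - 1 = n - 2 * k + 2) := by omega
          have b4 : (n - 2 * k - 1 + 1 = n - 2 * k) := by omega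
          have b5 : ¬ (n - 2 * k - 1 + 1 = n - 2 * k + 1) := by omega
          have b6 : ¬ (n - 2 * k - 1 + 1 = n - 2 * k + 2) := by omega
          simp only [if_neg b1, if_neg b2, if_neg b3, if_pos b4, if_neg b5, if_neg b6, E.tau_mul]
          simp [z2_add_self]
        by_cases a2 : c = n - 2 * k
        · subst a2
          have b2 : ¬ (n - 2 * k = n - 2 * k + 1) := by omega
          have b3 : ¬ (n - 2 * k = n - 2 * k + 2) := by omega
          have b4 : ¬ (n - 2 * k + 1 = n - 2 * k) := by omega
          have b6 : ¬ (n - 2 * k + 1 = n - 2 * k + 2) := by omega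
          simp only [if_true, if_neg b2, if_neg b3, if_neg b4, if_neg b6, E.tau_mul, E.d_mul,
            add_zero, zero_add]
          rw [add_comm (E.mul z (E.d2 z))]
          exact z2_add_self _
        by_cases a3 : c = n - 2 * k + 1
        · subst a3
          have b1 : ¬ (n - 2 * k + 1 = n - 2 * k) := by omega
          have b3 : ¬ (n - 2 * k + 1 = n - 2 * k + 2) := by omega
          have b4 : ¬ (n - 2 * k + 1 + 1 = n - 2 * k) := by omega
          have b5 : ¬ (n - 2 * k + 1 + 1 = n - 2 * k + 1) := by omega
          have b6 : (n - 2 * k + 1 + 1 = n - 2 * k + 2) := by omega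
          simp only [if_true, if_neg b1, if_neg b3, if_neg b4, if_neg b5, if_pos b6, E.d_mul,
            add_zero, zero_add, E.d2_d2, map_zero, hyz]
          exact z2_add_self _
        · have b1 : ¬ (c = n - 2 * k + 2) := by omega
          have b4 : ¬ (c + 1 = n - 2 * k) := by omega
          have b5 : ¬ (c + 1 = n - 2 * k + 1) := by omega
          have b6 : ¬ (c + 1 = n - 2 * k + 2) := by omega
          simp [a2, a3, b1, b4, b5, b6]
      · simp [Finsupp.single_apply]
    | succ m ih =>
      obtain ⟨x, hx, hxz⟩ := ih
      obtain ⟨x', hx', hxx'⟩ := H _ (by omega) _ _ x hx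
      refine ⟨x + x', by push_cast; rw [← add_assoc]; exact hxx', ?_⟩
      rw [Finsupp.add_apply, hx'.2.1 _ (by omega), add_zero, hxz]
  obtain ⟨x, hx, hxz⟩ := key r.toNat
  exact ⟨x, hx.mono (by omega), 0, Submodule.zero_mem _, by simp [hxz]⟩

theorem Good.add {k : ℤ} {z w : E.T2} (hzg : z ∈ E.gr2 k) (hwg : w ∈ E.gr2 k)
    (hz : E.Good k z) (hw : E.Good k w) : E.Good k (z + w) := by
  intro r n
  obtain ⟨x, hx, y, hy, h⟩ := hz r n
  obtain ⟨x', hx', y', hy', h'⟩ := hw r n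
  have hm : E.mul z w ∈ E.gr (2 * k) := by
    have := E.mul_gr _ _ _ hzg _ hwg; rwa [← two_mul] at this
  refine ⟨x + x', hx.add hx', y + y' + E.mul z w,
    Submodule.add_mem _ (Submodule.add_mem _ hy hy') hm, ?_⟩
  rw [Finsupp.add_apply, h, h', mul_sq_add]
  simp only [map_add]
  have := z2_add_self (E.mul z w + E.tau (E.mul z w))
  calc _ = E.mul z z + E.mul w w + (y + y' + (E.tau y + E.tau y')) := by abel
    _ = E.mul z z + E.mul w w + (y + y' + (E.tau y + E.tau y')) +
      ((E.mul z w + E.tau (E.mul z w)) + (E.mul z w + E.tau (E.mul z w))) := by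
        rw [this, add_zero]
    _ = _ := by abel

theorem good_rel {k : ℤ} {z : E.T2} (hzg : z ∈ E.gr2 k) (hz : z ∈ E.rel2) : E.Good k z := by
  intro r n
  obtain ⟨y, hy, h⟩ := E.homog k z hzg hz
  refine ⟨0, ⟨fun c => by simp, fun c _ => by simp, fun c _ => by simp [dd]⟩, y, hy, ?_⟩
  rw [h, z2_add_self]; rfl

theorem good_cycle {k : ℤ} {z : E.T2} (hzg : z ∈ E.gr2 k) (hz : E.d2 z = 0) : E.Good k z := by
  intro r n
  refine ⟨Finsupp.single (n - 2 * k) (E.mul z z),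
    ⟨fun c => single_gr ?_ c, fun c hc => ?_, fun c _ => ?_⟩, 0, Submodule.zero_mem _, by simp⟩
  · rw [show n - (n - 2 * k) = k + k by ring]; exact E.mul_gr _ _ _ hzg _ hzg
  · have h1 : n - 2 * k ≠ c := by omega
    simp [Finsupp.single_apply, h1]
  · rw [dd_single, E.d_mul, hz, E.tau_mul, z2_add_self]; simp

/-- Morphisms of Tate data of degree `s`. -/
structure Hom (E E' : TD) (s : ℤ) where
  f2 : E.T2 →ₗ[ZMod 2] E'.T2
  f : E.K →ₗ[ZMod 2] E'.K
  f2_gr : ∀ n, ∀ x ∈ E.gr2 n, f2 x ∈ E'.gr2 (n + s)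
  f_gr : ∀ n, ∀ x ∈ E.gr n, f x ∈ E'.gr (n + 2 * s)
  f2_rel : ∀ x ∈ E.rel2, f2 x ∈ E'.rel2
  f2_d : ∀ x, f2 (E.d2 x) = E'.d2 (f2 x)
  f_d : ∀ x, f (E.d x) = E'.d (f x)
  f_tau : ∀ x, f (E.tau x) = E'.tau (f x)
  f_mul : ∀ x y, f (E.mul x y) = E'.mul (f2 x) (f2 y)

theorem Hom.dd {E E' : TD} {s : ℤ} (φ : Hom E E' s) (x : ℤ →₀ E.K) (c : ℤ) :
    E'.dd (Finsupp.mapRange.linearMap φ.f x) c = φ.f (E.dd x c) := by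
  simp [TD.dd, φ.f_d, φ.f_tau]

theorem Hom.Zp {E E' : TD} {s : ℤ} (φ : Hom E E' s) {r p n : ℤ} {x : ℤ →₀ E.K}
    (hx : E.Zp r p n x) :
    E'.Zp r (p + 2 * s) (n + 2 * s) (Finsupp.mapRange.linearMap φ.f x) := by
  refine ⟨fun c => ?_, fun c hc => ?_, fun c hc => ?_⟩
  · have := φ.f_gr _ _ (hx.1 c)
    rw [show n - c + 2 * s = n + 2 * s - c by ring] at this
    simpa using this
  · simp [hx.2.1 c (by omega)]
  · rw [φ.dd, hx.2.2 c (by omega), map_zero]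

theorem Hom.good {E E' : TD} {s : ℤ} (φ : Hom E E' s) {k : ℤ} {z : E.T2} (hz : E.Good k z) :
    E'.Good (k + s) (φ.f2 z) := by
  intro r n
  obtain ⟨x, hx, y, hy, h⟩ := hz r (n - 2 * s)
  have hx' := φ.Zp hx
  rw [show n - 2 * s + 2 * s = n by ring, show 2 * k + 2 * s = 2 * (k + s) by ring] at hx'
  have hy' := φ.f_gr _ _ hy
  rw [show 2 * k + 2 * s = 2 * (k + s) by ring] at hy'
  refine ⟨_, hx', φ.f y, hy', ?_⟩
  rw [show n - 2 * (k + s) = n - 2 * s - 2 * k by ring]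
  simp only [Finsupp.mapRange.linearMap_apply, Finsupp.mapRange_apply]
  rw [h, map_add, map_add, φ.f_mul, φ.f_tau]

theorem collapse_low (H : E.Collapse) (m : ℕ) : ∀ p n : ℤ, ∀ x, E.Zp (3 + m) p n x →
    ∃ u, E.Zp 2 (p - (3 + m) + 2) n u ∧ E.Zp (3 + m + 1) p n (x + u) := by
  induction m with
  | zero =>
    intro p n x hx
    obtain ⟨x', h1, h2⟩ := H _ (by omega) p n x hx
    refine ⟨x', ?_, h2⟩
    rw [show p - (3 + ((0 : ℕ) : ℤ)) + 2 = p - 1 by push_cast; ring]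
    simpa using h1
  | succ m ih =>
    intro p n x hx
    obtain ⟨x', h1, h2⟩ := H _ (by omega) p n x hx
    rw [show (3 + ((m + 1 : ℕ) : ℤ)) - 1 = 3 + m by push_cast; ring] at h1
    obtain ⟨u, h3, h4⟩ := ih _ _ _ h1
    refine ⟨u, ?_, ?_⟩
    · rwa [show p - (3 + ((m + 1 : ℕ) : ℤ)) + 2 = p - 1 - (3 + m) + 2 by push_cast; ring]
    · have : x + u = (x + x') + (x' + u) := by
        rw [add_assoc, z2_add_cancel]
      rw [this]
      refine h2.add ⟨h4.1, fun c hc => h4.2.1 c (by omega), fun c hc => h4.2.2 c ?_⟩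
      push_cast at hc; omega

theorem collapse_of_inj {E E' : TD} {s : ℤ} (φ : Hom E E' s) (H : E'.Collapse)
    (hinj : ∀ k, ∀ z ∈ E.gr2 k, E.d2 z ∈ E.rel2 →
      (∃ v ∈ E'.gr2 (k + s + 1), φ.f2 z + E'.d2 v ∈ E'.rel2) →
      ∃ v ∈ E.gr2 (k + 1), z + E.d2 v ∈ E.rel2) : E.Collapse := by
  intro r hr p n x hx
  -- the differential of x
  have hddgr := E.dd_gr n x hx.1
  set t : ℤ →₀ E.K := Finsupp.mapRange.linearMap E.d x +
    Finsupp.mapDomain (fun p => p - 1)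
      (Finsupp.mapRange.linearMap (LinearMap.id + E.tau) x) with ht
  have htdd : ∀ c, t c = E.dd x c := by
    intro c
    have hinjf : Function.Injective (fun p : ℤ => p - 1) := fun a b h => by
      simpa using h
    have := Finsupp.mapDomain_apply hinjf
      (Finsupp.mapRange.linearMap (LinearMap.id + E.tau) x) (c + 1)
    simp only [add_sub_cancel_right] at this
    rw [ht, Finsupp.add_apply, this]
    simp [dd]
  have htZ : ∀ r', E.Zp r' (p - r) (n - 1) t := by
    intro r'
    refine ⟨fun c => ?_, fun c hc => ?_, fun c _ => ?_⟩
    · rw [htdd]; exact hddgr c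
    · rw [htdd]; exact hx.2.2 c hc
    · rw [dd, htdd, htdd, dd, dd]
      simp only [map_add, E.d_d, E.tau_d, E.tau_tau, zero_add]
      have h1 := z2_add_self (E.d (x (c + 1)))
      have h2 := z2_add_self (E.d (E.tau (x (c + 1))))
      have h3 := z2_add_self (x (c + 1 + 1))
      have h4 := z2_add_self (E.tau (x (c + 1 + 1)))
      calc _ = (E.d (x (c + 1)) + E.d (x (c + 1))) +
            (E.d (E.tau (x (c + 1))) + E.d (E.tau (x (c + 1)))) +
            (x (c + 1 + 1) + x (c + 1 + 1)) +
            (E.tau (x (c + 1 + 1)) + E.tau (x (c + 1 + 1))) := by abel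
        _ = 0 := by rw [h1, h2, h3, h4]; simp
  -- it is enough to find x' with small support and the right leading differential
  have fin : ∀ x' : ℤ →₀ E.K, (∀ c, x' c ∈ E.gr (n - c)) →
      (∀ c, p - r + 2 < n - c → x' c = 0) →
      (∀ c, p - r < n - 1 - c → E.dd x' c = 0) →
      (E.dd x (n - 1 - (p - r)) = E.dd x' (n - 1 - (p - r))) →
      ∃ x', E.Zp (r - 1) (p - 1) n x' ∧ E.Zp (r + 1) p n (x + x') := by
    intro x' h1 h2 h3 h4
    refine ⟨x', ⟨h1, fun c hc => h2 c (by omega), fun c hc => h3 c (by omega)⟩,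
      fun c => Submodule.add_mem _ (hx.1 c) (h1 c), fun c hc => ?_, fun c hc => ?_⟩
    · rw [Finsupp.add_apply, hx.2.1 c hc, h2 c (by omega), add_zero]
    · rw [dd_add]
      by_cases hc' : p - r < n - 1 - c
      · rw [hx.2.2 c hc', h3 c hc', add_zero]
      · obtain rfl : c = n - 1 - (p - r) := by omega
        rw [h4, z2_add_self]
  obtain ⟨q, hq⟩ : ∃ q, q = p - r := ⟨_, rfl⟩
  rw [← hq] at fin htZ
  rcases Int.even_or_odd' q with ⟨j, rfl | rfl⟩
  · obtain ⟨z, hz, hdz, y, hy, h⟩ := lead_even3 (htZ 3)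
    obtain ⟨v0, hv0, hrel⟩ : ∃ v ∈ E.gr2 (j + 1), z + E.d2 v ∈ E.rel2 := by
      apply hinj j z hz hdz
      obtain ⟨m, rfl⟩ : ∃ m : ℕ, r = 3 + m := ⟨(r - 3).toNat, by omega⟩
      obtain ⟨u, hu1, hu2⟩ := collapse_low H m _ _ _ (φ.Zp hx)
      rw [show p + 2 * s - (3 + (m : ℤ)) + 2 = 2 * (j + s + 1) by omega] at hu1
      obtain ⟨v, hv, yy, hyy, -, y3, h3⟩ := lead_even hu1
      refine ⟨v, hv, ?_⟩
      have e := hu2.2.2 (n - 1 - 2 * j) (by omega)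
      rw [dd_add, φ.dd, ← htdd, h,
        show n - 1 - 2 * j = n + 2 * s - 2 * (j + s + 1) + 1 by ring, h3, map_add, map_add,
        φ.f_mul, φ.f_tau] at e
      apply E'.inj _ (φ.f y + y3 + E'.mul (φ.f2 z) (E'.d2 v))
      rw [mul_sq_add]
      apply z2_eq_of_add
      have h5 := z2_add_self (E'.mul (φ.f2 z) (E'.d2 v) + E'.tau (E'.mul (φ.f2 z) (E'.d2 v)))
      simp only [map_add]
      calc _ = (E'.mul (φ.f2 z) (φ.f2 z) + (φ.f y + E'.tau (φ.f y)) +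
            (E'.mul (E'.d2 v) (E'.d2 v) + (y3 + E'.tau y3))) +
            ((E'.mul (φ.f2 z) (E'.d2 v) + E'.tau (E'.mul (φ.f2 z) (E'.d2 v))) +
            (E'.mul (φ.f2 z) (E'.d2 v) + E'.tau (E'.mul (φ.f2 z) (E'.d2 v)))) := by abel
        _ = 0 := by rw [e, h5, add_zero]
    have hdv : E.d2 v0 ∈ E.gr2 j := by
      have := E.d2_gr _ _ hv0; rwa [add_sub_cancel_right] at this
    obtain ⟨y5, hy5, h5⟩ := E.homog j _ (Submodule.add_mem _ hz hdv) hrel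
    set y6 := y + y5 + E.mul z (E.d2 v0) with hy6
    have hy6g : y6 ∈ E.gr (2 * j) := by
      refine Submodule.add_mem _ (Submodule.add_mem _ hy hy5) ?_
      have := E.mul_gr _ _ _ hz _ hdv; rwa [← two_mul] at this
    have hlead : E.dd x (n - 1 - 2 * j) = E.mul (E.d2 v0) (E.d2 v0) + (y6 + E.tau y6) := by
      rw [← htdd, h]
      apply z2_eq_of_add
      rw [hy6]; simp only [map_add]
      rw [mul_sq_add] at h5
      have h7 := z2_add_self (y + E.tau y)
      have h8 := z2_add_self (y5 + E.tau y5)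
      calc _ = (E.mul z z + E.mul (E.d2 v0) (E.d2 v0) +
            (E.mul z (E.d2 v0) + E.tau (E.mul z (E.d2 v0)))) + (y5 + E.tau y5) +
            ((y + E.tau y) + (y + E.tau y)) := by abel
        _ = 0 := by rw [h5, h7, h8, add_zero]
    apply fin (Finsupp.single (n - 1 - 2 * j) (E.mul v0 (E.d2 v0)) +
        Finsupp.single (n - 1 - 2 * j - 1) (E.mul v0 v0) +
        Finsupp.single (n - 1 - 2 * j + 1) y6)
    · intro c
      refine Submodule.add_mem _ (Submodule.add_mem _ (single_gr ?_ c) (single_gr ?_ c))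
          (single_gr ?_ c)
      · rw [show n - (n - 1 - 2 * j) = (j + 1) + j by ring]; exact E.mul_gr _ _ _ hv0 _ hdv
      · rw [show n - (n - 1 - 2 * j - 1) = (j + 1) + (j + 1) by ring]
        exact E.mul_gr _ _ _ hv0 _ hv0
      · rw [show n - (n - 1 - 2 * j + 1) = 2 * j by ring]; exact hy6g
    · intro c hc
      have h1 : n - 1 - 2 * j ≠ c := by omega
      have h2 : n - 1 - 2 * j - 1 ≠ c := by omega
      have h3 : n - 1 - 2 * j + 1 ≠ c := by omega
      simp [Finsupp.single_apply, h1, h2, h3]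
    · intro c hc
      have b1 : ¬ c = n - 1 - 2 * j := by omega
      have b3 : ¬ c = n - 1 - 2 * j + 1 := by omega
      have b4 : ¬ c + 1 = n - 1 - 2 * j + 1 := by omega
      simp only [dd_add, dd_single, if_neg b1, if_neg b3, if_neg b4, E.tau_mul, E.d_mul,
        z2_add_self]
      by_cases b2 : c = n - 1 - 2 * j - 1
      · have b5 : c + 1 = n - 1 - 2 * j := by omega
        have b6 : ¬ c + 1 = n - 1 - 2 * j - 1 := by omega
        simp only [if_pos b2, if_pos b5, if_neg b6, add_zero, zero_add]
        rw [add_comm (E.mul v0 (E.d2 v0))]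
        exact z2_add_self _
      · have b5 : ¬ c + 1 = n - 1 - 2 * j := by omega
        simp [b2, b5]
    · rw [hlead]
      have b1 : ¬ n - 1 - 2 * j + 1 = n - 1 - 2 * j := by omega
      have b2 : ¬ n - 1 - 2 * j = n - 1 - 2 * j - 1 := by omega
      have b3 : ¬ n - 1 - 2 * j + 1 = n - 1 - 2 * j - 1 := by omega
      have b4 : ¬ n - 1 - 2 * j = n - 1 - 2 * j + 1 := by omega
      simp only [dd_add, dd_single, if_true, if_neg b1, if_neg b2, if_neg b3, if_neg b4,
        E.d_mul, E.d2_d2, map_zero, add_zero, zero_add]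
  · obtain ⟨y, hy, h⟩ := lead_odd (r := 1) le_rfl (htZ 1)
    apply fin (Finsupp.single (n - 1 - (2 * j + 1) + 1) y)
    · intro c
      refine single_gr ?_ c
      rw [show n - (n - 1 - (2 * j + 1) + 1) = 2 * j + 1 by ring]; exact hy
    · intro c hc
      have h3 : n - 1 - (2 * j + 1) + 1 ≠ c := by omega
      simp [Finsupp.single_apply, h3]
    · intro c hc
      exact dd_single_ne _ _ _ _ (by omega) (by omega)
    · rw [← htdd, h]
      simp [dd_single]

end TD
end piece1

section piece2
variable {A : DGA (ZMod 2)}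

theorem np_smul {V : Type*} [AddCommGroup V] [Module (ZMod 2) V] (i : ℤ) (x : V) :
    ((Int.negOnePow i : ℤˣ) : ℤ) • x = x := by
  rcases Int.even_or_odd i with h | h
  · rw [Int.negOnePow_even i h]; simp
  · rw [Int.negOnePow_odd i h]; simp [z2_neg]

theorem int_ind {V : Type*} [AddCommGroup V] [Module (ZMod 2) V] {gr : ℤ → Submodule (ZMod 2) V}
    (h : DirectSum.IsInternal gr) {p : V → Prop} (x : V)
    (h0 : p 0) (ha : ∀ x y, p x → p y → p (x + y)) (hg : ∀ i, ∀ x ∈ gr i, p x) : p x := by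
  have hx : x ∈ (⨆ i, gr i) := by rw [h.submodule_iSup_eq_top]; trivial
  exact Submodule.iSup_induction gr (motive := p) hx hg h0 ha

theorem DGBimod.dL (M : DGBimod A) (a : A.V) (m : M.V) :
    M.d (M.actL a m) = M.actL (A.d a) m + M.actL a (M.d m) := by
  refine int_ind A.internal (p := fun a => M.d (M.actL a m) = M.actL (A.d a) m + M.actL a (M.d m)) a
    (by simp) ?_ ?_
  · intro x y hx hy
    simp only [map_add, LinearMap.add_apply, hx, hy]; abel
  · intro i x hx
    rw [M.leibnizL i x hx, np_smul]

theorem DGBimod.dR (M : DGBimod A) (m : M.V) (a : A.V) :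
    M.d (M.actR m a) = M.actR (M.d m) a + M.actR m (A.d a) := by
  refine int_ind M.internal (p := fun m => M.d (M.actR m a) = M.actR (M.d m) a + M.actR m (A.d a)) m
    (by simp) ?_ ?_
  · intro x y hx hy
    simp only [map_add, LinearMap.add_apply, hx, hy]; abel
  · intro i x hx
    rw [M.leibnizR i x hx, np_smul]

theorem DGA.dM (A : DGA (ZMod 2)) (a b : A.V) : A.d (A.mul a b) = A.mul (A.d a) b + A.mul a (A.d b) :=
  A.diag.dL a b

/-! Homogeneous components. -/

theorem gr_ext {V : Type*} [AddCommGroup V] [Module (ZMod 2) V] {gr S : ℤ → Submodule (ZMod 2) V}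
    (h : DirectSum.IsInternal gr) (hS : ∀ m, S m ≤ gr m) (ht : (⨆ m, S m) = ⊤) (m : ℤ) :
    S m = gr m := by
  classical
  apply le_antisymm (hS m)
  intro x hx
  have hxt : x ∈ (⨆ m, S m) := by rw [ht]; trivial
  obtain ⟨f, hf⟩ := (Submodule.mem_iSup_iff_exists_dfinsupp S x).1 hxt
  -- compare components
  let g : Π₀ i, gr i := f.mapRange (fun i y => ⟨y.1, hS i y.2⟩) (fun i => rfl)
  have e1 : (DFinsupp.lsum ℕ fun i => (gr i).subtype) g = x := by
    rw [← hf]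
    simp only [DFinsupp.lsum_apply_apply, g]
    rw [DFinsupp.sumAddHom_apply, DFinsupp.sumAddHom_apply, DFinsupp.sum_mapRange_index]
    · rfl
    · intro i; simp
  have e2 : (DFinsupp.lsum ℕ fun i => (gr i).subtype) (DFinsupp.single m ⟨x, hx⟩) = x := by
    simp
  have hinj := h.1
  have e3 : g = DFinsupp.single m ⟨x, hx⟩ := by
    apply hinj
    have e4 : ∀ u : Π₀ i, gr i, (DirectSum.coeAddMonoidHom gr) u = (DFinsupp.lsum ℕ fun i => (gr i).subtype) u := by
      intro u; rfl
    rw [e4, e4, e1, e2]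
  have e5 := congrArg (fun u => ((u m : gr m) : V)) e3
  simp only [g, DFinsupp.mapRange_apply, DFinsupp.single_eq_same] at e5
  rw [← e5]; exact (f m).2

/-- The homogeneous component. -/
def comp {V : Type*} [AddCommGroup V] [Module (ZMod 2) V] (gr : ℤ → Submodule (ZMod 2) V)
    (h : DirectSum.IsInternal gr) (n : ℤ) : V →ₗ[ZMod 2] V :=
  (gr n).subtype.comp ((DirectSum.component (ZMod 2) ℤ (fun i => gr i) n).comp
    (LinearEquiv.ofBijective (DirectSum.coeLinearMap gr) h).symm.toLinearMap)

section comp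
variable {V : Type*} [AddCommGroup V] [Module (ZMod 2) V] {gr : ℤ → Submodule (ZMod 2) V}
  (h : DirectSum.IsInternal gr)

theorem comp_mem (n : ℤ) (x : V) : comp gr h n x ∈ gr n := by
  simp only [comp, LinearMap.comp_apply, Submodule.subtype_apply]
  exact Subtype.mem _

theorem comp_symm {n : ℤ} {x : V} (hx : x ∈ gr n) :
    (LinearEquiv.ofBijective (DirectSum.coeLinearMap gr) h).symm x =
      DirectSum.lof (ZMod 2) ℤ (fun i => gr i) n ⟨x, hx⟩ := by
  rw [LinearEquiv.symm_apply_eq]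
  exact (DirectSum.coeLinearMap_lof gr n ⟨x, hx⟩).symm

theorem comp_same {n : ℤ} {x : V} (hx : x ∈ gr n) : comp gr h n x = x := by
  simp only [comp, LinearMap.comp_apply, LinearEquiv.coe_coe, comp_symm h hx]
  simp [DirectSum.component.lof_self]

theorem comp_ne {n m : ℤ} {x : V} (hx : x ∈ gr m) (hn : m ≠ n) : comp gr h n x = 0 := by
  simp only [comp, LinearMap.comp_apply, LinearEquiv.coe_coe, comp_symm h hx]
  rw [DirectSum.component.of, dif_neg hn]; simp

theorem comp_sum (x : V) : ∃ u : Finset ℤ, (∀ n ∉ u, comp gr h n x = 0) ∧ x = ∑ n ∈ u, comp gr h n x := by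
  classical
  refine int_ind h (p := fun x => ∃ u : Finset ℤ, (∀ n ∉ u, comp gr h n x = 0) ∧ x = ∑ n ∈ u, comp gr h n x) x
    ⟨∅, by simp, by simp⟩ ?_ ?_
  · rintro x y ⟨u, hu, hu'⟩ ⟨v, hv, hv'⟩
    have key : ∀ (w : V) (a b : Finset ℤ), a ⊆ b → (∀ n ∉ a, comp gr h n w = 0) → w = ∑ n ∈ a, comp gr h n w →
        w = ∑ n ∈ b, comp gr h n w := by
      intro w a b hab h1 h2
      rw [← Finset.sum_subset hab (fun n _ hn => h1 n hn)]; exact h2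
    refine ⟨u ∪ v, ?_, ?_⟩
    · intro n hn
      simp only [Finset.mem_union, not_or] at hn
      rw [map_add, hu n hn.1, hv n hn.2, add_zero]
    · simp only [map_add, Finset.sum_add_distrib]
      rw [← key x u _ Finset.subset_union_left hu hu', ← key y v _ Finset.subset_union_right hv hv']
  · intro i x hx
    refine ⟨{i}, ?_, by simp [comp_same h hx]⟩
    intro n hn
    exact comp_ne h hx (by simpa [eq_comm] using hn)

theorem mem_of_comp {n : ℤ} {x : V} (hx : ∀ m, m ≠ n → comp gr h m x = 0) : x ∈ gr n := by
  classical
  obtain ⟨u, hu, hu'⟩ := comp_sum h x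
  rw [hu']
  refine Submodule.sum_mem _ fun m _ => ?_
  by_cases hm : m = n
  · subst hm; exact comp_mem h m x
  · rw [hx m hm]; exact Submodule.zero_mem _

theorem internal_of {V : Type*} [AddCommGroup V] [Module (ZMod 2) V] {gr : ℤ → Submodule (ZMod 2) V}
    (c : ℤ → V →ₗ[ZMod 2] V) (h1 : ∀ n, ∀ x ∈ gr n, c n x = x)
    (h2 : ∀ n m, m ≠ n → ∀ x ∈ gr m, c n x = 0) (ht : ∀ x, x ∈ ⨆ n, gr n) :
    DirectSum.IsInternal gr := by
  classical
  rw [DirectSum.isInternal_submodule_iff_iSupIndep_and_iSup_eq_top]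
  refine ⟨?_, eq_top_iff.2 fun x _ => ht x⟩
  intro n
  rw [Submodule.disjoint_def]
  intro x hx hx'
  rw [← h1 n x hx]
  have : (⨆ j, ⨆ (_ : j ≠ n), gr j) ≤ LinearMap.ker (c n) := by
    refine iSup_le fun j => iSup_le fun hj => ?_
    intro y hy
    exact h2 n j hj y hy
  exact this hx'
end comp
end piece2

section piece3
variable {A : DGA (ZMod 2)}

/-- Graded complexes with relations. -/
structure RC : Type 1 where
  T : Type
  [acg : AddCommGroup T]
  [mod : Module (ZMod 2) T]
  gr : ℤ → Submodule (ZMod 2) T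
  N : Submodule (ZMod 2) T
  d : T →ₗ[ZMod 2] T
  d_d : ∀ x, d (d x) = 0
  d_gr : ∀ n, ∀ x ∈ gr n, d x ∈ gr (n - 1)
  d_N : ∀ x ∈ N, d x ∈ N

attribute [instance] RC.acg
attribute [instance 2000] RC.mod

namespace RC
variable (E E' : RC)

def Z (n : ℤ) : Submodule (ZMod 2) E.T := (E.gr n ⊔ E.N) ⊓ Submodule.comap E.d E.N
def B (n : ℤ) : Submodule (ZMod 2) E.T := Submodule.map E.d (E.gr (n + 1) ⊔ E.N) ⊔ E.N

theorem mem_Z {n : ℤ} {x : E.T} : x ∈ E.Z n ↔ x ∈ E.gr n ⊔ E.N ∧ E.d x ∈ E.N := Iff.rfl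

theorem N_le_B (n : ℤ) : E.N ≤ E.B n := le_sup_right

theorem d_mem_B {n : ℤ} {x : E.T} (hx : x ∈ E.gr (n + 1) ⊔ E.N) : E.d x ∈ E.B n :=
  Submodule.mem_sup_left ⟨x, hx, rfl⟩

theorem d_grN {n : ℤ} {x : E.T} (hx : x ∈ E.gr n ⊔ E.N) : E.d x ∈ E.gr (n - 1) ⊔ E.N := by
  obtain ⟨y, hy, z, hz, rfl⟩ := Submodule.mem_sup.1 hx
  rw [map_add]
  exact Submodule.add_mem_sup (E.d_gr n y hy) (E.d_N z hz)

theorem mem_B {n : ℤ} {x : E.T} : x ∈ E.B n ↔ ∃ v ∈ E.gr (n + 1), x + E.d v ∈ E.N := by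
  constructor
  · intro hx
    obtain ⟨y, ⟨v, hv, rfl⟩, z, hz, rfl⟩ := Submodule.mem_sup.1 hx
    obtain ⟨v1, hv1, v2, hv2, rfl⟩ := Submodule.mem_sup.1 hv
    refine ⟨v1, hv1, ?_⟩
    have : E.d (v1 + v2) + z + E.d v1 = E.d v2 + z := by
      rw [map_add]
      have := z2_add_self (E.d v1)
      calc _ = (E.d v1 + E.d v1) + (E.d v2 + z) := by abel
        _ = _ := by rw [this, zero_add]
    rw [this]
    exact Submodule.add_mem _ (E.d_N _ hv2) hz
  · rintro ⟨v, hv, h⟩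
    have : x = E.d v + (x + E.d v) := by
      rw [add_comm x, z2_add_cancel]
    rw [this]
    exact Submodule.add_mem_sup ⟨v, Submodule.mem_sup_left hv, rfl⟩ h

theorem B_le_Z (n : ℤ) : E.B n ≤ E.Z n := by
  intro x hx
  obtain ⟨v, hv, h⟩ := E.mem_B.1 hx
  have e : x = E.d v + (x + E.d v) := by
    rw [add_comm x, z2_add_cancel]
  refine ⟨?_, ?_⟩
  · rw [e]
    have := E.d_gr _ v hv
    rw [add_sub_cancel_right] at this
    exact Submodule.add_mem_sup this h
  · change E.d x ∈ E.N
    rw [e, map_add, E.d_d, zero_add]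
    exact E.d_N _ h

/-- every cycle class has a homogeneous representative -/
theorem Z_rep {n : ℤ} {x : E.T} (hx : x ∈ E.Z n) :
    ∃ y ∈ E.gr n, E.d y ∈ E.N ∧ x + y ∈ E.N := by
  obtain ⟨h1, h2⟩ := hx
  obtain ⟨y, hy, z, hz, rfl⟩ := Submodule.mem_sup.1 h1
  refine ⟨y, hy, ?_, ?_⟩
  · have : E.d y = E.d (y + z) + E.d z := by
      rw [map_add, add_assoc, z2_add_self, add_zero]
    rw [this]
    exact Submodule.add_mem _ h2 (E.d_N z hz)
  · have : y + z + y = z := by rw [add_comm y z, add_assoc, z2_add_self, add_zero]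
    rw [this]; exact hz

variable {E E'}

structure Map (E E' : RC) (s : ℤ) (f : E.T →ₗ[ZMod 2] E'.T) : Prop where
  gr : ∀ n, ∀ x ∈ E.gr n, f x ∈ E'.gr (n + s) ⊔ E'.N
  N : ∀ x ∈ E.N, f x ∈ E'.N
  comm : ∀ x, f (E.d x) + E'.d (f x) ∈ E'.N

theorem Map.mk' {E E' : RC} {s : ℤ} {f : E.T →ₗ[ZMod 2] E'.T}
    (h1 : ∀ n, ∀ x ∈ E.gr n, f x ∈ E'.gr (n + s)) (h2 : ∀ x ∈ E.N, f x ∈ E'.N)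
    (h3 : ∀ x, f (E.d x) = E'.d (f x)) : Map E E' s f :=
  ⟨fun n x hx => Submodule.mem_sup_left (h1 n x hx), h2, fun x => by
    rw [h3, z2_add_self]; exact Submodule.zero_mem _⟩

theorem Map.grN {s : ℤ} {f : E.T →ₗ[ZMod 2] E'.T} (hf : Map E E' s f) {n : ℤ} {x : E.T}
    (hx : x ∈ E.gr n ⊔ E.N) : f x ∈ E'.gr (n + s) ⊔ E'.N := by
  obtain ⟨y, hy, z, hz, rfl⟩ := Submodule.mem_sup.1 hx
  rw [map_add]
  exact Submodule.add_mem _ (hf.gr n y hy) (Submodule.mem_sup_right (hf.N z hz))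

theorem Map.Z {s : ℤ} {f : E.T →ₗ[ZMod 2] E'.T} (hf : Map E E' s f) {n : ℤ} {x : E.T}
    (hx : x ∈ E.Z n) : f x ∈ E'.Z (n + s) := by
  refine ⟨hf.grN hx.1, ?_⟩
  change E'.d (f x) ∈ E'.N
  rw [← z2_add_cancel (f (E.d x)) (E'.d (f x))]
  exact Submodule.add_mem _ (hf.N _ hx.2) (hf.comm x)

theorem Map.B {s : ℤ} {f : E.T →ₗ[ZMod 2] E'.T} (hf : Map E E' s f) {n : ℤ} {x : E.T}
    (hx : x ∈ E.B n) : f x ∈ E'.B (n + s) := by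
  obtain ⟨v, hv, h⟩ := E.mem_B.1 hx
  have e : x = E.d v + (x + E.d v) := by
    rw [add_comm x, z2_add_cancel]
  rw [e, map_add]
  refine Submodule.add_mem _ ?_ (E'.N_le_B _ (hf.N _ h))
  rw [← z2_add_cancel (E'.d (f v)) (f (E.d v)), add_comm (E'.d _) (f _)]
  refine Submodule.add_mem _ (E'.d_mem_B ?_) (E'.N_le_B _ (hf.comm v))
  have := hf.gr _ v hv
  rwa [add_right_comm] at this

theorem null_B {s : ℤ} {f h : E.T →ₗ[ZMod 2] E'.T}
    (hgr : ∀ n, ∀ x ∈ E.gr n, h x ∈ E'.gr (n + s + 1) ⊔ E'.N) (hN : ∀ x ∈ E.N, h x ∈ E'.N)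
    (hf : ∀ x, f x + (E'.d (h x) + h (E.d x)) ∈ E'.N) {n : ℤ} {x : E.T} (hx : x ∈ E.Z n) :
    f x ∈ E'.B (n + s) := by
  have e : f x = (f x + (E'.d (h x) + h (E.d x))) + (E'.d (h x) + h (E.d x)) := by
    rw [add_assoc, z2_add_self, add_zero]
  rw [e]
  refine Submodule.add_mem _ (E'.N_le_B _ (hf x))
    (Submodule.add_mem _ (E'.d_mem_B ?_) (E'.N_le_B _ (hN _ hx.2)))
  obtain ⟨y, hy, z, hz, rfl⟩ := Submodule.mem_sup.1 hx.1
  rw [map_add]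
  exact Submodule.add_mem _ (hgr n y hy) (Submodule.mem_sup_right (hN z hz))

/-- finite-dimensionality of the homology -/
def FD (E : RC) (n : ℤ) : Prop :=
  ∃ V : Submodule (ZMod 2) E.T, Module.Finite (ZMod 2) V ∧ E.Z n ≤ V ⊔ E.B n

theorem fin_map {V W : Type*} [AddCommGroup V] [Module (ZMod 2) V] [AddCommGroup W]
    [Module (ZMod 2) W] (f : V →ₗ[ZMod 2] W) (U : Submodule (ZMod 2) V)
    (h : Module.Finite (ZMod 2) U) : Module.Finite (ZMod 2) (U.map f) := by
  exact Module.Finite.map U f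

theorem fin_le {V : Type*} [AddCommGroup V] [Module (ZMod 2) V]
    {U W : Submodule (ZMod 2) V} (hUW : U ≤ W)
    (h : Module.Finite (ZMod 2) W) : Module.Finite (ZMod 2) U := by
  exact Module.Finite.of_injective (Submodule.inclusion hUW) (Submodule.inclusion_injective hUW)

theorem fin_sup {V : Type*} [AddCommGroup V] [Module (ZMod 2) V]
    {U W : Submodule (ZMod 2) V} (hU : Module.Finite (ZMod 2) U)
    (h : Module.Finite (ZMod 2) W) : Module.Finite (ZMod 2) ↥(U ⊔ W) := by
  exact Submodule.finite_sup U W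

/-- If `Z ≤ U ⊔ W` with `U` finite-dimensional, one can choose a complement inside `Z`. -/
theorem fin_choose {V : Type*} [AddCommGroup V] [Module (ZMod 2) V]
    {Z U W : Submodule (ZMod 2) V} (hU : Module.Finite (ZMod 2) U) (h : Z ≤ U ⊔ W) :
    ∃ U' ≤ Z, Module.Finite (ZMod 2) U' ∧ Z ≤ U' ⊔ (W ⊓ Z) := by
  -- the quotient Z / (Z ⊓ W) is finite dimensional
  let q : ↥Z →ₗ[ZMod 2] (V ⧸ W) := W.mkQ.comp Z.subtype
  have hr : LinearMap.range q ≤ U.map W.mkQ := by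
    rintro _ ⟨z, rfl⟩
    obtain ⟨u, hu, w, hw, e⟩ := Submodule.mem_sup.1 (h z.2)
    refine ⟨u, hu, ?_⟩
    simp only [q, LinearMap.comp_apply, Submodule.subtype_apply, ← e, map_add]
    rw [(Submodule.Quotient.mk_eq_zero W (x := w)).2 hw |> (fun h => (h : W.mkQ w = 0)), add_zero]
  have hfr : Module.Finite (ZMod 2) (LinearMap.range q) := fin_le hr (fin_map _ _ hU)
  obtain ⟨g, hg⟩ := LinearMap.exists_rightInverse_of_surjective q.rangeRestrict
    (LinearMap.range_eq_top.2 q.surjective_rangeRestrict)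
  refine ⟨LinearMap.range (Z.subtype.comp g), ?_, inferInstance, ?_⟩
  · rintro _ ⟨y, rfl⟩; exact (g y).2
  · intro z hz
    set y := q.rangeRestrict ⟨z, hz⟩
    have e : z = (g y : V) + (z - (g y : V)) := by abel
    rw [e]
    refine Submodule.add_mem_sup ⟨y, rfl⟩ ⟨?_, Submodule.sub_mem _ hz (g y).2⟩
    have h1 : q.rangeRestrict (g y) = y := LinearMap.congr_fun hg y
    have h2 : q (g y) = q ⟨z, hz⟩ := congrArg Subtype.val h1
    exact (Submodule.Quotient.eq W).1 h2.symm

theorem FD_retract {n s : ℤ} {f : E.T →ₗ[ZMod 2] E'.T} {g : E'.T →ₗ[ZMod 2] E.T}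
    (hf : ∀ x ∈ E.Z n, f x ∈ E'.Z (n + s)) (hg : ∀ x ∈ E'.B (n + s), g x ∈ E.B n)
    (h : ∀ x ∈ E.Z n, g (f x) + x ∈ E.B n) (hE : E'.FD (n + s)) : E.FD n := by
  obtain ⟨V, hV, hZ⟩ := hE
  refine ⟨V.map g, fin_map g V hV, ?_⟩
  intro x hx
  obtain ⟨v, hv, b, hb, e⟩ := Submodule.mem_sup.1 (hZ (hf x hx))
  have : x = g v + (g b + (g (f x) + x)) := by
    rw [← e, map_add]
    have h1 := z2_add_self (g v)
    have h2 := z2_add_self (g b)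
    calc x = (g v + g v) + (g b + g b) + x := by rw [h1, h2]; simp
      _ = _ := by abel
  rw [this]
  exact Submodule.add_mem_sup ⟨v, hv, rfl⟩ (Submodule.add_mem _ (hg b hb) (h x hx))

/-- homology -/
abbrev H (E : RC) (n : ℤ) := Hgr E.T E.gr E.N E.d n

theorem FD_iff (n : ℤ) : E.FD n ↔ Module.Finite (ZMod 2) (E.H n) := by
  constructor
  · rintro ⟨V, hV, h⟩
    obtain ⟨U, hUZ, hU, hZ⟩ := fin_choose hV h
    let f : ↥U →ₗ[ZMod 2] (↥(E.Z n) ⧸ Submodule.comap (E.Z n).subtype (E.B n)) :=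
      (Submodule.mkQ _).comp (Submodule.inclusion hUZ)
    have : Function.Surjective f := by
      intro y
      obtain ⟨⟨z, hz⟩, rfl⟩ := Submodule.mkQ_surjective _ y
      obtain ⟨u, hu, w, hw, e⟩ := Submodule.mem_sup.1 (hZ hz)
      refine ⟨⟨u, hu⟩, ?_⟩
      apply (Submodule.Quotient.eq _).2
      change u - z ∈ E.B n
      rw [← e, sub_add_cancel_left]
      exact Submodule.neg_mem _ hw.1
    exact Module.Finite.of_surjective f this
  · intro h
    have h' : Module.Finite (ZMod 2) (↥(E.Z n) ⧸ Submodule.comap (E.Z n).subtype (E.B n)) := h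
    obtain ⟨g, hg⟩ := LinearMap.exists_rightInverse_of_surjective
      (Submodule.mkQ (Submodule.comap (E.Z n).subtype (E.B n))) (Submodule.range_mkQ _)
    refine ⟨LinearMap.range ((E.Z n).subtype.comp g), inferInstance, ?_⟩
    intro z hz
    set y := Submodule.mkQ (Submodule.comap (E.Z n).subtype (E.B n)) ⟨z, hz⟩ with hy
    have e : z = (g y : E.T) + (z - (g y : E.T)) := by abel
    rw [e]
    refine Submodule.add_mem_sup ⟨y, rfl⟩ ?_
    have h1 := LinearMap.congr_fun hg y
    have h2 : (Submodule.comap (E.Z n).subtype (E.B n)).mkQ ⟨z, hz⟩ =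
      (Submodule.comap (E.Z n).subtype (E.B n)).mkQ (g y) := h1.symm
    have h3 := (Submodule.Quotient.eq (Submodule.comap (E.Z n).subtype (E.B n))).1 h2
    exact h3

end RC

/-- A bimodule as a complex. -/
abbrev DGBimod.rc (M : DGBimod A) : RC where
  T := M.V
  gr := M.gr
  N := ⊥
  d := M.d
  d_d := M.d_d
  d_gr := M.d_gr
  d_N := by intro x hx; simp at hx; simp [hx]

/-! ### Functoriality of `T2` -/

section T2
variable {R R' M M' : DGBimod A}

theorem gr2_map {s t u : ℤ} {f : R.V →ₗ[ZMod 2] R'.V} {g : M.V →ₗ[ZMod 2] M'.V}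
    (hf : ∀ i, ∀ x ∈ R.gr i, f x ∈ R'.gr (i + s)) (hg : ∀ i, ∀ x ∈ M.gr i, g x ∈ M'.gr (i + t))
    (hu : s + t = u) {n : ℤ} {z : T2 R M} (hz : z ∈ gr2 R M n) :
    TensorProduct.map f g z ∈ gr2 R' M' (n + u) := by
  have : gr2 R M n ≤ Submodule.comap (TensorProduct.map f g) (gr2 R' M' (n + u)) := by
    rw [gr2, Submodule.span_le]
    rintro _ ⟨i, j, r, hr, m, hm, e, rfl⟩
    apply Submodule.subset_span
    exact ⟨i + s, j + t, f r, hf i r hr, g m, hg j m hm, by omega, by simp⟩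
  exact this hz

theorem tmul_gr2 {i j n : ℤ} {r : R.V} {m : M.V} (hr : r ∈ R.gr i) (hm : m ∈ M.gr j)
    (h : i + j = n) : r ⊗ₜ[ZMod 2] m ∈ gr2 R M n :=
  Submodule.subset_span ⟨i, j, r, hr, m, hm, h, rfl⟩

theorem rel2_R (r : R.V) (a : A.V) (m : M.V) :
    (R.actR r a) ⊗ₜ[ZMod 2] m + r ⊗ₜ[ZMod 2] (M.actL a m) ∈ rel2 R M :=
  Submodule.subset_span (Or.inl ⟨r, a, m, rfl⟩)

theorem rel2_L (r : R.V) (a : A.V) (m : M.V) :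
    (R.actL a r) ⊗ₜ[ZMod 2] m + r ⊗ₜ[ZMod 2] (M.actR m a) ∈ rel2 R M :=
  Submodule.subset_span (Or.inr ⟨r, a, m, rfl⟩)

theorem rel2_le {S : Submodule (ZMod 2) (T2 R M)}
    (h1 : ∀ r a m, (R.actR r a) ⊗ₜ[ZMod 2] m + r ⊗ₜ[ZMod 2] (M.actL a m) ∈ S)
    (h2 : ∀ r a m, (R.actL a r) ⊗ₜ[ZMod 2] m + r ⊗ₜ[ZMod 2] (M.actR m a) ∈ S) : rel2 R M ≤ S := by
  rw [rel2, Submodule.span_le]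
  rintro _ (⟨r, a, m, rfl⟩ | ⟨r, a, m, rfl⟩)
  · exact h1 r a m
  · exact h2 r a m

theorem rel2_map {f : R.V →ₗ[ZMod 2] R'.V} {g : M.V →ₗ[ZMod 2] M'.V}
    (hfL : ∀ a m, f (R.actL a m) = R'.actL a (f m)) (hfR : ∀ m a, f (R.actR m a) = R'.actR (f m) a)
    (hgL : ∀ a m, g (M.actL a m) = M'.actL a (g m)) (hgR : ∀ m a, g (M.actR m a) = M'.actR (g m) a)
    {z : T2 R M} (hz : z ∈ rel2 R M) : TensorProduct.map f g z ∈ rel2 R' M' := by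
  have : rel2 R M ≤ Submodule.comap (TensorProduct.map f g) (rel2 R' M') := by
    apply rel2_le
    · intro r a m
      simp only [Submodule.mem_comap, map_add, TensorProduct.map_tmul, hfR, hgL]
      exact rel2_R _ _ _
    · intro r a m
      simp only [Submodule.mem_comap, map_add, TensorProduct.map_tmul, hfL, hgR]
      exact rel2_L _ _ _
  exact this hz

theorem d2_tmul (r : R.V) (m : M.V) :
    d2 R M (r ⊗ₜ m) = R.d r ⊗ₜ m + r ⊗ₜ M.d m := by
  simp [d2]

theorem d2_d2 (z : T2 R M) : d2 R M (d2 R M z) = 0 := by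
  induction z using TensorProduct.induction_on with
  | zero => simp
  | add x y hx hy => rw [map_add, map_add, hx, hy, add_zero]
  | tmul r m =>
    simp only [d2_tmul, map_add, R.d_d, M.d_d, TensorProduct.zero_tmul, TensorProduct.tmul_zero]
    simp [z2_add_self]

theorem gr_sub {M : DGBimod A} (i : ℤ) (x : M.V) (hx : x ∈ M.gr i) : M.d x ∈ M.gr (i + -1) :=
  M.d_gr i x hx

theorem d2_gr {n : ℤ} {z : T2 R M} (hz : z ∈ gr2 R M n) : d2 R M z ∈ gr2 R M (n - 1) := by
  rw [d2, LinearMap.add_apply]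
  exact Submodule.add_mem _
    (gr2_map (s := -1) (t := 0) (u := -1) gr_sub (fun i x hx => by simpa using hx) (by simp) hz)
    (gr2_map (s := 0) (t := -1) (u := -1) (fun i x hx => by simpa using hx) gr_sub (by simp) hz)

theorem d2_rel {z : T2 R M} (hz : z ∈ rel2 R M) : d2 R M z ∈ rel2 R M := by
  have : rel2 R M ≤ Submodule.comap (d2 R M) (rel2 R M) := by
    apply rel2_le
    · intro r a m
      simp only [Submodule.mem_comap, map_add, d2_tmul, R.dR, M.dL, TensorProduct.add_tmul,
        TensorProduct.tmul_add]
      have h1 := rel2_R (R := R) (M := M) (R.d r) a m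
      have h2 := rel2_R (R := R) (M := M) r (A.d a) m
      have h3 := rel2_R (R := R) (M := M) r a (M.d m)
      convert Submodule.add_mem _ (Submodule.add_mem _ h1 h2) h3 using 1
      abel
    · intro r a m
      simp only [Submodule.mem_comap, map_add, d2_tmul, R.dL, M.dR, TensorProduct.add_tmul,
        TensorProduct.tmul_add]
      have h1 := rel2_L (R := R) (M := M) (R.d r) a m
      have h2 := rel2_L (R := R) (M := M) r (A.d a) m
      have h3 := rel2_L (R := R) (M := M) r a (M.d m)
      convert Submodule.add_mem _ (Submodule.add_mem _ h1 h2) h3 using 1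
      abel
  exact this hz

variable (R M) in
/-- The Hochschild complex. -/
abbrev rc2 : RC where
  T := T2 R M
  gr := gr2 R M
  N := rel2 R M
  d := d2 R M
  d_d := d2_d2
  d_gr := fun _ _ h => d2_gr h
  d_N := fun _ h => d2_rel h

theorem d2_map {f : R.V →ₗ[ZMod 2] R'.V} {g : M.V →ₗ[ZMod 2] M'.V}
    (hf : ∀ x, f (R.d x) = R'.d (f x)) (hg : ∀ x, g (M.d x) = M'.d (g x)) (z : T2 R M) :
    TensorProduct.map f g (d2 R M z) = d2 R' M' (TensorProduct.map f g z) := by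
  induction z using TensorProduct.induction_on with
  | zero => simp
  | add x y hx hy => simp only [map_add, hx, hy]
  | tmul r m => simp [d2_tmul, hf, hg]

theorem rc2_map {s t u : ℤ} {f : R.V →ₗ[ZMod 2] R'.V} {g : M.V →ₗ[ZMod 2] M'.V}
    (hf : IsBHom R R' s f) (hg : IsBHom M M' t g) (hu : s + t = u) :
    RC.Map (rc2 R M) (rc2 R' M') u (TensorProduct.map f g) :=
  RC.Map.mk' (fun _ _ hx => gr2_map hf.1 hg.1 hu hx)
    (fun _ hx => rel2_map hf.2.2.1 hf.2.2.2 hg.2.2.1 hg.2.2.2 hx)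
    (fun x => d2_map hf.2.1 hg.2.1 x)

theorem isB_id (M : DGBimod A) : IsBHom M M 0 LinearMap.id :=
  ⟨fun i x hx => by simpa using hx, fun _ => rfl, fun _ _ => rfl, fun _ _ => rfl⟩

theorem IsBHom.comp' {M₁ M₂ M₃ : DGBimod A} {s t u : ℤ} {f : M₁.V →ₗ[ZMod 2] M₂.V}
    {g : M₂.V →ₗ[ZMod 2] M₃.V} (hg : IsBHom M₂ M₃ t g) (hf : IsBHom M₁ M₂ s f) (hu : s + t = u) :
    IsBHom M₁ M₃ u (g.comp f) := by
  refine ⟨fun i x hx => ?_, fun x => ?_, fun a m => ?_, fun m a => ?_⟩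
  · have := hg.1 _ _ (hf.1 i x hx)
    rw [add_assoc, hu] at this; exact this
  · simp [hf.2.1, hg.2.1]
  · simp [hf.2.2.1, hg.2.2.1]
  · simp [hf.2.2.2, hg.2.2.2]

theorem mem_null {M N : DGBimod A} {s : ℤ} {f : M.V →ₗ[ZMod 2] N.V} :
    f ∈ nullHtpSub M N s ↔ ∃ h ∈ grHomSub M N (s + 1), ∀ x, f x = N.d (h x) + h (M.d x) := by
  constructor
  · rintro ⟨h, hh, rfl⟩
    exact ⟨h, hh, fun x => rfl⟩
  · rintro ⟨h, hh, e⟩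
    exact ⟨h, hh, by ext x; exact (e x).symm⟩

theorem htp2_eq {g h : M.V →ₗ[ZMod 2] M'.V} (e : ∀ x, g x = M'.d (h x) + h (M.d x)) (x : T2 R M) :
    TensorProduct.map LinearMap.id g x + (d2 R M' (TensorProduct.map LinearMap.id h x) +
        TensorProduct.map LinearMap.id h (d2 R M x)) = 0 := by
  induction x using TensorProduct.induction_on with
  | zero => simp
  | add x y hx hy =>
    simp only [map_add]
    rw [← add_zero (0 : T2 R M')]
    nth_rw 1 [← hx]
    rw [← hy]; abel
  | tmul r m =>
    simp only [TensorProduct.map_tmul, d2_tmul, map_add, LinearMap.id_apply, e,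
      TensorProduct.tmul_add]
    have h1 := z2_add_self (R.d r ⊗ₜ[ZMod 2] h m)
    have h2 := z2_add_self (r ⊗ₜ[ZMod 2] h (M.d m))
    have h3 := z2_add_self (r ⊗ₜ[ZMod 2] M'.d (h m))
    calc _ = (R.d r ⊗ₜ[ZMod 2] h m + R.d r ⊗ₜ[ZMod 2] h m) + (r ⊗ₜ[ZMod 2] h (M.d m)
        + r ⊗ₜ[ZMod 2] h (M.d m)) + (r ⊗ₜ[ZMod 2] M'.d (h m) + r ⊗ₜ[ZMod 2] M'.d (h m)) := by abel
      _ = 0 := by rw [h1, h2, h3]; simp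


/-- homotopic maps in the second variable -/
theorem rc2_null {s : ℤ} {g : M.V →ₗ[ZMod 2] M'.V} (hg : g ∈ nullHtpSub M M' s) {n : ℤ}
    {z : T2 R M} (hz : z ∈ (rc2 R M).Z n) :
    TensorProduct.map LinearMap.id g z ∈ (rc2 R M').B (n + s) := by
  obtain ⟨h, hh, e⟩ := mem_null.1 hg
  refine RC.null_B (E := rc2 R M) (E' := rc2 R M') (s := s)
    (f := TensorProduct.map LinearMap.id g) (h := TensorProduct.map LinearMap.id h)
    (fun n x hx => ?_) (fun x hx => ?_) (fun x => ?_) hz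
  · rw [add_assoc]
    exact Submodule.mem_sup_left (gr2_map (s := 0) (t := s + 1) (fun i x hx => by simpa using hx) hh.1 (by ring) hx)
  · exact rel2_map (fun _ _ => rfl) (fun _ _ => rfl) hh.2.1 hh.2.2 hx
  · exact (htp2_eq e x) ▸ Submodule.zero_mem _

theorem comm_d2 (x : T2 R M) : (TensorProduct.comm (ZMod 2) R.V M.V).toLinearMap (d2 R M x) =
      d2 M R ((TensorProduct.comm (ZMod 2) R.V M.V).toLinearMap x) := by
  induction x using TensorProduct.induction_on with
  | zero => simp
  | add x y hx hy => simp only [map_add, hx, hy]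
  | tmul r m => simp [d2_tmul, add_comm]

/-- The swap. -/
theorem rc2_swap (R M : DGBimod A) :
    RC.Map (rc2 R M) (rc2 M R) 0 (TensorProduct.comm (ZMod 2) R.V M.V).toLinearMap where
  gr := fun n x hx => by
    apply Submodule.mem_sup_left
    have : gr2 R M n ≤ Submodule.comap (TensorProduct.comm (ZMod 2) R.V M.V).toLinearMap (gr2 M R (n + 0)) := by
      rw [gr2, Submodule.span_le]
      rintro _ ⟨i, j, r, hr, m, hm, e, rfl⟩
      exact tmul_gr2 hm hr (by omega)
    exact this hx
  N := fun x hx => by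
    have : rel2 R M ≤ Submodule.comap (TensorProduct.comm (ZMod 2) R.V M.V).toLinearMap (rel2 M R) := by
      apply rel2_le
      · intro r a m
        have := rel2_L (R := M) (M := R) m a r
        rw [add_comm] at this
        simpa using this
      · intro r a m
        have := rel2_R (R := M) (M := R) m a r
        rw [add_comm] at this
        simpa using this
    exact this hx
  comm := fun x => by
    have e := comm_d2 x
    exact (congrArg (· + d2 M R _) e).trans (z2_add_self _) ▸ Submodule.zero_mem _

end T2
end piece3

section piece4
variable {A : DGA (ZMod 2)}

/-! ### Cell data -/

theorem sandwichT_tmul (M : DGBimod A) (m : M.V) (a b : A.V) :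
    sandwichT M m (a ⊗ₜ b) = M.actR (M.actL a m) b := rfl

/-- The map out of the free bimodule. -/
def freeMap {I : Type} (M : DGBimod A) (g : I → M.V) :
    (I →₀ (A.V ⊗[ZMod 2] A.V)) →ₗ[ZMod 2] M.V :=
  Finsupp.lsum (ZMod 2) (fun i => sandwichT M (g i))

theorem freeMap_single {I : Type} (M : DGBimod A) (g : I → M.V) (i : I) (c : A.V ⊗[ZMod 2] A.V) :
    freeMap M g (Finsupp.single i c) = sandwichT M (g i) c := by
  simp [freeMap]

/-- Explicit cell structure. -/
structure CellData (C : DGBimod A) : Type 1 where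
  I : Type
  g : I → C.V
  deg : I → ℤ
  lvl : I → ℕ
  g_gr : ∀ i, g i ∈ C.gr (deg i)
  bij : Function.Bijective (freeMap C g)
  tri : ∀ i, ∃ c : I →₀ (A.V ⊗[ZMod 2] A.V), C.d (g i) = freeMap C g c ∧
    ∀ j, lvl i ≤ lvl j → c j = 0

theorem cellData_of (C : DGBimod A) (Fil : ℕ → Submodule (ZMod 2) C.V) (h0 : Fil 0 = ⊥)
    (hm : Monotone Fil) (ht : (⨆ n, Fil n) = ⊤)
    (hL : ∀ n a, ∀ x ∈ Fil n, C.actL a x ∈ Fil n)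
    (hR : ∀ n a, ∀ x ∈ Fil n, C.actR x a ∈ Fil n)
    (P : ℕ → Type → Prop)
    (hs : ∀ n, ∃ (I : Type) (g : I → C.V) (deg : I → ℤ), P n I ∧
      (∀ i, g i ∈ Fil (n + 1)) ∧ (∀ i, C.d (g i) ∈ Fil n) ∧
      (∀ i p q, ∀ a ∈ A.gr p, ∀ b ∈ A.gr q, C.actR (C.actL a (g i)) b ∈ C.gr (p + q + deg i)) ∧
      Fil (n + 1) ≤ Fil n ⊔ (⨆ i, LinearMap.range (sandwichT C (g i))) ∧
      (∀ (u : Finset I) (c : I → A.V ⊗[ZMod 2] A.V),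
        (∑ i ∈ u, sandwichT C (g i) (c i)) ∈ Fil n → ∀ i ∈ u, c i = 0)) :
    ∃ (J : ℕ → Type) (D : CellData C), (∀ n, P n (J n)) ∧ D.I = (Σ n, J n) := by
  classical
  choose J g deg hP h1 h2 h3 h4 h5 using hs
  let G : (Σ n, J n) → C.V := fun i => g i.1 i.2
  have hsand : ∀ n x, x ∈ Fil n → ∀ c, sandwichT C x c ∈ Fil n := by
    intro n x hx c
    induction c using TensorProduct.induction_on with
    | zero => simp
    | add c c' h h' => rw [map_add]; exact Submodule.add_mem _ h h'
    | tmul a b => rw [sandwichT_tmul]; exact hR _ _ _ (hL _ _ _ hx)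
  have hsup : ∀ n (c : (Σ n, J n) →₀ (A.V ⊗[ZMod 2] A.V)), (∀ j, n ≤ j.1 → c j = 0) →
      freeMap C G c ∈ Fil n := by
    intro n c hc
    rw [freeMap, Finsupp.lsum_apply, Finsupp.sum]
    refine Submodule.sum_mem _ fun j hj => ?_
    have hj' : j.1 + 1 ≤ n := by
      by_contra hcon
      exact (Finsupp.mem_support_iff.1 hj) (hc j (by omega))
    exact hsand n _ (hm hj' (h1 j.1 j.2)) _
  have hgen : ∀ n, ∀ x ∈ Fil n, ∃ c : (Σ n, J n) →₀ (A.V ⊗[ZMod 2] A.V),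
      x = freeMap C G c ∧ ∀ j, n ≤ j.1 → c j = 0 := by
    intro n
    induction n with
    | zero =>
      intro x hx
      rw [h0, Submodule.mem_bot] at hx
      exact ⟨0, by simp [hx], by simp⟩
    | succ n ih =>
      let S : Submodule (ZMod 2) C.V := Submodule.map (freeMap C G)
        (⨅ (j : Σ n, J n) (_ : n + 1 ≤ j.1), LinearMap.ker (Finsupp.lapply (R := ZMod 2) (M := A.V ⊗[ZMod 2] A.V) j))
      have hS : Fil (n + 1) ≤ S := by
        refine (h4 n).trans (sup_le ?_ (iSup_le ?_))
        · intro x hx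
          obtain ⟨c, rfl, hc⟩ := ih x hx
          refine ⟨c, ?_, rfl⟩
          simp only [SetLike.mem_coe, Submodule.mem_iInf, LinearMap.mem_ker, Finsupp.lapply_apply]
          intro j hj; exact hc j (by omega)
        · rintro i _ ⟨c, rfl⟩
          refine ⟨Finsupp.single ⟨n, i⟩ c, ?_, freeMap_single C G ⟨n, i⟩ c⟩
          simp only [SetLike.mem_coe, Submodule.mem_iInf, LinearMap.mem_ker, Finsupp.lapply_apply]
          rintro j hj
          rw [Finsupp.single_eq_of_ne]
          rintro rfl
          simp at hj
      intro x hx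
      obtain ⟨c, hc, rfl⟩ := hS hx
      refine ⟨c, rfl, ?_⟩
      simpa only [SetLike.mem_coe, Submodule.mem_iInf, LinearMap.mem_ker, Finsupp.lapply_apply] using hc
  refine ⟨J, ⟨Σ n, J n, G, fun i => deg i.1 i.2, fun i => i.1, ?_, ⟨?_, ?_⟩, ?_⟩, hP, rfl⟩
  · intro i
    have := h3 i.1 i.2 0 0 A.one A.one_gr A.one A.one_gr
    rw [C.actL_one, C.actR_one] at this
    simpa using this
  · rw [← LinearMap.ker_eq_bot, LinearMap.ker_eq_bot']
    have key : ∀ n (c : (Σ n, J n) →₀ (A.V ⊗[ZMod 2] A.V)), (∀ j, n ≤ j.1 → c j = 0) →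
        freeMap C G c = 0 → c = 0 := by
      intro n
      induction n with
      | zero => intro c hc _; ext j; rw [hc j (Nat.zero_le _)]; rfl
      | succ n ih =>
        intro c hc hz
        let b := Finsupp.split c n
        let b' : (Σ n, J n) →₀ (A.V ⊗[ZMod 2] A.V) := Finsupp.mapDomain (Sigma.mk n) b
        have hinj : Function.Injective (Sigma.mk n : J n → Σ n, J n) := sigma_mk_injective
        have hb1 : ∀ i, b' ⟨n, i⟩ = c ⟨n, i⟩ := by
          intro i
          simp only [b', Finsupp.mapDomain_apply hinj, b, Finsupp.split_apply]
        have hb2 : ∀ j, n ≤ j.1 → (c + b') j = 0 := by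
          rintro ⟨m, i⟩ hj
          rcases eq_or_lt_of_le hj with h | h
          · simp only at h
            subst h
            rw [Finsupp.add_apply, hb1, z2_add_self]
          · rw [Finsupp.add_apply, hc _ h, zero_add]
            simp only [b']
            rw [Finsupp.mapDomain_of_notMem_range]
            rintro ⟨i', e⟩
            have := congrArg Sigma.fst e
            simp only at this h
            omega
        have hb3 : freeMap C G b' ∈ Fil n := by
          have := hsup n (c + b') hb2
          rwa [map_add, hz, zero_add] at this
        have hb4 : freeMap C G b' = ∑ i ∈ b.support, sandwichT C (g n i) (b i) := by
          simp only [b', freeMap, Finsupp.lsum_apply]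
          rw [Finsupp.sum_mapDomain_index (by simp) (by simp)]
          rfl
        have hb5 : b = 0 := by
          ext i
          by_cases hi : i ∈ b.support
          · exact h5 n b.support b (hb4 ▸ hb3) i hi
          · simpa using hi
        have hb6 : b' = 0 := by simp [b', hb5]
        rw [hb6, add_zero] at hb2
        exact ih c hb2 hz
    intro c hc
    refine key (c.support.sup (fun j => j.1) + 1) c ?_ hc
    intro j hj
    by_contra hne
    have := Finset.le_sup (f := fun j : (Σ n, J n) => j.1) (Finsupp.mem_support_iff.2 hne)
    omega
  · intro x
    have hx : x ∈ ⨆ n, Fil n := by rw [ht]; trivial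
    obtain ⟨n, hn⟩ := (Submodule.mem_iSup_of_directed Fil hm.directed_le).1 hx
    obtain ⟨c, e, _⟩ := hgen n x hn
    exact ⟨c, e.symm⟩
  · intro i
    exact hgen i.1 _ (h2 i.1 i.2)

theorem cellData_exists {C : DGBimod A} (h : IsCellBimod C) : Nonempty (CellData C) := by
  obtain ⟨Fil, h0, hm, ht, hd, hL, hR, hs⟩ := h
  obtain ⟨J, D, _⟩ := cellData_of C Fil h0 hm ht hL hR (fun _ _ => True) (fun n => by
    obtain ⟨I, g, deg, h⟩ := hs n
    exact ⟨I, g, deg, trivial, h⟩)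
  exact ⟨D⟩

theorem finCellData_exists {C : DGBimod A} (h : IsFiniteCellBimod C) :
    ∃ D : CellData C, Finite D.I := by
  classical
  obtain ⟨Fil, ⟨h0, hm, ht, hd, hL, hR, hs⟩, n₀, hn⟩ := h
  obtain ⟨J, D, hP, e⟩ := cellData_of C Fil h0 hm ht hL hR
    (fun n J => Finite J ∧ (n₀ ≤ n → IsEmpty J)) (fun n => by
    by_cases hlt : n₀ ≤ n
    · have htop : Fil n = ⊤ := top_le_iff.1 (hn ▸ hm hlt)
      refine ⟨Empty, fun i => i.elim, fun i => i.elim, ⟨inferInstance, fun _ => inferInstance⟩,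
        fun i => i.elim, fun i => i.elim, fun i => i.elim, ?_, fun u c _ i => i.elim⟩
      rw [htop]; simp
    · obtain ⟨I, hI, g, deg, h⟩ := hs n
      exact ⟨I, g, deg, ⟨hI, fun h => absurd h hlt⟩, h⟩)
  refine ⟨D, ?_⟩
  rw [e]
  have : ∀ n, Finite (J n) := fun n => (hP n).1
  let f : (Σ n, J n) → (Σ n : Fin n₀, J n) := fun x =>
    ⟨⟨x.1, by by_contra h; exact ((hP x.1).2 (by omega)).elim x.2⟩, x.2⟩
  refine Finite.of_injective f ?_
  rintro ⟨n, i⟩ ⟨m, j⟩ h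
  simp only [f, Sigma.mk.injEq, Fin.mk.injEq] at h
  obtain ⟨rfl, h⟩ := h
  simpa using h

namespace CellData
variable {C : DGBimod A} (D : CellData C)

/-- coordinates -/
def e : (D.I →₀ (A.V ⊗[ZMod 2] A.V)) ≃ₗ[ZMod 2] C.V := LinearEquiv.ofBijective _ D.bij

theorem e_apply (c) : D.e c = freeMap C D.g c := rfl

theorem e_symm_gen (i : D.I) (a b : A.V) :
    D.e.symm (C.actR (C.actL a (D.g i)) b) = Finsupp.single i (a ⊗ₜ b) := by
  rw [LinearEquiv.symm_apply_eq, e_apply, freeMap_single, sandwichT_tmul]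

theorem e_symm_free (c) : D.e.symm (freeMap C D.g c) = c := by
  rw [LinearEquiv.symm_apply_eq, e_apply]

theorem ind_free {M : DGBimod A} {I : Type} {g : I → M.V} {p : M.V → Prop} (h0 : p 0) (ha : ∀ x y, p x → p y → p (x + y))
    (hg : ∀ i a b, p (M.actR (M.actL a (g i)) b)) (c) : p (freeMap M g c) := by
  induction c using Finsupp.induction_linear with
  | zero => simpa using h0
  | add f f' h h' => rw [map_add]; exact ha _ _ h h'
  | single i c =>
    rw [freeMap_single]
    induction c using TensorProduct.induction_on with
    | zero => simpa using h0
    | add c c' h h' => rw [map_add]; exact ha _ _ h h'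
    | tmul a b => exact hg i a b

theorem ind {p : C.V → Prop} (h0 : p 0) (ha : ∀ x y, p x → p y → p (x + y))
    (hg : ∀ i a b, p (C.actR (C.actL a (D.g i)) b)) (x : C.V) : p x := by
  obtain ⟨c, rfl⟩ := D.bij.2 x
  exact ind_free h0 ha hg c

/-- extension of a map on generators -/
def ext {E : DGBimod A} (f : D.I → E.V) : C.V →ₗ[ZMod 2] E.V :=
  (freeMap E f).comp D.e.symm.toLinearMap

variable {E : DGBimod A} (f : D.I → E.V)

theorem ext_gen (i : D.I) (a b : A.V) :
    D.ext f (C.actR (C.actL a (D.g i)) b) = E.actR (E.actL a (f i)) b := by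
  simp [ext, e_symm_gen, freeMap_single, sandwichT_tmul]

theorem ext_g (i : D.I) : D.ext f (D.g i) = f i := by
  have := D.ext_gen f i A.one A.one
  simpa only [C.actL_one, C.actR_one, E.actL_one, E.actR_one] using this

theorem ext_L (a : A.V) (x : C.V) : D.ext f (C.actL a x) = E.actL a (D.ext f x) := by
  refine D.ind (p := fun x => D.ext f (C.actL a x) = E.actL a (D.ext f x)) (by simp) ?_ ?_ x
  · intro x y hx hy; simp only [map_add, hx, hy]
  · intro i b c
    rw [← C.actLR, ← C.actL_mul, ext_gen, ext_gen, ← E.actLR, ← E.actL_mul]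

theorem ext_R (x : C.V) (a : A.V) : D.ext f (C.actR x a) = E.actR (D.ext f x) a := by
  refine D.ind (p := fun x => D.ext f (C.actR x a) = E.actR (D.ext f x) a) (by simp) ?_ ?_ x
  · intro x y hx hy; simp only [map_add, LinearMap.add_apply, hx, hy]
  · intro i b c
    rw [C.actR_mul, ext_gen, ext_gen, E.actR_mul]

/-- uniqueness -/
theorem uniq {u v : C.V →ₗ[ZMod 2] E.V}
    (huL : ∀ a m, u (C.actL a m) = E.actL a (u m)) (huR : ∀ m a, u (C.actR m a) = E.actR (u m) a)
    (hvL : ∀ a m, v (C.actL a m) = E.actL a (v m)) (hvR : ∀ m a, v (C.actR m a) = E.actR (v m) a)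
    (h : ∀ i, u (D.g i) = v (D.g i)) (x : C.V) : u x = v x := by
  refine D.ind (p := fun x => u x = v x) (by simp) ?_ ?_ x
  · intro x y hx hy; simp only [map_add, hx, hy]
  · intro i b c
    rw [huR, huL, hvR, hvL, h]

theorem gen_gr {i : D.I} {p q n : ℤ} {a b : A.V} (ha : a ∈ A.gr p) (hb : b ∈ A.gr q)
    (hn : p + q + D.deg i = n) : C.actR (C.actL a (D.g i)) b ∈ C.gr n := by
  have := C.actR_gr _ _ _ (C.actL_gr p _ a ha _ (D.g_gr i)) b hb
  have e : p + D.deg i + q = n := by omega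
  rwa [e] at this

theorem gr_eq (n : ℤ) : Submodule.span (ZMod 2) {x | ∃ i p q, ∃ a ∈ A.gr p, ∃ b ∈ A.gr q,
    p + q + D.deg i = n ∧ x = C.actR (C.actL a (D.g i)) b} = C.gr n := by
  refine gr_ext C.internal (S := fun n => Submodule.span (ZMod 2) {x | ∃ i p q, ∃ a ∈ A.gr p, ∃ b ∈ A.gr q,
    p + q + D.deg i = n ∧ x = C.actR (C.actL a (D.g i)) b}) ?_ ?_ n
  · intro m
    rw [Submodule.span_le]
    rintro _ ⟨i, p, q, a, ha, b, hb, e, rfl⟩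
    exact D.gen_gr ha hb e
  · rw [eq_top_iff]
    intro x _
    refine D.ind (p := fun x => x ∈ _) (Submodule.zero_mem _) (fun _ _ => Submodule.add_mem _) ?_ x
    intro i a b
    refine int_ind A.internal (p := fun a => C.actR (C.actL a (D.g i)) b ∈ _) a (by simp) ?_ ?_
    · intro x y hx hy; simp only [map_add, LinearMap.add_apply]; exact Submodule.add_mem _ hx hy
    · intro p a ha
      refine int_ind A.internal (p := fun b => C.actR (C.actL a (D.g i)) b ∈ _) b (by simp) ?_ ?_
      · intro x y hx hy; simp only [map_add]; exact Submodule.add_mem _ hx hy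
      · intro q b hb
        exact Submodule.mem_iSup_of_mem (p + q + D.deg i)
          (Submodule.subset_span ⟨i, p, q, a, ha, b, hb, rfl, rfl⟩)

theorem ext_gr {t : ℤ} (hf : ∀ i, f i ∈ E.gr (D.deg i + t)) (n : ℤ) (x : C.V) (hx : x ∈ C.gr n) :
    D.ext f x ∈ E.gr (n + t) := by
  rw [← D.gr_eq] at hx
  have : Submodule.span (ZMod 2) {x | ∃ i p q, ∃ a ∈ A.gr p, ∃ b ∈ A.gr q,
    p + q + D.deg i = n ∧ x = C.actR (C.actL a (D.g i)) b} ≤ Submodule.comap (D.ext f) (E.gr (n + t)) := by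
    rw [Submodule.span_le]
    rintro _ ⟨i, p, q, a, ha, b, hb, e, rfl⟩
    simp only [Submodule.comap_coe, Set.mem_preimage, SetLike.mem_coe]
    rw [ext_gen]
    have h := E.actR_gr _ _ _ (E.actL_gr p _ a ha _ (hf i)) b hb
    have e' : p + (D.deg i + t) + q = n + t := by omega
    rwa [e'] at h
  exact this hx

theorem ext_mem {t : ℤ} (hf : ∀ i, f i ∈ E.gr (D.deg i + t)) : D.ext f ∈ grHomSub C E t :=
  ⟨D.ext_gr f hf, D.ext_L f, D.ext_R f⟩

/-- an extension is a chain map if it is so on generators -/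
theorem chain_of_gen {u : C.V →ₗ[ZMod 2] E.V}
    (huL : ∀ a m, u (C.actL a m) = E.actL a (u m)) (huR : ∀ m a, u (C.actR m a) = E.actR (u m) a)
    (h : ∀ i, u (C.d (D.g i)) = E.d (u (D.g i))) (x : C.V) : u (C.d x) = E.d (u x) := by
  refine D.ind (p := fun x => u (C.d x) = E.d (u x)) (by simp) ?_ ?_ x
  · intro x y hx hy; simp only [map_add, hx, hy]
  · intro i b c
    simp only [C.dR, C.dL, map_add, LinearMap.add_apply, huR, huL, h, E.dR, E.dL]

end CellData
end piece4

section piece5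
variable {A : DGA (ZMod 2)}

/-! ### The ambient space `T4` -/

section T4
variable {R M R' M' : DGBimod A}

variable (R M) in
/-- reassociation -/
def asc : (T2 R M ⊗[ZMod 2] T2 R M) ≃ₗ[ZMod 2] T4 R M :=
  TensorProduct.assoc (ZMod 2) R.V M.V (R.V ⊗[ZMod 2] M.V)

theorem asc_tmul (r : R.V) (m : M.V) (r' : R.V) (m' : M.V) :
    asc R M ((r ⊗ₜ m) ⊗ₜ (r' ⊗ₜ m')) = r ⊗ₜ (m ⊗ₜ (r' ⊗ₜ m')) := rfl

/-- induction on pure tensors -/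
theorem ind22 {p : T2 R M → T2 R M → Prop}
    (h0 : ∀ y, p 0 y) (h0' : ∀ x, p x 0)
    (ha : ∀ x x' y, p x y → p x' y → p (x + x') y)
    (ha' : ∀ x y y', p x y → p x y' → p x (y + y'))
    (h : ∀ r m r' m', p (r ⊗ₜ m) (r' ⊗ₜ m')) (x y : T2 R M) : p x y := by
  induction x using TensorProduct.induction_on with
  | zero => exact h0 y
  | add x x' hx hx' => exact ha _ _ _ hx hx'
  | tmul r m =>
    induction y using TensorProduct.induction_on with
    | zero => exact h0' _
    | add x x' hx hx' => exact ha' _ _ _ hx hx'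
    | tmul r' m' => exact h r m r' m'

theorem asc_ind {p : T4 R M → Prop} (h0 : p 0) (ha : ∀ x y, p x → p y → p (x + y))
    (h : ∀ x y, p (asc R M (x ⊗ₜ y))) (z : T4 R M) : p z := by
  obtain ⟨w, rfl⟩ := (asc R M).surjective z
  induction w using TensorProduct.induction_on with
  | zero => rw [map_zero]; exact h0
  | add x x' hx hx' => rw [map_add]; exact ha _ _ hx hx'
  | tmul x y => exact h x y

theorem d4_asc (x y : T2 R M) : d4 R M (asc R M (x ⊗ₜ y)) =
    asc R M (d2 R M x ⊗ₜ y) + asc R M (x ⊗ₜ d2 R M y) := by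
  refine ind22 (p := fun x y => d4 R M (asc R M (x ⊗ₜ y)) =
    asc R M (d2 R M x ⊗ₜ y) + asc R M (x ⊗ₜ d2 R M y)) ?_ ?_ ?_ ?_ ?_ x y
  · intro y; simp
  · intro y; simp
  · intro x x' y h h'
    simp only [TensorProduct.add_tmul, map_add, h, h']; abel
  · intro x y y' h h'
    simp only [TensorProduct.tmul_add, map_add, h, h']; abel
  · intro r m r' m'
    simp only [asc_tmul, d2_tmul, TensorProduct.tmul_add, TensorProduct.add_tmul, map_add, d4,
      LinearMap.add_apply, TensorProduct.map_tmul, LinearMap.id_apply]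
    abel

theorem tau4_asc (x y : T2 R M) : tau4 R M (asc R M (x ⊗ₜ y)) = asc R M (y ⊗ₜ x) := by
  simp [tau4, asc]

theorem d4_d4 (z : T4 R M) : d4 R M (d4 R M z) = 0 := by
  refine asc_ind (p := fun z => d4 R M (d4 R M z) = 0) (by simp) ?_ ?_ z
  · intro x y hx hy; simp only [map_add, hx, hy, add_zero]
  · intro x y
    simp only [d4_asc, map_add, d2_d2, TensorProduct.zero_tmul, TensorProduct.tmul_zero, map_zero,
      zero_add, add_zero]
    exact z2_add_self _

theorem tau4_tau4 (z : T4 R M) : tau4 R M (tau4 R M z) = z := by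
  refine asc_ind (p := fun z => tau4 R M (tau4 R M z) = z) (by simp) ?_ ?_ z
  · intro x y hx hy; simp only [map_add, hx, hy]
  · intro x y; simp only [tau4_asc]

theorem tau4_d4 (z : T4 R M) : tau4 R M (d4 R M z) = d4 R M (tau4 R M z) := by
  refine asc_ind (p := fun z => tau4 R M (d4 R M z) = d4 R M (tau4 R M z)) (by simp) ?_ ?_ z
  · intro x y hx hy; simp only [map_add, hx, hy]
  · intro x y; simp only [tau4_asc, d4_asc, map_add]; rw [add_comm]

theorem asc_gr {i j n : ℤ} {x y : T2 R M} (hx : x ∈ gr2 R M i) (hy : y ∈ gr2 R M j)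
    (hn : i + j = n) : asc R M (x ⊗ₜ y) ∈ gr4 R M n := by
  have key : ∀ y ∈ gr2 R M j, gr2 R M i ≤ Submodule.comap
      ((asc R M).toLinearMap.comp ((TensorProduct.mk (ZMod 2) _ _).flip y)) (gr4 R M n) := by
    intro y hy
    rw [gr2, Submodule.span_le]
    rintro _ ⟨i1, j1, r, hr, m, hm, e, rfl⟩
    have : gr2 R M j ≤ Submodule.comap
      ((asc R M).toLinearMap.comp ((TensorProduct.mk (ZMod 2) _ _) (r ⊗ₜ m))) (gr4 R M n) := by
      rw [gr2, Submodule.span_le]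
      rintro _ ⟨i2, j2, r', hr', m', hm', e', rfl⟩
      exact Submodule.subset_span ⟨i1, j1, i2, j2, r, hr, m, hm, r', hr', m', hm', by omega, rfl⟩
    exact this hy
  exact key y hy hx

theorem gr4_le {n : ℤ} {S : Submodule (ZMod 2) (T4 R M)}
    (h : ∀ i j, i + j = n → ∀ x ∈ gr2 R M i, ∀ y ∈ gr2 R M j, asc R M (x ⊗ₜ y) ∈ S) :
    gr4 R M n ≤ S := by
  rw [gr4, Submodule.span_le]
  rintro _ ⟨i1, j1, i2, j2, r, hr, m, hm, r', hr', m', hm', e, rfl⟩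
  exact h (i1 + j1) (i2 + j2) (by omega) _ (tmul_gr2 hr hm rfl) _ (tmul_gr2 hr' hm' rfl)

theorem d4_gr {n : ℤ} {z : T4 R M} (hz : z ∈ gr4 R M n) : d4 R M z ∈ gr4 R M (n - 1) := by
  have : gr4 R M n ≤ Submodule.comap (d4 R M) (gr4 R M (n - 1)) := by
    apply gr4_le
    intro i j e x hx y hy
    rw [Submodule.mem_comap, d4_asc]
    exact Submodule.add_mem _ (asc_gr (d2_gr hx) hy (by omega)) (asc_gr hx (d2_gr hy) (by omega))
  exact this hz

theorem tau4_gr {n : ℤ} {z : T4 R M} (hz : z ∈ gr4 R M n) : tau4 R M z ∈ gr4 R M n := by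
  have : gr4 R M n ≤ Submodule.comap (tau4 R M) (gr4 R M n) := by
    apply gr4_le
    intro i j e x hx y hy
    rw [Submodule.mem_comap, tau4_asc]
    exact asc_gr hy hx (by omega)
  exact this hz

theorem rel4_le {S : Submodule (ZMod 2) (T4 R M)}
    (h1 : ∀ r a m r' m', asc R M ((R.actR r a ⊗ₜ m) ⊗ₜ (r' ⊗ₜ m')) +
      asc R M ((r ⊗ₜ M.actL a m) ⊗ₜ (r' ⊗ₜ m')) ∈ S)
    (h2 : ∀ r a m r' m', asc R M ((R.actL a r ⊗ₜ m) ⊗ₜ (r' ⊗ₜ m')) +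
      asc R M ((r ⊗ₜ m) ⊗ₜ (r' ⊗ₜ M.actR m' a)) ∈ S)
    (h3 : ∀ r a m r' m', asc R M ((r ⊗ₜ M.actR m a) ⊗ₜ (r' ⊗ₜ m')) +
      asc R M ((r ⊗ₜ m) ⊗ₜ (R.actL a r' ⊗ₜ m')) ∈ S)
    (h4 : ∀ r a m r' m', asc R M ((r ⊗ₜ m) ⊗ₜ (R.actR r' a ⊗ₜ m')) +
      asc R M ((r ⊗ₜ m) ⊗ₜ (r' ⊗ₜ M.actL a m')) ∈ S) :
    rel4 R M ≤ S := by
  rw [rel4, Submodule.span_le]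
  rintro _ (((⟨r, a, m, r', m', rfl⟩ | ⟨r, a, m, r', m', rfl⟩) | ⟨r, a, m, r', m', rfl⟩) |
    ⟨r, a, m, r', m', rfl⟩)
  · exact h1 r a m r' m'
  · exact h2 r a m r' m'
  · exact h3 r a m r' m'
  · exact h4 r a m r' m'

theorem rel4_1 (r : R.V) (a : A.V) (m : M.V) (r' : R.V) (m' : M.V) :
    asc R M ((R.actR r a ⊗ₜ m) ⊗ₜ (r' ⊗ₜ m')) +
      asc R M ((r ⊗ₜ M.actL a m) ⊗ₜ (r' ⊗ₜ m')) ∈ rel4 R M :=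
  Submodule.subset_span (Or.inl (Or.inl (Or.inl ⟨r, a, m, r', m', rfl⟩)))
theorem rel4_2 (r : R.V) (a : A.V) (m : M.V) (r' : R.V) (m' : M.V) :
    asc R M ((R.actL a r ⊗ₜ m) ⊗ₜ (r' ⊗ₜ m')) +
      asc R M ((r ⊗ₜ m) ⊗ₜ (r' ⊗ₜ M.actR m' a)) ∈ rel4 R M :=
  Submodule.subset_span (Or.inl (Or.inl (Or.inr ⟨r, a, m, r', m', rfl⟩)))
theorem rel4_3 (r : R.V) (a : A.V) (m : M.V) (r' : R.V) (m' : M.V) :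
    asc R M ((r ⊗ₜ M.actR m a) ⊗ₜ (r' ⊗ₜ m')) +
      asc R M ((r ⊗ₜ m) ⊗ₜ (R.actL a r' ⊗ₜ m')) ∈ rel4 R M :=
  Submodule.subset_span (Or.inl (Or.inr ⟨r, a, m, r', m', rfl⟩))
theorem rel4_4 (r : R.V) (a : A.V) (m : M.V) (r' : R.V) (m' : M.V) :
    asc R M ((r ⊗ₜ m) ⊗ₜ (R.actR r' a ⊗ₜ m')) +
      asc R M ((r ⊗ₜ m) ⊗ₜ (r' ⊗ₜ M.actL a m')) ∈ rel4 R M :=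
  Submodule.subset_span (Or.inr ⟨r, a, m, r', m', rfl⟩)

theorem tau4_rel {z : T4 R M} (hz : z ∈ rel4 R M) : tau4 R M z ∈ rel4 R M := by
  have : rel4 R M ≤ Submodule.comap (tau4 R M) (rel4 R M) := by
    apply rel4_le <;> intro r a m r' m' <;> rw [Submodule.mem_comap, map_add, tau4_asc, tau4_asc]
    · exact rel4_4 _ _ _ _ _
    · rw [add_comm]; exact rel4_3 _ _ _ _ _
    · rw [add_comm]; exact rel4_2 _ _ _ _ _
    · exact rel4_1 _ _ _ _ _
  exact this hz

theorem d4_rel {z : T4 R M} (hz : z ∈ rel4 R M) : d4 R M z ∈ rel4 R M := by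
  have : rel4 R M ≤ Submodule.comap (d4 R M) (rel4 R M) := by
    apply rel4_le <;> intro r a m r' m' <;>
      simp only [Submodule.mem_comap, map_add, d4_asc, d2_tmul, R.dR, R.dL, M.dR, M.dL,
        TensorProduct.add_tmul, TensorProduct.tmul_add]
    · convert Submodule.add_mem _ (Submodule.add_mem _ (rel4_1 (R.d r) a m r' m')
        (Submodule.add_mem _ (rel4_1 r (A.d a) m r' m') (rel4_1 r a (M.d m) r' m')))
        (Submodule.add_mem _ (rel4_1 r a m (R.d r') m') (rel4_1 r a m r' (M.d m'))) using 1
      abel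
    · convert Submodule.add_mem _ (Submodule.add_mem _ (rel4_2 (R.d r) a m r' m')
        (Submodule.add_mem _ (rel4_2 r (A.d a) m r' m') (rel4_2 r a (M.d m) r' m')))
        (Submodule.add_mem _ (rel4_2 r a m (R.d r') m') (rel4_2 r a m r' (M.d m'))) using 1
      abel
    · convert Submodule.add_mem _ (Submodule.add_mem _ (rel4_3 (R.d r) a m r' m')
        (Submodule.add_mem _ (rel4_3 r (A.d a) m r' m') (rel4_3 r a (M.d m) r' m')))
        (Submodule.add_mem _ (rel4_3 r a m (R.d r') m') (rel4_3 r a m r' (M.d m'))) using 1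
      abel
    · convert Submodule.add_mem _ (Submodule.add_mem _ (rel4_4 (R.d r) a m r' m')
        (Submodule.add_mem _ (rel4_4 r (A.d a) m r' m') (rel4_4 r a (M.d m) r' m')))
        (Submodule.add_mem _ (rel4_4 r a m (R.d r') m') (rel4_4 r a m r' (M.d m'))) using 1
      abel
  exact this hz

/-! functoriality -/

/-- The map induced on `T4`. -/
def map4 (f : R.V →ₗ[ZMod 2] R'.V) (g : M.V →ₗ[ZMod 2] M'.V) : T4 R M →ₗ[ZMod 2] T4 R' M' :=
  TensorProduct.map f (TensorProduct.map g (TensorProduct.map f g))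

theorem map4_asc (f : R.V →ₗ[ZMod 2] R'.V) (g : M.V →ₗ[ZMod 2] M'.V) (x y : T2 R M) :
    map4 f g (asc R M (x ⊗ₜ y)) =
      asc R' M' (TensorProduct.map f g x ⊗ₜ TensorProduct.map f g y) := by
  refine ind22 (p := fun x y => map4 f g (asc R M (x ⊗ₜ y)) =
      asc R' M' (TensorProduct.map f g x ⊗ₜ TensorProduct.map f g y)) ?_ ?_ ?_ ?_ ?_ x y
  · intro y; simp
  · intro y; simp
  · intro x x' y h h'
    simp only [TensorProduct.add_tmul, map_add, h, h']
  · intro x y y' h h'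
    simp only [TensorProduct.tmul_add, map_add, h, h']
  · intro r m r' m'
    simp only [asc_tmul, TensorProduct.map_tmul, map4]

theorem map4_gr {s t : ℤ} {f : R.V →ₗ[ZMod 2] R'.V} {g : M.V →ₗ[ZMod 2] M'.V}
    (hf : IsBHom R R' s f) (hg : IsBHom M M' t g) {n : ℤ} {z : T4 R M} (hz : z ∈ gr4 R M n) :
    map4 f g z ∈ gr4 R' M' (n + 2 * (s + t)) := by
  have : gr4 R M n ≤ Submodule.comap (map4 f g) (gr4 R' M' (n + 2 * (s + t))) := by
    apply gr4_le
    intro i j e x hx y hy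
    rw [Submodule.mem_comap, map4_asc]
    exact asc_gr (gr2_map hf.1 hg.1 rfl hx) (gr2_map hf.1 hg.1 rfl hy) (by omega)
  exact this hz

theorem map4_rel {s t : ℤ} {f : R.V →ₗ[ZMod 2] R'.V} {g : M.V →ₗ[ZMod 2] M'.V}
    (hf : IsBHom R R' s f) (hg : IsBHom M M' t g) {z : T4 R M} (hz : z ∈ rel4 R M) :
    map4 f g z ∈ rel4 R' M' := by
  have : rel4 R M ≤ Submodule.comap (map4 f g) (rel4 R' M') := by
    apply rel4_le <;> intro r a m r' m' <;>
      simp only [Submodule.mem_comap, map_add, map4_asc, TensorProduct.map_tmul, hf.2.2.1, hf.2.2.2,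
        hg.2.2.1, hg.2.2.2]
    · exact rel4_1 _ _ _ _ _
    · exact rel4_2 _ _ _ _ _
    · exact rel4_3 _ _ _ _ _
    · exact rel4_4 _ _ _ _ _
  exact this hz

theorem map4_d {s t : ℤ} {f : R.V →ₗ[ZMod 2] R'.V} {g : M.V →ₗ[ZMod 2] M'.V}
    (hf : IsBHom R R' s f) (hg : IsBHom M M' t g) (z : T4 R M) :
    map4 f g (d4 R M z) = d4 R' M' (map4 f g z) := by
  refine asc_ind (p := fun z => map4 f g (d4 R M z) = d4 R' M' (map4 f g z)) (by simp) ?_ ?_ z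
  · intro x y hx hy; simp only [map_add, hx, hy]
  · intro x y
    simp only [d4_asc, map_add, map4_asc, d2_map hf.2.1 hg.2.1]

theorem map4_tau (f : R.V →ₗ[ZMod 2] R'.V) (g : M.V →ₗ[ZMod 2] M'.V) (z : T4 R M) :
    map4 f g (tau4 R M z) = tau4 R' M' (map4 f g z) := by
  refine asc_ind (p := fun z => map4 f g (tau4 R M z) = tau4 R' M' (map4 f g z)) (by simp) ?_ ?_ z
  · intro x y hx hy; simp only [map_add, hx, hy]
  · intro x y
    simp only [tau4_asc, map4_asc]

/-! the quotient -/
section quot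
variable (R M)

def kgr (n : ℤ) : Submodule (ZMod 2) (HCQ4 R M) := Submodule.map (rel4 R M).mkQ (gr4 R M n)
def kd : HCQ4 R M →ₗ[ZMod 2] HCQ4 R M :=
  (rel4 R M).mapQ (rel4 R M) (d4 R M) (fun _ h => d4_rel h)
def ktau : HCQ4 R M →ₗ[ZMod 2] HCQ4 R M :=
  (rel4 R M).mapQ (rel4 R M) (tau4 R M) (fun _ h => tau4_rel h)
def kmul : T2 R M →ₗ[ZMod 2] T2 R M →ₗ[ZMod 2] HCQ4 R M :=
  (TensorProduct.mk (ZMod 2) (T2 R M) (T2 R M)).compr₂ ((rel4 R M).mkQ.comp (asc R M).toLinearMap)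
end quot

theorem kmul_apply (x y : T2 R M) : kmul R M x y = (rel4 R M).mkQ (asc R M (x ⊗ₜ y)) := rfl
theorem kd_mk (x : T4 R M) : kd R M ((rel4 R M).mkQ x) = (rel4 R M).mkQ (d4 R M x) := rfl
theorem ktau_mk (x : T4 R M) : ktau R M ((rel4 R M).mkQ x) = (rel4 R M).mkQ (tau4 R M x) := rfl
theorem ktau_kmul (x y : T2 R M) : ktau R M (kmul R M x y) = kmul R M y x := by
  rw [kmul_apply, ktau_mk, tau4_asc, kmul_apply]

theorem mk_eq_of_add {V : Type*} [AddCommGroup V] [Module (ZMod 2) V] {N : Submodule (ZMod 2) V}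
    {x y : V} (h : x + y ∈ N) : N.mkQ x = N.mkQ y := by
  apply (Submodule.Quotient.eq N).2
  rwa [z2_sub]

theorem add_of_mk_eq {V : Type*} [AddCommGroup V] [Module (ZMod 2) V] {N : Submodule (ZMod 2) V}
    {x y : V} (h : N.mkQ x = N.mkQ y) : x + y ∈ N := by
  have := (Submodule.Quotient.eq N).1 h
  rwa [z2_sub] at this

theorem kmul_rel {z : T2 R M} (hz : z ∈ rel2 R M) :
    ∃ y, kmul R M z z = y + ktau R M y := by
  have add : ∀ z w, (∃ y, kmul R M z z = y + ktau R M y) → (∃ y, kmul R M w w = y + ktau R M y) →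
      ∃ y, kmul R M (z + w) (z + w) = y + ktau R M y := by
    rintro z w ⟨y, hy⟩ ⟨y', hy'⟩
    refine ⟨y + y' + kmul R M z w, ?_⟩
    simp only [map_add, LinearMap.add_apply, hy, hy', ktau_kmul]
    abel
  have gen : ∀ x y, kmul R M x x = kmul R M y y → ∃ u, kmul R M (x + y) (x + y) = u + ktau R M u := by
    intro x y h
    refine ⟨kmul R M x y, ?_⟩
    simp only [map_add, LinearMap.add_apply, h, ktau_kmul]
    have := z2_add_self (kmul R M y y)
    calc _ = (kmul R M y y + kmul R M y y) + (kmul R M x y + kmul R M y x) := by abel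
      _ = _ := by rw [this, zero_add]
  refine Submodule.span_induction (p := fun z _ => ∃ y, kmul R M z z = y + ktau R M y)
    ?_ ⟨0, by simp⟩ (fun z w _ _ => add z w) ?_ hz
  · rintro _ (⟨r, a, m, rfl⟩ | ⟨r, a, m, rfl⟩)
    · apply gen
      simp only [kmul_apply]
      exact (mk_eq_of_add (rel4_1 _ _ _ _ _)).trans (mk_eq_of_add (rel4_4 _ _ _ _ _))
    · apply gen
      simp only [kmul_apply]
      exact (mk_eq_of_add (rel4_2 _ _ _ _ _)).trans (mk_eq_of_add (add_comm (asc R M _) _ ▸ rel4_3 _ _ _ _ _))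
  · rintro c z _ ⟨y, hy⟩
    refine ⟨c • c • y, ?_⟩
    simp only [map_smul, LinearMap.smul_apply, hy, smul_add]

/-- map on the quotient -/
def kmap {s t : ℤ} {f : R.V →ₗ[ZMod 2] R'.V} {g : M.V →ₗ[ZMod 2] M'.V}
    (hf : IsBHom R R' s f) (hg : IsBHom M M' t g) : HCQ4 R M →ₗ[ZMod 2] HCQ4 R' M' :=
  (rel4 R M).mapQ (rel4 R' M') (map4 f g) (fun _ h => map4_rel hf hg h)

theorem kmap_mk {s t : ℤ} {f : R.V →ₗ[ZMod 2] R'.V} {g : M.V →ₗ[ZMod 2] M'.V}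
    (hf : IsBHom R R' s f) (hg : IsBHom M M' t g) (x : T4 R M) :
    kmap hf hg ((rel4 R M).mkQ x) = (rel4 R' M').mkQ (map4 f g x) := rfl

theorem kmap_kmul {s t : ℤ} {f : R.V →ₗ[ZMod 2] R'.V} {g : M.V →ₗ[ZMod 2] M'.V}
    (hf : IsBHom R R' s f) (hg : IsBHom M M' t g) (x y : T2 R M) :
    kmap hf hg (kmul R M x y) = kmul R' M' (TensorProduct.map f g x) (TensorProduct.map f g y) := by
  rw [kmul_apply, kmap_mk, map4_asc, kmul_apply]

theorem kmap_ktau {s t : ℤ} {f : R.V →ₗ[ZMod 2] R'.V} {g : M.V →ₗ[ZMod 2] M'.V}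
    (hf : IsBHom R R' s f) (hg : IsBHom M M' t g) (x : HCQ4 R M) :
    kmap hf hg (ktau R M x) = ktau R' M' (kmap hf hg x) := by
  obtain ⟨x, rfl⟩ := Submodule.mkQ_surjective _ x
  rw [ktau_mk, kmap_mk, kmap_mk, ktau_mk, map4_tau]

theorem kmap_kd {s t : ℤ} {f : R.V →ₗ[ZMod 2] R'.V} {g : M.V →ₗ[ZMod 2] M'.V}
    (hf : IsBHom R R' s f) (hg : IsBHom M M' t g) (x : HCQ4 R M) :
    kmap hf hg (kd R M x) = kd R' M' (kmap hf hg x) := by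
  obtain ⟨x, rfl⟩ := Submodule.mkQ_surjective _ x
  rw [kd_mk, kmap_mk, kmap_mk, kd_mk, map4_d hf hg]

theorem kmap_gr {s t : ℤ} {f : R.V →ₗ[ZMod 2] R'.V} {g : M.V →ₗ[ZMod 2] M'.V}
    (hf : IsBHom R R' s f) (hg : IsBHom M M' t g) {n : ℤ} {x : HCQ4 R M} (hx : x ∈ kgr R M n) :
    kmap hf hg x ∈ kgr R' M' (n + 2 * (s + t)) := by
  obtain ⟨x, hx, rfl⟩ := hx
  exact ⟨map4 f g x, map4_gr hf hg hx, rfl⟩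

/-- The properties needed for Tate data. -/
structure TateOK (R M : DGBimod A) : Prop where
  even : ∀ k, ∀ x ∈ kgr R M (2 * k), x + ktau R M x = 0 →
    ∃ z ∈ gr2 R M k, ∃ y ∈ kgr R M (2 * k), x = kmul R M z z + (y + ktau R M y)
  odd : ∀ k, ∀ x ∈ kgr R M (2 * k + 1), x + ktau R M x = 0 →
    ∃ y ∈ kgr R M (2 * k + 1), x = y + ktau R M y
  inj : ∀ z y, kmul R M z z = y + ktau R M y → z ∈ rel2 R M
  homog : ∀ k, ∀ z ∈ gr2 R M k, z ∈ rel2 R M → ∃ y ∈ kgr R M (2 * k), kmul R M z z = y + ktau R M y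

theorem TateOK.retract {C R M : DGBimod A} {ι : R.V →ₗ[ZMod 2] C.V} {r : C.V →ₗ[ZMod 2] R.V}
    (hι : IsBHom R C 0 ι) (hr : IsBHom C R 0 r) (h : r.comp ι = LinearMap.id)
    (H : TateOK C M) : TateOK R M := by
  have hM := isB_id M
  have e2 : ∀ z : T2 R M, TensorProduct.map r LinearMap.id (TensorProduct.map ι LinearMap.id z) = z := by
    intro z
    rw [← LinearMap.comp_apply, ← TensorProduct.map_comp, h]
    simp
  have e4 : ∀ x : HCQ4 R M, kmap hr hM (kmap hι hM x) = x := by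
    intro x
    obtain ⟨x, rfl⟩ := Submodule.mkQ_surjective _ x
    rw [kmap_mk, kmap_mk]
    congr 1
    refine asc_ind (p := fun x => map4 r LinearMap.id (map4 ι LinearMap.id x) = x) (by simp) ?_ ?_ x
    · intro x y hx hy; simp only [map_add, hx, hy]
    · intro x y; rw [map4_asc, map4_asc, e2, e2]
  have g4 : ∀ n, ∀ x ∈ kgr R M n, kmap hι hM x ∈ kgr C M n := fun n x hx => by
    simpa using kmap_gr hι hM hx
  have g4' : ∀ n, ∀ x ∈ kgr C M n, kmap hr hM x ∈ kgr R M n := fun n x hx => by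
    simpa using kmap_gr hr hM hx
  have g2 : ∀ n, ∀ x ∈ gr2 R M n, TensorProduct.map ι LinearMap.id x ∈ gr2 C M n := fun n x hx => by
    simpa using gr2_map (u := 0) hι.1 hM.1 (by simp) hx
  have g2' : ∀ n, ∀ x ∈ gr2 C M n, TensorProduct.map r LinearMap.id x ∈ gr2 R M n := fun n x hx => by
    simpa using gr2_map (u := 0) hr.1 hM.1 (by simp) hx
  refine ⟨?_, ?_, ?_, ?_⟩
  · intro k x hx hx0
    obtain ⟨z, hz, y, hy, e⟩ := H.even k _ (g4 _ x hx) (by rw [← kmap_ktau, ← map_add, hx0, map_zero])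
    refine ⟨_, g2' _ z hz, _, g4' _ y hy, ?_⟩
    rw [← e4 x, e, map_add, map_add, kmap_kmul, kmap_ktau]
  · intro k x hx hx0
    obtain ⟨y, hy, e⟩ := H.odd k _ (g4 _ x hx) (by rw [← kmap_ktau, ← map_add, hx0, map_zero])
    refine ⟨_, g4' _ y hy, ?_⟩
    rw [← e4 x, e, map_add, kmap_ktau]
  · intro z y e
    have := H.inj (TensorProduct.map ι LinearMap.id z) (kmap hι hM y) (by
      rw [← kmap_kmul hι hM, e, map_add, kmap_ktau])
    rw [← e2 z]
    exact rel2_map hr.2.2.1 hr.2.2.2 hM.2.2.1 hM.2.2.2 this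
  · intro k z hz hz'
    obtain ⟨y, hy, e⟩ := H.homog k _ (g2 _ z hz) (rel2_map hι.2.2.1 hι.2.2.2 hM.2.2.1 hM.2.2.2 hz')
    refine ⟨_, g4' _ y hy, ?_⟩
    rw [← kmap_ktau, ← map_add, ← e, kmap_kmul, e2]

end T4
end piece5

section piece6
variable {A : DGA (ZMod 2)}

section swaplemma
variable {W : Type} [AddCommGroup W] [Module (ZMod 2) W]

/-- swap -/
abbrev swp (W : Type) [AddCommGroup W] [Module (ZMod 2) W] :
    W ⊗[ZMod 2] W →ₗ[ZMod 2] W ⊗[ZMod 2] W := (TensorProduct.comm (ZMod 2) W W).toLinearMap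

/-- grading on `W ⊗ W` -/
def GG (gr : ℤ → Submodule (ZMod 2) W) (n : ℤ) : Submodule (ZMod 2) (W ⊗[ZMod 2] W) :=
  Submodule.span (ZMod 2) {z | ∃ i j, ∃ w ∈ gr i, ∃ w' ∈ gr j, i + j = n ∧ z = w ⊗ₜ[ZMod 2] w'}

theorem gbasis {gr : ℤ → Submodule (ZMod 2) W} (h : DirectSum.IsInternal gr) :
    ∃ (κ : Type) (δ : κ → ℤ) (b : Module.Basis κ (ZMod 2) W), (∀ p, b p ∈ gr (δ p)) ∧
      ∀ i, ∀ w ∈ gr i, ∀ p, δ p ≠ i → b.repr w p = 0 := by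
  classical
  let v : ∀ i, Module.Basis (Module.Free.ChooseBasisIndex (ZMod 2) (gr i)) (ZMod 2) (gr i) :=
    fun i => Module.Free.chooseBasis (ZMod 2) (gr i)
  refine ⟨_, fun p => p.1, h.collectedBasis v, fun p => ?_, fun i w hw p hp => ?_⟩
  · exact h.collectedBasis_mem v p
  · obtain ⟨j, a⟩ := p
    exact h.collectedBasis_repr_of_mem_ne v (x := w) (i := i) (j := j) (a := a) (fun e => hp e.symm) hw

variable {κ : Type} (b : Module.Basis κ (ZMod 2) W)

theorem repr_swp (t : W ⊗[ZMod 2] W) (p q : κ) :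
    (b.tensorProduct b).repr (swp W t) (p, q) = (b.tensorProduct b).repr t (q, p) := by
  induction t using TensorProduct.induction_on with
  | zero => simp
  | add x y hx hy => simp only [map_add, Finsupp.add_apply, hx, hy]
  | tmul x y =>
    simp [Module.Basis.tensorProduct_repr_tmul_apply, mul_comm]

theorem swp_sym {t : W ⊗[ZMod 2] W} (hs : ∀ p q, (b.tensorProduct b).repr t (p, q) = (b.tensorProduct b).repr t (q, p))
    (hd : ∀ p, (b.tensorProduct b).repr t (p, p) = 0) :
    ∃ y, t = y + swp W y ∧ ∀ p q, (b.tensorProduct b).repr t (p, q) = 0 → (b.tensorProduct b).repr y (p, q) = 0 := by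
  classical
  let _ : LinearOrder κ := linearOrderOfSTO WellOrderingRel
  let y := (b.tensorProduct b).repr.symm (((b.tensorProduct b).repr t).filter (fun x => x.1 < x.2))
  have hy : ∀ p q, (b.tensorProduct b).repr y (p, q) = if p < q then (b.tensorProduct b).repr t (p, q) else 0 := by
    intro p q
    simp only [y, LinearEquiv.apply_symm_apply, Finsupp.filter_apply]
  refine ⟨y, ?_, ?_⟩
  · apply (b.tensorProduct b).repr.injective
    ext ⟨p, q⟩
    rw [map_add, Finsupp.add_apply, repr_swp, hy, hy]
    rcases lt_trichotomy p q with h | h | h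
    · rw [if_pos h, if_neg h.not_gt, add_zero]
    · subst h; simp [hd]
    · rw [if_neg h.not_gt, if_pos h, zero_add, hs]
  · intro p q h
    rw [hy, h, ite_self]

variable {gr : ℤ → Submodule (ZMod 2) W} {δ : κ → ℤ}

theorem GG_repr (hb' : ∀ i, ∀ w ∈ gr i, ∀ p, δ p ≠ i → b.repr w p = 0) {n : ℤ} {t : W ⊗[ZMod 2] W}
    (ht : t ∈ GG gr n) (p q : κ) (hpq : δ p + δ q ≠ n) : (b.tensorProduct b).repr t (p, q) = 0 := by
  induction ht using Submodule.span_induction with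
  | zero => simp
  | add x y _ _ hx hy => simp only [map_add, Finsupp.add_apply, hx, hy, add_zero]
  | smul c x _ hx => simp only [map_smul, Finsupp.smul_apply, hx, smul_zero]
  | mem x hx =>
    obtain ⟨i, j, w, hw, w', hw', e, rfl⟩ := hx
    rw [Module.Basis.tensorProduct_repr_tmul_apply]
    by_cases h1 : δ p = i
    · rw [hb' j w' hw' q (by omega)]; simp
    · rw [hb' i w hw p h1]; simp

theorem GG_of_repr (hb : ∀ p, b p ∈ gr (δ p)) {n : ℤ} {t : W ⊗[ZMod 2] W}
    (ht : ∀ p q, δ p + δ q ≠ n → (b.tensorProduct b).repr t (p, q) = 0) : t ∈ GG gr n := by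
  rw [← (b.tensorProduct b).linearCombination_repr t, Finsupp.linearCombination_apply]
  refine Submodule.sum_mem _ ?_
  rintro ⟨p, q⟩ _
  by_cases h : δ p + δ q = n
  · refine Submodule.smul_mem _ _ (Submodule.subset_span ⟨_, _, b p, hb p, b q, hb q, h, ?_⟩)
    simp
  · dsimp only
    rw [ht p q h, zero_smul]; exact Submodule.zero_mem _

theorem gr_of_repr (hb : ∀ p, b p ∈ gr (δ p)) {n : ℤ} {t : W}
    (ht : ∀ p, δ p ≠ n → b.repr t p = 0) : t ∈ gr n := by
  rw [← b.linearCombination_repr t, Finsupp.linearCombination_apply]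
  refine Submodule.sum_mem _ ?_
  rintro p _
  by_cases h : δ p = n
  · exact Submodule.smul_mem _ _ (h ▸ hb p)
  · dsimp only
    rw [ht p h, zero_smul]; exact Submodule.zero_mem _

theorem swp_odd (h : DirectSum.IsInternal gr) {k : ℤ} {t : W ⊗[ZMod 2] W} (ht : t ∈ GG gr (2 * k + 1))
    (hs : t + swp W t = 0) : ∃ y ∈ GG gr (2 * k + 1), t = y + swp W y := by
  obtain ⟨κ, δ, b, hb, hb'⟩ := gbasis h
  have hs' := z2_eq_of_add hs
  obtain ⟨y, e, hy⟩ := swp_sym b (t := t) (fun p q => by rw [← repr_swp, ← hs'])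
    (fun p => GG_repr b hb' ht p p (by omega))
  exact ⟨y, GG_of_repr b hb (fun p q hpq => hy p q (GG_repr b hb' ht p q hpq)), e⟩

theorem swp_even (h : DirectSum.IsInternal gr) {k : ℤ} {t : W ⊗[ZMod 2] W} (ht : t ∈ GG gr (2 * k))
    (hs : t + swp W t = 0) : ∃ z ∈ gr k, ∃ y ∈ GG gr (2 * k), t = z ⊗ₜ z + (y + swp W y) := by
  obtain ⟨κ, δ, b, hb, hb'⟩ := gbasis h
  have hs' := z2_eq_of_add hs
  let z : W := b.repr.symm (((b.tensorProduct b).repr t).comapDomain (fun p => (p, p))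
    (fun p _ q _ e => (Prod.mk.inj e).1))
  have hz : ∀ p, b.repr z p = (b.tensorProduct b).repr t (p, p) := by
    intro p; simp only [z, LinearEquiv.apply_symm_apply]; rfl
  have hzg : z ∈ gr k := gr_of_repr b hb (fun p hp => by
    rw [hz]; exact GG_repr b hb' ht p p (by omega))
  have hzz : z ⊗ₜ[ZMod 2] z ∈ GG gr (2 * k) := Submodule.subset_span ⟨k, k, z, hzg, z, hzg, by ring, rfl⟩
  have ht2 : t + z ⊗ₜ[ZMod 2] z ∈ GG gr (2 * k) := Submodule.add_mem _ ht hzz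
  obtain ⟨y, e, hy⟩ := swp_sym b (t := t + z ⊗ₜ[ZMod 2] z) (fun p q => by
      rw [map_add, Finsupp.add_apply, Finsupp.add_apply, ← repr_swp, ← hs',
        Module.Basis.tensorProduct_repr_tmul_apply, Module.Basis.tensorProduct_repr_tmul_apply,
        smul_eq_mul, smul_eq_mul, mul_comm])
    (fun p => by
      rw [map_add, Finsupp.add_apply, Module.Basis.tensorProduct_repr_tmul_apply, hz]
      generalize ((b.tensorProduct b).repr t) (p, p) = c
      revert c; decide)
  refine ⟨z, hzg, y, GG_of_repr b hb (fun p q hpq => hy p q (GG_repr b hb' ht2 p q hpq)), ?_⟩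
  rw [← e, add_comm t, z2_add_cancel]

theorem swp_inj {z : W} {y : W ⊗[ZMod 2] W} (h : z ⊗ₜ z = y + swp W y) : z = 0 := by
  let b := Module.Free.chooseBasis (ZMod 2) W
  apply b.repr.injective
  ext p
  have e := congrArg (fun t => (b.tensorProduct b).repr t (p, p)) h
  simp only [map_add, Finsupp.add_apply, repr_swp, Module.Basis.tensorProduct_repr_tmul_apply] at e
  rw [map_zero, Finsupp.zero_apply]
  revert e
  generalize ((b.tensorProduct b).repr y) (p, p) = c
  generalize b.repr z p = c'
  revert c c'; decide

theorem swp_homog (h : DirectSum.IsInternal gr) {n : ℤ} {t y : W ⊗[ZMod 2] W} (ht : t ∈ GG gr n)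
    (hy : t = y + swp W y) : ∃ y ∈ GG gr n, t = y + swp W y := by
  classical
  obtain ⟨κ, δ, b, hb, hb'⟩ := gbasis h
  let y' := (b.tensorProduct b).repr.symm (((b.tensorProduct b).repr y).filter (fun x => δ x.1 + δ x.2 = n))
  have hy' : ∀ p q, (b.tensorProduct b).repr y' (p, q) = if δ p + δ q = n then (b.tensorProduct b).repr y (p, q) else 0 := by
    intro p q
    simp only [y', LinearEquiv.apply_symm_apply, Finsupp.filter_apply]
  refine ⟨y', GG_of_repr b hb (fun p q hpq => by rw [hy', if_neg hpq]), ?_⟩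
  apply (b.tensorProduct b).repr.injective
  ext ⟨p, q⟩
  rw [map_add, Finsupp.add_apply, repr_swp, hy', hy', add_comm (δ q)]
  by_cases hpq : δ p + δ q = n
  · rw [if_pos hpq, if_pos hpq, hy, map_add, Finsupp.add_apply, repr_swp]
  · rw [if_neg hpq, if_neg hpq, GG_repr b hb' ht p q hpq, add_zero]
end swaplemma
end piece6

section piece7
set_option linter.unusedVariables false
set_option linter.unusedSimpArgs false
variable {A : DGA (ZMod 2)}

section celltate
variable {C : DGBimod A} (D : CellData C) (M : DGBimod A)

/-- coordinates of Hochschild chains of a cell bimodule -/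
abbrev CW := D.I →₀ M.V

/-- grading -/
def cwgr (n : ℤ) : Submodule (ZMod 2) (CW D M) where
  carrier := {w | ∀ i, w i ∈ M.gr (n - D.deg i)}
  add_mem' := fun h h' i => Submodule.add_mem _ (h i) (h' i)
  zero_mem' := fun i => Submodule.zero_mem _
  smul_mem' := fun c _ h i => Submodule.smul_mem _ c (h i)

theorem cwgr_single {n j : ℤ} {i : D.I} {m : M.V} (hm : m ∈ M.gr j) (e : j + D.deg i = n) :
    Finsupp.single i m ∈ cwgr D M n := by
  classical
  intro i'
  rw [Finsupp.single_apply]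
  split_ifs with h
  · subst h
    have : n - D.deg i = j := by omega
    rwa [this]
  · exact Submodule.zero_mem _

theorem cwgr_internal : DirectSum.IsInternal (cwgr D M) := by
  let c : ℤ → (CW D M →ₗ[ZMod 2] CW D M) := fun n =>
    Finsupp.lsum ℕ (fun i => (Finsupp.lsingle i).comp (comp M.gr M.internal (n - D.deg i)))
  have hc : ∀ n i m, c n (Finsupp.single i m) = Finsupp.single i (comp M.gr M.internal (n - D.deg i) m) := by
    intro n i m; simp [c]
  have hc' : ∀ n w i, c n w i = comp M.gr M.internal (n - D.deg i) (w i) := by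
    classical
    intro n w i
    induction w using Finsupp.induction_linear with
    | zero => simp
    | add f g h h' => simp only [map_add, Finsupp.add_apply, h, h']
    | single j m =>
      rw [hc]
      by_cases h : j = i
      · subst h; simp
      · simp [Finsupp.single_apply, h]
  refine internal_of c ?_ ?_ ?_
  · intro n x hx
    ext i
    rw [hc', comp_same _ (hx i)]
  · intro n m hn x hx
    ext i
    rw [hc', comp_ne _ (hx i) (by omega)]; rfl
  · intro x
    induction x using Finsupp.induction_linear with
    | zero => exact Submodule.zero_mem _
    | add f g h h' => exact Submodule.add_mem _ h h'
    | single i m =>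
      refine int_ind M.internal (p := fun m => Finsupp.single i m ∈ ⨆ n, cwgr D M n) m (by simp) ?_ ?_
      · intro x y hx hy; rw [Finsupp.single_add]; exact Submodule.add_mem _ hx hy
      · intro j m hm
        exact Submodule.mem_iSup_of_mem (j + D.deg i) (cwgr_single D M hm rfl)

/-- right action -/
def wR : CW D M →ₗ[ZMod 2] A.V →ₗ[ZMod 2] CW D M :=
  Finsupp.lsum ℕ (fun i => M.actR.compr₂ (Finsupp.lsingle i))

theorem wR_single (i : D.I) (m : M.V) (a : A.V) :
    wR D M (Finsupp.single i m) a = Finsupp.single i (M.actR m a) := by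
  simp [wR]

theorem wR_one (w : CW D M) : wR D M w A.one = w := by
  induction w using Finsupp.induction_linear with
  | zero => simp
  | add f g h h' => simp only [map_add, LinearMap.add_apply, h, h']
  | single i m => rw [wR_single, M.actR_one]

theorem wR_mul (w : CW D M) (a b : A.V) : wR D M (wR D M w a) b = wR D M w (A.mul a b) := by
  induction w using Finsupp.induction_linear with
  | zero => simp
  | add f g h h' => simp only [map_add, LinearMap.add_apply, h, h']
  | single i m => simp only [wR_single, M.actR_mul]

/-- auxiliary -/
def kap0 (i : D.I) : A.V →ₗ[ZMod 2] A.V →ₗ[ZMod 2] (M.V →ₗ[ZMod 2] A.V ⊗[ZMod 2] CW D M) :=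
  LinearMap.mk₂ (ZMod 2) (fun a b => (TensorProduct.mk (ZMod 2) A.V (CW D M) a).comp
      ((Finsupp.lsingle i).comp (M.actL b)))
    (fun a a' b => by ext m; simp [TensorProduct.add_tmul])
    (fun c a b => by ext m; simp [TensorProduct.smul_tmul'])
    (fun a b b' => by ext m; simp [TensorProduct.tmul_add])
    (fun c a b => by ext m; simp [← Finsupp.smul_single])

/-- partial normal form -/
def kap : T2 C M →ₗ[ZMod 2] A.V ⊗[ZMod 2] CW D M :=
  TensorProduct.lift ((Finsupp.lsum ℕ (fun i => TensorProduct.lift (kap0 D M i))).comp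
    D.e.symm.toLinearMap)

theorem kap_gen (i : D.I) (a b : A.V) (m : M.V) :
    kap D M ((C.actR (C.actL a (D.g i)) b) ⊗ₜ m) = a ⊗ₜ Finsupp.single i (M.actL b m) := by
  simp [kap, kap0, D.e_symm_gen]

/-- induction -/
theorem cell_ind2 {p : T2 C M → Prop} (h0 : p 0) (ha : ∀ x y, p x → p y → p (x + y))
    (hg : ∀ i a b m, p ((C.actR (C.actL a (D.g i)) b) ⊗ₜ m)) (x : T2 C M) : p x := by
  induction x using TensorProduct.induction_on with
  | zero => exact h0
  | add x y hx hy => exact ha _ _ hx hy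
  | tmul r m =>
    refine D.ind (p := fun r => p (r ⊗ₜ m)) (by simpa using h0) ?_ ?_ r
    · intro x y hx hy; rw [TensorProduct.add_tmul]; exact ha _ _ hx hy
    · intro i a b; exact hg i a b m

theorem kap_R (r : C.V) (c : A.V) (m : M.V) : kap D M (C.actR r c ⊗ₜ m) = kap D M (r ⊗ₜ M.actL c m) := by
  refine D.ind (p := fun r => kap D M (C.actR r c ⊗ₜ m) = kap D M (r ⊗ₜ M.actL c m)) (by simp) ?_ ?_ r
  · intro x y hx hy; simp only [map_add, LinearMap.add_apply, TensorProduct.add_tmul, hx, hy]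
  · intro i a b
    rw [C.actR_mul, kap_gen, kap_gen, M.actL_mul]

/-- left action on the `A` factor -/
def lamA (c : A.V) : A.V ⊗[ZMod 2] CW D M →ₗ[ZMod 2] A.V ⊗[ZMod 2] CW D M :=
  TensorProduct.map (A.mul c) LinearMap.id
/-- right action on the `W` factor -/
def rhoA (c : A.V) : A.V ⊗[ZMod 2] CW D M →ₗ[ZMod 2] A.V ⊗[ZMod 2] CW D M :=
  TensorProduct.map LinearMap.id ((wR D M).flip c)

theorem kap_L (r : C.V) (c : A.V) (m : M.V) : kap D M (C.actL c r ⊗ₜ m) = lamA D M c (kap D M (r ⊗ₜ m)) := by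
  refine D.ind (p := fun r => kap D M (C.actL c r ⊗ₜ m) = lamA D M c (kap D M (r ⊗ₜ m))) (by simp) ?_ ?_ r
  · intro x y hx hy; simp only [map_add, TensorProduct.add_tmul, hx, hy]
  · intro i a b
    rw [← C.actLR, ← C.actL_mul, kap_gen, kap_gen]
    simp [lamA]

theorem kap_Rm (r : C.V) (c : A.V) (m : M.V) : kap D M (r ⊗ₜ M.actR m c) = rhoA D M c (kap D M (r ⊗ₜ m)) := by
  refine D.ind (p := fun r => kap D M (r ⊗ₜ M.actR m c) = rhoA D M c (kap D M (r ⊗ₜ m))) (by simp) ?_ ?_ r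
  · intro x y hx hy; simp only [map_add, TensorProduct.add_tmul, hx, hy]
  · intro i a b
    rw [kap_gen, kap_gen]
    simp [rhoA, wR_single, M.actLR]

/-- the pairing -/
def hB : A.V ⊗[ZMod 2] CW D M →ₗ[ZMod 2] A.V ⊗[ZMod 2] CW D M →ₗ[ZMod 2]
    CW D M ⊗[ZMod 2] CW D M :=
  TensorProduct.lift (LinearMap.mk₂ (ZMod 2) (fun a w => TensorProduct.map (wR D M w) ((wR D M).flip a))
    (fun a a' w => by rw [map_add, TensorProduct.map_add_right])
    (fun c a w => by rw [map_smul, TensorProduct.map_smul_right])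
    (fun a w w' => by rw [map_add, TensorProduct.map_add_left])
    (fun c a w => by rw [map_smul, TensorProduct.map_smul_left]))

theorem hB_tmul (a a' : A.V) (w w' : CW D M) :
    hB D M (a ⊗ₜ w) (a' ⊗ₜ w') = wR D M w a' ⊗ₜ wR D M w' a := by
  simp [hB]

theorem aw_ind2 {p : A.V ⊗[ZMod 2] CW D M → A.V ⊗[ZMod 2] CW D M → Prop}
    (h0 : ∀ y, p 0 y) (h0' : ∀ x, p x 0)
    (ha : ∀ x x' y, p x y → p x' y → p (x + x') y)
    (ha' : ∀ x y y', p x y → p x y' → p x (y + y'))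
    (h : ∀ r m r' m', p (r ⊗ₜ m) (r' ⊗ₜ m')) (x y) : p x y := by
  induction x using TensorProduct.induction_on with
  | zero => exact h0 _
  | add x x' hx hx' => exact ha _ _ _ hx hx'
  | tmul r m =>
    induction y using TensorProduct.induction_on with
    | zero => exact h0' _
    | add x x' hx hx' => exact ha' _ _ _ hx hx'
    | tmul r' m' => exact h _ _ _ _

theorem hB_swp (q q') : swp (CW D M) (hB D M q q') = hB D M q' q := by
  refine aw_ind2 D M (p := fun q q' => swp (CW D M) (hB D M q q') = hB D M q' q) ?_ ?_ ?_ ?_ ?_ q q'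
  · intro y; simp
  · intro y; simp
  · intro x x' y h h'; simp only [map_add, LinearMap.add_apply, h, h']
  · intro x x' y h h'; simp only [map_add, LinearMap.add_apply, h, h']
  · intro a w a' w'; simp [hB_tmul]

theorem hB_1 (c : A.V) (q q') : hB D M (lamA D M c q) q' = hB D M q (rhoA D M c q') := by
  refine aw_ind2 D M (p := fun q q' => hB D M (lamA D M c q) q' = hB D M q (rhoA D M c q')) ?_ ?_ ?_ ?_ ?_ q q'
  · intro y; simp
  · intro y; simp
  · intro x x' y h h'; simp only [map_add, LinearMap.add_apply, h, h']
  · intro x x' y h h'; simp only [map_add, h, h']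
  · intro a w a' w'; simp [hB_tmul, lamA, rhoA, wR_mul]

theorem hB_2 (c : A.V) (q q') : hB D M (rhoA D M c q) q' = hB D M q (lamA D M c q') := by
  rw [← hB_swp, ← hB_1, hB_swp]

/-- normal form on `T4` -/
def nf4 : T4 C M →ₗ[ZMod 2] CW D M ⊗[ZMod 2] CW D M :=
  ((TensorProduct.lift (hB D M)).comp (TensorProduct.map (kap D M) (kap D M))).comp
    (asc C M).symm.toLinearMap

theorem nf4_asc (x y : T2 C M) : nf4 D M (asc C M (x ⊗ₜ y)) = hB D M (kap D M x) (kap D M y) := by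
  simp [nf4]

theorem nf4_rel {z : T4 C M} (hz : z ∈ rel4 C M) : nf4 D M z = 0 := by
  have : rel4 C M ≤ LinearMap.ker (nf4 D M) := by
    apply rel4_le <;> intro r a m r' m' <;>
      rw [LinearMap.mem_ker, map_add, nf4_asc, nf4_asc]
    · rw [kap_R]; exact z2_add_self _
    · rw [kap_L, kap_Rm, hB_1]; exact z2_add_self _
    · rw [kap_L, kap_Rm, hB_2]; exact z2_add_self _
    · rw [kap_R]; exact z2_add_self _
  exact this hz

theorem nf4_tau (z : T4 C M) : nf4 D M (tau4 C M z) = swp _ (nf4 D M z) := by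
  refine asc_ind (p := fun z => nf4 D M (tau4 C M z) = swp _ (nf4 D M z)) (by simp) ?_ ?_ z
  · intro x y hx hy; simp only [map_add, hx, hy]
  · intro x y; rw [tau4_asc, nf4_asc, nf4_asc, hB_swp]

/-- section -/
def sig : CW D M →ₗ[ZMod 2] T2 C M :=
  Finsupp.lsum ℕ (fun i => TensorProduct.mk (ZMod 2) C.V M.V (D.g i))

theorem sig_single (i : D.I) (m : M.V) : sig D M (Finsupp.single i m) = D.g i ⊗ₜ m := by
  simp [sig]

theorem kap_sig (w : CW D M) : kap D M (sig D M w) = A.one ⊗ₜ w := by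
  induction w using Finsupp.induction_linear with
  | zero => simp
  | add f g h h' => simp only [map_add, TensorProduct.tmul_add, h, h']
  | single i m =>
    rw [sig_single]
    have := kap_gen D M i A.one A.one m
    rwa [C.actL_one, C.actR_one, M.actL_one] at this

/-- section on `T4` -/
def sig4 : CW D M ⊗[ZMod 2] CW D M →ₗ[ZMod 2] T4 C M :=
  (asc C M).toLinearMap.comp (TensorProduct.map (sig D M) (sig D M))

theorem sig4_tmul (w w' : CW D M) : sig4 D M (w ⊗ₜ w') = asc C M (sig D M w ⊗ₜ sig D M w') := rfl

theorem nf4_sig4 (t) : nf4 D M (sig4 D M t) = t := by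
  induction t using TensorProduct.induction_on with
  | zero => simp
  | add x y hx hy => simp only [map_add, hx, hy]
  | tmul w w' => rw [sig4_tmul, nf4_asc, kap_sig, kap_sig, hB_tmul, wR_one, wR_one]

theorem sig4_swp (t) : sig4 D M (swp _ t) = tau4 C M (sig4 D M t) := by
  induction t using TensorProduct.induction_on with
  | zero => simp
  | add x y hx hy => simp only [map_add, hx, hy]
  | tmul w w' => rw [sig4_tmul, tau4_asc]; simp [sig4_tmul]

/-- normal form on `T2` -/
def nf2 : T2 C M →ₗ[ZMod 2] CW D M := (TensorProduct.lift (wR D M).flip).comp (kap D M)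

theorem nf2_gen (i : D.I) (a b : A.V) (m : M.V) :
    nf2 D M ((C.actR (C.actL a (D.g i)) b) ⊗ₜ m) = Finsupp.single i (M.actR (M.actL b m) a) := by
  simp [nf2, kap_gen, wR_single]

theorem nf2_sig (w : CW D M) : nf2 D M (sig D M w) = w := by
  simp [nf2, kap_sig, wR_one]

theorem nf2_rel {z : T2 C M} (hz : z ∈ rel2 C M) : nf2 D M z = 0 := by
  have : rel2 C M ≤ LinearMap.ker (nf2 D M) := by
    apply rel2_le
    · intro r a m
      rw [LinearMap.mem_ker, map_add, nf2, LinearMap.comp_apply, LinearMap.comp_apply, kap_R]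
      exact z2_add_self _
    · intro r a m
      rw [LinearMap.mem_ker, map_add, nf2, LinearMap.comp_apply, LinearMap.comp_apply, kap_L, kap_Rm]
      have : ∀ q, TensorProduct.lift (wR D M).flip (lamA D M a q) = TensorProduct.lift (wR D M).flip (rhoA D M a q) := by
        intro q
        induction q using TensorProduct.induction_on with
        | zero => simp
        | add x y hx hy => simp only [map_add, hx, hy]
        | tmul b w => simp [lamA, rhoA, wR_mul]
      rw [this]; exact z2_add_self _
  exact this hz

theorem sig_nf2 (z : T2 C M) : z + sig D M (nf2 D M z) ∈ rel2 C M := by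
  refine cell_ind2 D M (p := fun z => z + sig D M (nf2 D M z) ∈ rel2 C M) (by simp) ?_ ?_ z
  · intro x y hx hy
    have := Submodule.add_mem _ hx hy
    rwa [add_add_add_comm, ← map_add, ← map_add] at this
  · intro i a b m
    rw [nf2_gen, sig_single]
    have h1 := rel2_R (R := C) (M := M) (C.actL a (D.g i)) b m
    have h2 := rel2_L (R := C) (M := M) (D.g i) a (M.actL b m)
    have := Submodule.add_mem _ h1 h2
    rwa [add_assoc, z2_add_cancel] at this

theorem sig4_nf4 (z : T4 C M) : z + sig4 D M (nf4 D M z) ∈ rel4 C M := by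
  refine asc_ind (p := fun z => z + sig4 D M (nf4 D M z) ∈ rel4 C M) (by simp) ?_ ?_ z
  · intro x y hx hy
    have := Submodule.add_mem _ hx hy
    rwa [add_add_add_comm, ← map_add, ← map_add] at this
  · intro x y
    refine cell_ind2 D M (p := fun x => asc C M (x ⊗ₜ y) + sig4 D M (nf4 D M (asc C M (x ⊗ₜ y))) ∈ rel4 C M) (by simp) ?_ ?_ x
    · intro x x' hx hy
      have := Submodule.add_mem _ hx hy
      rw [TensorProduct.add_tmul]; simp only [map_add] at this ⊢; rwa [add_add_add_comm] at this
    · intro i a b m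
      refine cell_ind2 D M (p := fun y => asc C M ((C.actR (C.actL a (D.g i)) b ⊗ₜ[ZMod 2] m) ⊗ₜ y) +
        sig4 D M (nf4 D M (asc C M ((C.actR (C.actL a (D.g i)) b ⊗ₜ[ZMod 2] m) ⊗ₜ y))) ∈ rel4 C M) (by simp) ?_ ?_ y
      · intro x x' hx hy
        have := Submodule.add_mem _ hx hy
        rw [TensorProduct.tmul_add]; simp only [map_add] at this ⊢; rwa [add_add_add_comm] at this
      · intro j a' b' m'
        rw [nf4_asc, kap_gen, kap_gen, hB_tmul, wR_single, wR_single, sig4_tmul, sig_single, sig_single]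
        have h1 := rel4_1 (R := C) (M := M) (C.actL a (D.g i)) b m (C.actR (C.actL a' (D.g j)) b') m'
        have h2 := rel4_2 (R := C) (M := M) (D.g i) a (M.actL b m) (C.actR (C.actL a' (D.g j)) b') m'
        have h4 := rel4_4 (R := C) (M := M) (D.g i) (b') (M.actL b m) (C.actL a' (D.g j)) (M.actR m' a)
        have h3 := rel4_3 (R := C) (M := M) (D.g i) a' (M.actL b m) (D.g j) (M.actL b' (M.actR m' a))
        rw [add_comm] at h3
        have := Submodule.add_mem _ (Submodule.add_mem _ h1 h2) (Submodule.add_mem _ h4 h3)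
        rw [M.actLR b']
        simpa only [add_assoc, z2_add_cancel] using this

theorem sig_gr {n : ℤ} {w : CW D M} (hw : w ∈ cwgr D M n) : sig D M w ∈ gr2 C M n := by
  rw [sig, Finsupp.lsum_apply]
  refine Submodule.sum_mem _ fun i _ => ?_
  exact tmul_gr2 (D.g_gr i) (hw i) (by ring)

theorem sig4_gr {n : ℤ} {t} (ht : t ∈ GG (cwgr D M) n) : sig4 D M t ∈ gr4 C M n := by
  have : GG (cwgr D M) n ≤ Submodule.comap (sig4 D M) (gr4 C M n) := by
    rw [GG, Submodule.span_le]
    rintro _ ⟨i, j, w, hw, w', hw', e, rfl⟩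
    exact asc_gr (sig_gr D M hw) (sig_gr D M hw') e
  exact this ht

theorem gr2_cell_le {n : ℤ} {S : Submodule (ZMod 2) (T2 C M)}
    (h : ∀ i p q j, p + q + D.deg i + j = n → ∀ a ∈ A.gr p, ∀ b ∈ A.gr q, ∀ m ∈ M.gr j,
      (C.actR (C.actL a (D.g i)) b) ⊗ₜ m ∈ S) : gr2 C M n ≤ S := by
  rw [gr2, Submodule.span_le]
  rintro _ ⟨k, j, r, hr, m, hm, e, rfl⟩
  rw [← D.gr_eq] at hr
  have : Submodule.span (ZMod 2) {x | ∃ i p q, ∃ a ∈ A.gr p, ∃ b ∈ A.gr q,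
    p + q + D.deg i = k ∧ x = C.actR (C.actL a (D.g i)) b} ≤
      Submodule.comap ((TensorProduct.mk (ZMod 2) C.V M.V).flip m) S := by
    rw [Submodule.span_le]
    rintro _ ⟨i, p, q, a, ha, b, hb, e', rfl⟩
    exact h i p q j (by omega) a ha b hb m hm
  exact this hr

theorem nf2_gr {n : ℤ} {z : T2 C M} (hz : z ∈ gr2 C M n) : nf2 D M z ∈ cwgr D M n := by
  have : gr2 C M n ≤ Submodule.comap (nf2 D M) (cwgr D M n) := by
    apply gr2_cell_le
    intro i p q j e a ha b hb m hm
    rw [Submodule.mem_comap, nf2_gen]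
    exact cwgr_single D M (M.actR_gr _ _ _ (M.actL_gr _ _ b hb m hm) a ha) (by omega)
  exact this hz

theorem nf4_gr {n : ℤ} {z : T4 C M} (hz : z ∈ gr4 C M n) : nf4 D M z ∈ GG (cwgr D M) n := by
  have : gr4 C M n ≤ Submodule.comap (nf4 D M) (GG (cwgr D M) n) := by
    apply gr4_le
    intro k l e x hx y hy
    rw [Submodule.mem_comap, nf4_asc]
    have key : gr2 C M k ≤ Submodule.comap (((hB D M).flip (kap D M y)).comp (kap D M)) (GG (cwgr D M) n) := by
      apply gr2_cell_le
      intro i p q j e a ha b hb m hm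
      have key2 : gr2 C M l ≤ Submodule.comap (((hB D M) (kap D M ((C.actR (C.actL a (D.g i)) b) ⊗ₜ m))).comp (kap D M)) (GG (cwgr D M) n) := by
        apply gr2_cell_le
        intro i' p' q' j' e' a' ha' b' hb' m' hm'
        rw [Submodule.mem_comap, LinearMap.comp_apply, kap_gen, kap_gen, hB_tmul, wR_single, wR_single]
        exact Submodule.subset_span ⟨_, _, _, cwgr_single D M (M.actR_gr _ _ _ (M.actL_gr _ _ b hb m hm) a' ha') rfl,
          _, cwgr_single D M (M.actR_gr _ _ _ (M.actL_gr _ _ b' hb' m' hm') a ha) rfl, by omega, rfl⟩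
      exact key2 hy
    exact key hx
  exact this hz

end celltate

theorem tateOK_cell {C : DGBimod A} (D : CellData C) (M : DGBimod A) : TateOK C M := by
  let P : HCQ4 C M →ₗ[ZMod 2] CW D M ⊗[ZMod 2] CW D M :=
    (rel4 C M).liftQ (nf4 D M) (fun z hz => nf4_rel D M hz)
  let S : CW D M ⊗[ZMod 2] CW D M →ₗ[ZMod 2] HCQ4 C M := (rel4 C M).mkQ.comp (sig4 D M)
  have P_mk : ∀ x, P ((rel4 C M).mkQ x) = nf4 D M x := fun x => rfl
  have PS : ∀ t, P (S t) = t := fun t => nf4_sig4 D M t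
  have SP : ∀ x, S (P x) = x := by
    intro x
    obtain ⟨x, rfl⟩ := Submodule.mkQ_surjective _ x
    have h := sig4_nf4 D M x
    rw [add_comm] at h
    exact mk_eq_of_add h
  have Pt : ∀ x, P (ktau C M x) = swp _ (P x) := by
    intro x
    obtain ⟨x, rfl⟩ := Submodule.mkQ_surjective _ x
    exact nf4_tau D M x
  have St : ∀ t, S (swp _ t) = ktau C M (S t) := by
    intro t
    have h : (rel4 C M).mkQ (sig4 D M (swp _ t)) = (rel4 C M).mkQ (tau4 C M (sig4 D M t)) := by rw [sig4_swp]
    exact h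
  have Sm : ∀ w, S (w ⊗ₜ w) = kmul C M (sig D M w) (sig D M w) := fun w => rfl
  have Pg : ∀ n, ∀ x ∈ kgr C M n, P x ∈ GG (cwgr D M) n := by
    rintro n _ ⟨x, hx, rfl⟩
    exact nf4_gr D M hx
  have Sg : ∀ n, ∀ t ∈ GG (cwgr D M) n, S t ∈ kgr C M n := fun n t ht => ⟨_, sig4_gr D M ht, rfl⟩
  have hin := cwgr_internal D M
  refine ⟨?_, ?_, ?_, ?_⟩
  · intro k x hx hs
    obtain ⟨z, hz, y, hy, e⟩ := swp_even hin (Pg _ x hx) (by rw [← Pt, ← map_add, hs, map_zero])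
    refine ⟨sig D M z, sig_gr D M hz, S y, Sg _ y hy, ?_⟩
    rw [← Sm, ← St, ← map_add, ← map_add, ← e, SP]
  · intro k x hx hs
    obtain ⟨y, hy, e⟩ := swp_odd hin (Pg _ x hx) (by rw [← Pt, ← map_add, hs, map_zero])
    refine ⟨S y, Sg _ y hy, ?_⟩
    rw [← St, ← map_add, ← e, SP]
  · intro z y h
    have hz := sig_nf2 D M z
    obtain ⟨y', hy'⟩ := kmul_rel hz
    have : nf2 D M z = 0 := by
      apply swp_inj (y := P (y + y' + kmul C M z (sig D M (nf2 D M z))))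
      rw [← Pt, ← map_add, ← PS (nf2 D M z ⊗ₜ nf2 D M z), Sm]
      congr 1
      simp only [map_add, LinearMap.add_apply, ktau_kmul] at hy' ⊢
      rw [h] at hy'
      have h3 := congrArg (fun t => y + ktau C M y + (kmul C M z (sig D M (nf2 D M z)) +
        kmul C M (sig D M (nf2 D M z)) z) + t) hy'
      generalize kmul C M z (sig D M (nf2 D M z)) = u1 at *
      generalize kmul C M (sig D M (nf2 D M z)) z = u2 at *
      generalize kmul C M (sig D M (nf2 D M z)) (sig D M (nf2 D M z)) = u3 at *
      calc u3 = (y + y) + (ktau C M y + ktau C M y) + (u1 + u1) + (u2 + u2) + u3 := by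
            simp only [z2_add_self, zero_add]
        _ = _ := by
            refine Eq.trans ?_ (h3.trans ?_) <;> abel
    rw [this, map_zero, add_zero] at hz
    exact hz
  · intro k z hz hr
    obtain ⟨y, hy⟩ := kmul_rel hr
    have hzz : kmul C M z z ∈ kgr C M (2 * k) := ⟨_, asc_gr hz hz (by ring), rfl⟩
    obtain ⟨y', hy', e⟩ := swp_homog hin (Pg _ _ hzz) (y := P y) (by rw [← Pt, ← map_add, ← hy])
    refine ⟨S y', Sg _ _ hy', ?_⟩
    rw [← St, ← map_add, ← e, SP]



theorem tateOK_of_retract {R : DGBimod A} (h : IsCellRetract R) (M : DGBimod A) : TateOK R M := by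
  obtain ⟨C, hC, ι, r, hι, hr, _, e⟩ := h
  obtain ⟨D⟩ := cellData_exists hC
  exact TateOK.retract hι hr e (tateOK_cell D M)
end piece7

section piece8
variable {A : DGA (ZMod 2)}

/-- The Tate data of a bimodule. -/
abbrev tateTD (R M : DGBimod A) (h : TateOK R M) : TD where
  T2 := T2 R M
  K := HCQ4 R M
  rel2 := rel2 R M
  gr2 := gr2 R M
  d2 := d2 R M
  gr := kgr R M
  d := kd R M
  tau := ktau R M
  mul := kmul R M
  d_d := by
    intro x
    obtain ⟨x, rfl⟩ := Submodule.mkQ_surjective _ x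
    rw [kd_mk, kd_mk, d4_d4, map_zero]
  d_gr := by
    rintro n _ ⟨x, hx, rfl⟩
    exact ⟨_, d4_gr hx, rfl⟩
  tau_tau := by
    intro x
    obtain ⟨x, rfl⟩ := Submodule.mkQ_surjective _ x
    rw [ktau_mk, ktau_mk, tau4_tau4]
  tau_gr := by
    rintro n _ ⟨x, hx, rfl⟩
    exact ⟨_, tau4_gr hx, rfl⟩
  tau_d := by
    intro x
    obtain ⟨x, rfl⟩ := Submodule.mkQ_surjective _ x
    rw [kd_mk, ktau_mk, ktau_mk, kd_mk, tau4_d4]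
  tau_mul := ktau_kmul
  d_mul := by
    intro x y
    rw [kmul_apply, kd_mk, d4_asc, map_add]; rfl
  mul_gr := fun i j x hx y hy => ⟨_, asc_gr hx hy rfl, rfl⟩
  d2_gr := fun n x hx => d2_gr hx
  d2_d2 := fun x => d2_d2 x
  surj_even := h.even
  surj_odd := h.odd
  inj := h.inj
  homog := h.homog

section link
variable (R M : DGBimod A)

/-- total differential -/
def tD : (ℤ →₀ T4 R M) →ₗ[ZMod 2] (ℤ →₀ T4 R M) :=
  (Finsupp.lmapDomain (T4 R M) (ZMod 2) (fun p => p - 1)).comp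
    (Finsupp.mapRange.linearMap (LinearMap.id + tau4 R M)) + Finsupp.mapRange.linearMap (d4 R M)
/-- relations -/
def tN : Submodule (ZMod 2) (ℤ →₀ T4 R M) := ⨅ p : ℤ, Submodule.comap (Finsupp.lapply p) (rel4 R M)
/-- row filtration -/
def tF (q n : ℤ) : Submodule (ZMod 2) (ℤ →₀ T4 R M) :=
  ⨆ (j : ℤ) (_ : j ≤ q), Submodule.map (Finsupp.lsingle (n - j)) (gr4 R M j)
/-- approximate cycles -/
def tZ (r p n : ℤ) : Submodule (ZMod 2) (ℤ →₀ T4 R M) :=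
  (tF R M p n ⊔ tN R M) ⊓ Submodule.comap (tD R M) (tF R M (p - r) (n - 1) ⊔ tN R M)

theorem tzero_iff (r p n : ℤ) : (TateBicx R M).zeroDiff (TateBicx R M).Frow r p n ↔
    Submodule.map (tD R M) (tZ R M r p n) ≤ Submodule.map (tD R M) (tZ R M (r - 1) (p - 1) n) ⊔
      tZ R M (r - 1) (p - r - 1) (n - 1) ⊔ tN R M := Iff.rfl

/-- projection to the quotient bicomplex -/
def tphi : (ℤ →₀ T4 R M) →ₗ[ZMod 2] (ℤ →₀ HCQ4 R M) := Finsupp.mapRange.linearMap (rel4 R M).mkQ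

theorem tphi_apply (x : ℤ →₀ T4 R M) (c : ℤ) : tphi R M x c = (rel4 R M).mkQ (x c) := rfl

theorem tphi_N (x : ℤ →₀ T4 R M) : x ∈ tN R M ↔ tphi R M x = 0 := by
  have : x ∈ tN R M ↔ ∀ c, x c ∈ rel4 R M := by
    simp only [tN, Submodule.mem_iInf, Submodule.mem_comap, Finsupp.lapply_apply]
  rw [this]
  constructor
  · intro h; ext c
    exact (Submodule.Quotient.mk_eq_zero _).2 (h c)
  · intro h c
    have := DFunLike.congr_fun h c
    exact (Submodule.Quotient.mk_eq_zero _).1 this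

theorem tD_apply (x : ℤ →₀ T4 R M) (c : ℤ) : tD R M x c =
    d4 R M (x c) + (x (c + 1) + tau4 R M (x (c + 1))) := by
  have e2 : (Finsupp.lmapDomain (T4 R M) (ZMod 2) (fun p => p - 1)
    (Finsupp.mapRange.linearMap (LinearMap.id + tau4 R M) x)) c = x (c + 1) + tau4 R M (x (c + 1)) := by
    have hinj : Function.Injective (fun p : ℤ => p - 1) := sub_left_injective
    have h := Finsupp.mapDomain_apply hinj (Finsupp.mapRange.linearMap (LinearMap.id + tau4 R M) x) (c + 1)
    simp only [add_sub_cancel_right] at h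
    exact h
  have e3 : tD R M x c = (Finsupp.lmapDomain (T4 R M) (ZMod 2) (fun p => p - 1)
    (Finsupp.mapRange.linearMap (LinearMap.id + tau4 R M) x)) c + d4 R M (x c) := rfl
  rw [e3, e2, add_comm]

theorem tphi_D (h : TateOK R M) (x : ℤ →₀ T4 R M) (c : ℤ) :
    tphi R M (tD R M x) c = (tateTD R M h).dd (tphi R M x) c := by
  rw [tphi_apply, tD_apply]; rfl

theorem tF_iff (q n : ℤ) (x : ℤ →₀ T4 R M) :
    x ∈ tF R M q n ⊔ tN R M ↔
      (∀ c, tphi R M x c ∈ kgr R M (n - c)) ∧ (∀ c, q < n - c → tphi R M x c = 0) := by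
  classical
  constructor
  · intro hx
    let S : Submodule (ZMod 2) (ℤ →₀ T4 R M) :=
      { carrier := {x | (∀ c, tphi R M x c ∈ kgr R M (n - c)) ∧ (∀ c, q < n - c → tphi R M x c = 0)}
        add_mem' := by
          rintro x y ⟨h1, h2⟩ ⟨h3, h4⟩
          refine ⟨fun c => ?_, fun c hc => ?_⟩
          · rw [map_add, Finsupp.add_apply]; exact Submodule.add_mem _ (h1 c) (h3 c)
          · rw [map_add, Finsupp.add_apply, h2 c hc, h4 c hc, add_zero]
        zero_mem' := ⟨fun c => by rw [map_zero]; exact Submodule.zero_mem _, fun c _ => by rw [map_zero]; rfl⟩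
        smul_mem' := by
          rintro a x ⟨h1, h2⟩
          refine ⟨fun c => ?_, fun c hc => ?_⟩
          · rw [map_smul, Finsupp.smul_apply]; exact Submodule.smul_mem _ _ (h1 c)
          · rw [map_smul, Finsupp.smul_apply, h2 c hc, smul_zero] }
    have hS : tF R M q n ⊔ tN R M ≤ S := by
      refine sup_le (iSup_le fun j => iSup_le fun hj => ?_) ?_
      · rintro _ ⟨y, hy, rfl⟩
        have key : ∀ c, tphi R M (Finsupp.single (n - j) y) c = if n - j = c then (rel4 R M).mkQ y else 0 := by
          intro c
          rw [tphi_apply, Finsupp.single_apply]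
          split_ifs
          · rfl
          · exact map_zero _
        refine ⟨fun c => ?_, fun c hc => ?_⟩
        · change tphi R M (Finsupp.single (n - j) y) c ∈ _
          rw [key]
          split_ifs with e
          · have e' : n - c = j := by omega
            rw [e']; exact ⟨y, hy, rfl⟩
          · exact Submodule.zero_mem _
        · change tphi R M (Finsupp.single (n - j) y) c = _
          rw [key, if_neg (by omega)]
      · intro y hy
        have := (tphi_N R M y).1 hy
        refine ⟨fun c => ?_, fun c hc => ?_⟩
        · rw [this]; exact Submodule.zero_mem _
        · rw [this]; rfl
    exact hS hx
  · rintro ⟨h1, h2⟩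
    choose y hy hy' using h1
    let z : ℤ →₀ T4 R M := ∑ c ∈ (tphi R M x).support, Finsupp.single c (y c)
    have hz : z ∈ tF R M q n := by
      refine Submodule.sum_mem _ fun c hc => ?_
      have hne := Finsupp.mem_support_iff.1 hc
      have hq : n - c ≤ q := by
        by_contra hlt
        exact hne (h2 c (by omega))
      refine Submodule.mem_iSup_of_mem (n - c) (Submodule.mem_iSup_of_mem hq ?_)
      have e : n - (n - c) = c := by ring
      rw [e]
      exact ⟨y c, hy c, rfl⟩
    have hzx : x + z ∈ tN R M := by
      rw [tphi_N, map_add]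
      have : tphi R M z = tphi R M x := by
        simp only [z, map_sum]
        have e : ∀ c, tphi R M (Finsupp.single c (y c)) = Finsupp.single c (tphi R M x c) := by
          intro c
          rw [← hy']
          exact Finsupp.mapRange_single (hf := map_zero _)
        simp only [e]
        exact Finsupp.sum_single _
      rw [this, z2_add_self]
    have : x = z + (x + z) := by rw [add_comm x z, z2_add_cancel]
    rw [this]
    exact Submodule.add_mem_sup hz hzx

theorem tZ_iff (h : TateOK R M) (r p n : ℤ) (x : ℤ →₀ T4 R M) :
    x ∈ tZ R M r p n ↔ (tateTD R M h).Zp r p n (tphi R M x) := by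
  have e : x ∈ tZ R M r p n ↔
    (x ∈ tF R M p n ⊔ tN R M ∧
      (tD R M x) ∈ tF R M (p - r) (n - 1) ⊔ tN R M) := Iff.rfl
  rw [e, tF_iff, tF_iff]
  constructor
  · rintro ⟨⟨h1, h2⟩, h3, h4⟩
    exact ⟨h1, h2, fun c hc => by rw [← tphi_D]; exact h4 c hc⟩
  · rintro ⟨h1, h2, h3⟩
    refine ⟨⟨h1, h2⟩, fun c => ?_, fun c hc => ?_⟩
    · rw [tphi_D R M h]; exact (tateTD R M h).dd_gr n _ h1 c
    · rw [tphi_D R M h]; exact h3 c hc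

theorem tDD (h : TateOK R M) (x : ℤ →₀ T4 R M) (c : ℤ) :
    (tateTD R M h).dd (tphi R M (tD R M x)) c = 0 := by
  have key : ∀ E : TD, ∀ u v w : E.K, E.d (E.d u + (v + E.tau v)) + ((E.d v + (w + E.tau w)) +
      E.tau (E.d v + (w + E.tau w))) = 0 := by
    intro E u v w
    simp only [map_add, E.d_d, E.tau_d, E.tau_tau, zero_add]
    rw [show E.d v + E.d (E.tau v) + (E.d v + (w + E.tau w) + (E.d (E.tau v) + (E.tau w + w))) =
      (E.d v + E.d v) + (E.d (E.tau v) + E.d (E.tau v)) + (w + w) + (E.tau w + E.tau w) by abel]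
    simp only [z2_add_self, zero_add]
  rw [TD.dd, tphi_D R M h, tphi_D R M h]
  exact key (tateTD R M h) _ _ _

theorem piFormal_iff (h : TateOK R M) : PiFormalBimod R M ↔ (tateTD R M h).Collapse := by
  have hsurj : Function.Surjective (tphi R M) := Finsupp.mapRange_surjective _ (map_zero _) (Submodule.mkQ_surjective _)
  have hadd : ∀ x y : ℤ →₀ T4 R M, (tD R M (x + y)) =
      (tD R M x) + (tD R M y) := fun x y =>
    map_add (tD R M) x y
  have step : ∀ r p n : ℤ, Submodule.map (tD R M) (tZ R M r p n) ≤ Submodule.map (tD R M) (tZ R M (r - 1) (p - 1) n) ⊔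
      tZ R M (r - 1) (p - r - 1) (n - 1) ⊔ tN R M ↔
      ∀ x, (tateTD R M h).Zp r p n x → ∃ x', (tateTD R M h).Zp (r - 1) (p - 1) n x' ∧
        (tateTD R M h).Zp (r + 1) p n (x + x') := by
    intro r p n
    constructor
    · intro H x hx
      obtain ⟨x, rfl⟩ := hsurj x
      have h1 : (tD R M x) ∈ Submodule.map (tD R M)
          (tZ R M r p n) := ⟨x, (tZ_iff R M h r p n x).2 hx, rfl⟩
      have h2 := H h1
      obtain ⟨a, ha, ν, hν, e1⟩ := Submodule.mem_sup.1 h2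
      obtain ⟨_, ⟨x', hx', rfl⟩, w, hw, e2⟩ := Submodule.mem_sup.1 ha
      have hx'' := (tZ_iff R M h _ _ _ x').1 hx'
      refine ⟨tphi R M x', hx'', ?_⟩
      have e3 : (tD R M (x + x')) = (w : ℤ →₀ T4 R M) + ν := by
        rw [hadd, ← e1, ← e2]
        have : ∀ u w ν : (ℤ →₀ T4 R M), u + w + ν + u = w + ν := by
          intro u w ν
          rw [show u + w + ν + u = (u + u) + (w + ν) by abel, z2_add_self, zero_add]
        exact this _ _ _
      have hw' := (tZ_iff R M h _ _ _ w).1 hw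
      refine ⟨fun c => Submodule.add_mem _ (hx.1 c) (hx''.1 c), fun c hc => ?_, fun c hc => ?_⟩
      · have t1 := hx.2.1 c hc
        have t2 := hx''.2.1 c (by omega)
        rw [Finsupp.add_apply, t1, t2, add_zero]
      · rw [← map_add, ← tphi_D R M h, e3, map_add, (tphi_N R M ν).1 hν, add_zero]
        exact hw'.2.1 c (by omega)
    · rintro H _ ⟨x, hx, rfl⟩
      obtain ⟨x', hx', hxx⟩ := H _ ((tZ_iff R M h r p n x).1 hx)
      obtain ⟨x', rfl⟩ := hsurj x'
      have e3 : (tD R M x) = (tD R M x') +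
          (tD R M (x + x')) := by
        rw [hadd, add_comm (tD R M x)]
        exact (z2_add_cancel (V := ℤ →₀ T4 R M) _ _).symm
      have m1 : (tD R M x') ∈ Submodule.map (tD R M)
          (tZ R M (r - 1) (p - 1) n) :=
        ⟨x', (tZ_iff R M h _ _ _ x').2 hx', rfl⟩
      have m2 : (tD R M (x + x')) ∈
          tZ R M (r - 1) (p - r - 1) (n - 1) := by
        rw [tZ_iff R M h]
        rw [← map_add] at hxx
        refine ⟨fun c => ?_, fun c hc => ?_, fun c hc => tDD R M h _ c⟩
        · rw [tphi_D R M h]; exact (tateTD R M h).dd_gr n _ hxx.1 c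
        · rw [tphi_D R M h]; exact hxx.2.2 c (by omega)
      rw [SetLike.mem_coe] at hx
      have : (tD R M x) ∈ Submodule.map (tD R M)
          (tZ R M (r - 1) (p - 1) n) ⊔
          tZ R M (r - 1) (p - r - 1) (n - 1) := by
        rw [e3]; exact Submodule.add_mem_sup m1 m2
      exact Submodule.mem_sup_left this
  constructor
  · intro H r hr p n x hx
    exact (step r p n).1 (H r hr p n) x hx
  · intro H r hr p n
    exact (step r p n).2 (H r hr p n)
end link

/-- functoriality -/
def tateHom {R M M' : DGBimod A} (h : TateOK R M) (h' : TateOK R M') {s : ℤ} {g : M.V →ₗ[ZMod 2] M'.V}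
    (hg : IsBHom M M' s g) : TD.Hom (tateTD R M h) (tateTD R M' h') s where
  f2 := TensorProduct.map LinearMap.id g
  f := kmap (isB_id R) hg
  f2_gr := fun n z hz => by
    exact gr2_map (isB_id R).1 hg.1 (by ring) hz
  f_gr := fun n z hz => by
    have := kmap_gr (isB_id R) hg hz
    rwa [zero_add] at this
  f2_rel := fun z hz => rel2_map (isB_id R).2.2.1 (isB_id R).2.2.2 hg.2.2.1 hg.2.2.2 hz
  f2_d := fun z => by
    exact d2_map (isB_id R).2.1 hg.2.1 z
  f_d := fun z => kmap_kd (isB_id R) hg z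
  f_tau := fun z => kmap_ktau (isB_id R) hg z
  f_mul := fun x y => kmap_kmul (isB_id R) hg x y
end piece8

section piece9
set_option linter.unusedVariables false
set_option linter.unusedSimpArgs false
variable {A : DGA (ZMod 2)}

/-- The cocone of a degree zero chain map. -/
def cocone {W W' : DGBimod A} (φ : W.V →ₗ[ZMod 2] W'.V) (hφ : IsBHom W W' 0 φ) : DGBimod A where
  V := W.V × W'.V
  gr := fun n => (W.gr n).prod (W'.gr (n + 1))
  internal := by
    classical
    refine internal_of (fun n => (comp W.gr W.internal n).prodMap (comp W'.gr W'.internal (n + 1))) ?_ ?_ ?_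
    · rintro n ⟨x, y⟩ ⟨hx, hy⟩
      exact Prod.ext (comp_same _ hx) (comp_same _ hy)
    · rintro n m hnm ⟨x, y⟩ ⟨hx, hy⟩
      exact Prod.ext (comp_ne _ hx hnm) (comp_ne _ hy (by omega))
    · rintro ⟨x, y⟩
      have e : ((x, y) : W.V × W'.V) = LinearMap.inl (ZMod 2) W.V W'.V x + LinearMap.inr (ZMod 2) W.V W'.V y := by simp
      rw [e]
      refine Submodule.add_mem _ ?_ ?_
      · refine int_ind W.internal (p := fun x => LinearMap.inl (ZMod 2) W.V W'.V x ∈ _) x (by rw [map_zero]; exact Submodule.zero_mem _) ?_ ?_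
        · intro x y hx hy; rw [map_add]; exact Submodule.add_mem _ hx hy
        · intro i x hx; exact Submodule.mem_iSup_of_mem i ⟨hx, Submodule.zero_mem _⟩
      · refine int_ind W'.internal (p := fun x => LinearMap.inr (ZMod 2) W.V W'.V x ∈ _) y (by rw [map_zero]; exact Submodule.zero_mem _) ?_ ?_
        · intro x y hx hy; rw [map_add]; exact Submodule.add_mem _ hx hy
        · intro i x hx
          refine Submodule.mem_iSup_of_mem (i - 1) ⟨Submodule.zero_mem _, ?_⟩
          have e : i - 1 + 1 = i := by ring
          rw [e]; exact hx
  d := LinearMap.prod (W.d.comp (LinearMap.fst _ _ _)) (φ.comp (LinearMap.fst _ _ _) + W'.d.comp (LinearMap.snd _ _ _))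
  d_d := by
    rintro ⟨x, y⟩
    refine Prod.ext (W.d_d x) ?_
    simp [hφ.2.1, W'.d_d, z2_add_self]
  d_gr := by
    rintro i ⟨x, y⟩ ⟨hx, hy⟩
    refine ⟨W.d_gr i x hx, ?_⟩
    have e : i - 1 + 1 = i := by ring
    change φ x + W'.d y ∈ W'.gr (i - 1 + 1)
    have h1 := hφ.1 i x hx
    have h2 := W'.d_gr (i + 1) y hy
    rw [e]
    rw [add_zero] at h1; rw [add_sub_cancel_right] at h2
    exact Submodule.add_mem _ h1 h2
  actL := LinearMap.mk₂ (ZMod 2) (fun a m => (W.actL a m.1, W'.actL a m.2))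
    (fun a b m => by simp) (fun c a m => by simp) (fun a m m' => by simp) (fun c a m => by simp)
  actR := LinearMap.mk₂ (ZMod 2) (fun m a => (W.actR m.1 a, W'.actR m.2 a))
    (fun a b m => by simp) (fun c a m => by simp) (fun a m m' => by simp) (fun c a m => by simp)
  actL_one := fun m => Prod.ext (W.actL_one _) (W'.actL_one _)
  actR_one := fun m => Prod.ext (W.actR_one _) (W'.actR_one _)
  actL_mul := fun a b m => Prod.ext (W.actL_mul _ _ _) (W'.actL_mul _ _ _)
  actR_mul := fun a b m => Prod.ext (W.actR_mul _ _ _) (W'.actR_mul _ _ _)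
  actLR := fun a b m => Prod.ext (W.actLR _ _ _) (W'.actLR _ _ _)
  actL_gr := fun i j a ha m hm => ⟨W.actL_gr i j a ha _ hm.1, by
    have := W'.actL_gr i _ a ha _ hm.2
    rw [← add_assoc] at this; exact this⟩
  actR_gr := fun i j m hm a ha => ⟨W.actR_gr i j _ hm.1 a ha, by
    have := W'.actR_gr _ j _ hm.2 a ha
    rw [add_right_comm] at this; exact this⟩
  leibnizL := fun i a ha m => by
    rw [np_smul]
    refine Prod.ext (W.dL a m.1) ?_
    change φ (W.actL a m.1) + W'.d (W'.actL a m.2) = W'.actL (A.d a) m.2 + W'.actL a (φ m.1 + W'.d m.2)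
    rw [hφ.2.2.1, W'.dL, map_add]
    abel
  leibnizR := fun i m hm a => by
    rw [np_smul]
    refine Prod.ext (W.dR m.1 a) ?_
    change φ (W.actR m.1 a) + W'.d (W'.actR m.2 a) = W'.actR (φ m.1 + W'.d m.2) a + W'.actR m.2 (A.d a)
    rw [hφ.2.2.2, W'.dR, map_add, LinearMap.add_apply]
    abel

section cocone
variable {W W' : DGBimod A} {φ : W.V →ₗ[ZMod 2] W'.V} (hφ : IsBHom W W' 0 φ)

/-- pairing into the cocone -/
def copair {Q : DGBimod A} (a : Q.V →ₗ[ZMod 2] W.V) (b : Q.V →ₗ[ZMod 2] W'.V) :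
    Q.V →ₗ[ZMod 2] (cocone φ hφ).V := LinearMap.prod a b
/-- first projection -/
def cofst : (cocone φ hφ).V →ₗ[ZMod 2] W.V := LinearMap.fst _ _ _
/-- second projection -/
def cosnd : (cocone φ hφ).V →ₗ[ZMod 2] W'.V := LinearMap.snd _ _ _

theorem cofst_d (x) : cofst hφ ((cocone φ hφ).d x) = W.d (cofst hφ x) := rfl
theorem cosnd_d (x) : cosnd hφ ((cocone φ hφ).d x) = φ (cofst hφ x) + W'.d (cosnd hφ x) := rfl
theorem cofst_isB : IsBHom (cocone φ hφ) W 0 (cofst hφ) :=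
  ⟨fun i x hx => by rw [add_zero]; exact hx.1, fun _ => rfl, fun _ _ => rfl, fun _ _ => rfl⟩
theorem cofst_pair {Q : DGBimod A} (a : Q.V →ₗ[ZMod 2] W.V) (b : Q.V →ₗ[ZMod 2] W'.V) (x) :
    cofst hφ (copair hφ a b x) = a x := rfl
theorem cosnd_pair {Q : DGBimod A} (a : Q.V →ₗ[ZMod 2] W.V) (b : Q.V →ₗ[ZMod 2] W'.V) (x) :
    cosnd hφ (copair hφ a b x) = b x := rfl
theorem co_ext {x y : (cocone φ hφ).V} (h1 : cofst hφ x = cofst hφ y) (h2 : cosnd hφ x = cosnd hφ y) : x = y :=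
  Prod.ext h1 h2
theorem cosnd_mem {Q : DGBimod A} {s t : ℤ} (ht : t = s + 1) {h : Q.V →ₗ[ZMod 2] (cocone φ hφ).V}
    (hh : h ∈ grHomSub Q (cocone φ hφ) s) : (cosnd hφ).comp h ∈ grHomSub Q W' t := by
  subst ht
  refine ⟨fun i x hx => ?_, fun a m => ?_, fun m a => ?_⟩
  · have := (hh.1 i x hx).2
    rw [add_assoc] at this; exact this
  · have := congrArg (cosnd hφ) (hh.2.1 a m); exact this
  · have := congrArg (cosnd hφ) (hh.2.2 m a); exact this
theorem cofst_mem {Q : DGBimod A} {s : ℤ} {h : Q.V →ₗ[ZMod 2] (cocone φ hφ).V}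
    (hh : h ∈ grHomSub Q (cocone φ hφ) s) : (cofst hφ).comp h ∈ grHomSub Q W s := by
  refine ⟨fun i x hx => (hh.1 i x hx).1, fun a m => ?_, fun m a => ?_⟩
  · have := congrArg (cofst hφ) (hh.2.1 a m); exact this
  · have := congrArg (cofst hφ) (hh.2.2 m a); exact this
theorem copair_mem {Q : DGBimod A} {s t : ℤ} (ht : t = s + 1) {a : Q.V →ₗ[ZMod 2] W.V} {b : Q.V →ₗ[ZMod 2] W'.V}
    (ha : a ∈ grHomSub Q W s) (hb : b ∈ grHomSub Q W' t) : copair hφ a b ∈ grHomSub Q (cocone φ hφ) s := by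
  subst ht
  refine ⟨fun i x hx => ⟨ha.1 i x hx, ?_⟩, fun a m => ?_, fun m a => ?_⟩
  · have := hb.1 i x hx
    rw [← add_assoc] at this; exact this
  · exact Prod.ext (ha.2.1 a m) (hb.2.1 a m)
  · exact Prod.ext (ha.2.2 m a) (hb.2.2 m a)
end cocone

theorem isB_of {Q E : DGBimod A} {s : ℤ} {f : Q.V →ₗ[ZMod 2] E.V} (h : f ∈ grHomSub Q E s)
    (hd : ∀ x, f (Q.d x) = E.d (f x)) : IsBHom Q E s f := ⟨h.1, hd, h.2.1, h.2.2⟩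
theorem isB_mem {Q E : DGBimod A} {s : ℤ} {f : Q.V →ₗ[ZMod 2] E.V} (h : IsBHom Q E s f) :
    f ∈ grHomSub Q E s := ⟨h.1, h.2.2.1, h.2.2.2⟩
theorem mem_comp {M₁ M₂ M₃ : DGBimod A} {s t u : ℤ} {f : M₁.V →ₗ[ZMod 2] M₂.V}
    {g : M₂.V →ₗ[ZMod 2] M₃.V} (hg : g ∈ grHomSub M₂ M₃ t) (hf : f ∈ grHomSub M₁ M₂ s) (hu : s + t = u) :
    g.comp f ∈ grHomSub M₁ M₃ u := by
  refine ⟨fun i x hx => ?_, fun a m => ?_, fun m a => ?_⟩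
  · have := hg.1 _ _ (hf.1 i x hx)
    rw [add_assoc, hu] at this; exact this
  · simp [hf.2.1, hg.2.1]
  · simp [hf.2.2, hg.2.2]
theorem null_comp_left {M₁ M₂ M₃ : DGBimod A} {s t u : ℤ} {f : M₁.V →ₗ[ZMod 2] M₂.V}
    {g : M₂.V →ₗ[ZMod 2] M₃.V} (hg : IsBHom M₂ M₃ t g) (hf : f ∈ nullHtpSub M₁ M₂ s) (hu : s + t = u) :
    g.comp f ∈ nullHtpSub M₁ M₃ u := by
  obtain ⟨h, hh, e⟩ := mem_null.1 hf
  refine mem_null.2 ⟨g.comp h, mem_comp (isB_mem hg) hh (by omega), fun x => ?_⟩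
  simp [e, hg.2.1]
theorem null_comp_right {M₁ M₂ M₃ : DGBimod A} {s t u : ℤ} {f : M₁.V →ₗ[ZMod 2] M₂.V}
    {g : M₂.V →ₗ[ZMod 2] M₃.V} (hg : g ∈ nullHtpSub M₂ M₃ t) (hf : IsBHom M₁ M₂ s f) (hu : s + t = u) :
    g.comp f ∈ nullHtpSub M₁ M₃ u := by
  obtain ⟨h, hh, e⟩ := mem_null.1 hg
  refine mem_null.2 ⟨h.comp f, mem_comp hh (isB_mem hf) (by omega), fun x => ?_⟩
  simp [e, hf.2.1]

/-- acyclic bimodules -/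
def Acyc (E : DGBimod A) : Prop := ∀ n, ∀ x ∈ E.gr n, E.d x = 0 → ∃ y ∈ E.gr (n + 1), E.d y = x

theorem acyc_cocone {W W' : DGBimod A} {φ : W.V →ₗ[ZMod 2] W'.V} (hφ : IsBHom W W' 0 φ)
    (hq : IsQIsoDeg W.V W'.V W.gr W'.gr W.d W'.d 0 φ) : Acyc (cocone φ hφ) := by
  rintro n x ⟨hx1, hx2⟩ hd
  have h1 : W.d x.1 = 0 := congrArg (cofst hφ) hd
  have h2 : φ x.1 + W'.d x.2 = 0 := congrArg (cosnd hφ) hd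
  obtain ⟨y, hy, hyd⟩ := (hq n).2 x.1 hx1 h1 ⟨x.2, by simpa using hx2, by rw [z2_eq_of_add h2]⟩
  -- φ y + x.2 is a cycle
  have h3 : W'.d (φ y + x.2) = 0 := by rw [map_add, ← hφ.2.1, hyd, h2]
  have hφy : φ y ∈ W'.gr (n + 1) := by simpa using hφ.1 _ y hy
  obtain ⟨z, hz, hzd, w, hw, hwe⟩ := (hq (n + 1)).1 (φ y + x.2) (by
    rw [add_zero]; exact Submodule.add_mem _ hφy hx2) h3
  refine ⟨((y + z, w) : W.V × W'.V), ⟨Submodule.add_mem _ hy hz, by simpa using hw⟩, ?_⟩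
  refine co_ext hφ ?_ ?_
  · change W.d (y + z) = x.1
    rw [map_add, hyd, hzd, add_zero]
  · change φ (y + z) + W'.d w = x.2
    rw [hwe, z2_sub, map_add]
    rw [show φ y + φ z + (φ z + (φ y + x.2)) = (φ y + φ y) + (φ z + φ z) + x.2 by abel, z2_add_self, z2_add_self]
    simp

namespace CellData
variable {C : DGBimod A} (D : CellData C) {E : DGBimod A}

theorem ext_d_congr {f f' : D.I → E.V} (i : D.I) (h : ∀ j, D.lvl j < D.lvl i → f j = f' j) :
    D.ext f (C.d (D.g i)) = D.ext f' (C.d (D.g i)) := by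
  obtain ⟨c, hc, hc0⟩ := D.tri i
  rw [hc]
  simp only [ext, LinearMap.comp_apply, LinearEquiv.coe_coe, e_symm_free]
  simp only [freeMap, Finsupp.lsum_apply]
  refine Finset.sum_congr rfl fun j hj => ?_
  have : D.lvl j < D.lvl i := by
    by_contra hlt
    exact (Finsupp.mem_support_iff.1 hj) (hc0 j (by omega))
  change sandwichT E (f j) (c j) = sandwichT E (f' j) (c j)
  rw [h j this]

/-- K-projectivity of cell bimodules -/
theorem kproj {C : DGBimod A} (D : CellData C) {E : DGBimod A} (hE : Acyc E) {s : ℤ} {f : C.V →ₗ[ZMod 2] E.V} (hf : IsBHom C E s f) :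
    f ∈ nullHtpSub C E s := by
  classical
  let P : D.I → E.V → (D.I → E.V) → Prop := fun i y h =>
    y ∈ E.gr (D.deg i + (s + 1)) ∧ E.d y = f (D.g i) + D.ext h (C.d (D.g i))
  let F : (i : D.I) → ((j : D.I) → D.lvl j < D.lvl i → E.V) → E.V := fun i ih =>
    if H : ∃ y, P i y (fun j => if hj : D.lvl j < D.lvl i then ih j hj else 0) then H.choose else 0
  let h : D.I → E.V := (measure D.lvl).wf.fix F
  have hfix : ∀ i, h i = F i (fun j _ => h j) := fun i => (measure D.lvl).wf.fix_eq F i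
  have key : ∀ n i, D.lvl i = n → P i (h i) h := by
    intro n
    induction n using Nat.strong_induction_on with
    | _ n ih =>
      intro i hi
      let h' : D.I → E.V := fun j => if D.lvl j < D.lvl i then h j else 0
      have e1 : D.ext h' (C.d (D.g i)) = D.ext h (C.d (D.g i)) :=
        D.ext_d_congr i (fun j hj => by simp only [h', if_pos hj])
      have hP : ∀ j, D.lvl j < D.lvl i → P j (h j) h := fun j hj => ih _ (by omega) j rfl
      have hgr' : ∀ j, h' j ∈ E.gr (D.deg j + (s + 1)) := by
        intro j; simp only [h']; split_ifs with hj
        · exact (hP j hj).1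
        · exact Submodule.zero_mem _
      have hex : ∃ y, P i y h' := by
        have hm1 : f (D.g i) + D.ext h' (C.d (D.g i)) ∈ E.gr (D.deg i + s) := by
          refine Submodule.add_mem _ (hf.1 _ _ (D.g_gr i)) ?_
          have := D.ext_gr h' hgr' _ _ (C.d_gr _ _ (D.g_gr i))
          rwa [show D.deg i - 1 + (s + 1) = D.deg i + s by ring] at this
        -- on lower elements the homotopy relation holds
        have hdd : E.d (D.ext h' (C.d (D.g i))) = f (C.d (D.g i)) := by
          obtain ⟨c, hc, hc0⟩ := D.tri i
          have gen : ∀ c : D.I →₀ (A.V ⊗[ZMod 2] A.V), (∀ j, D.lvl i ≤ D.lvl j → c j = 0) →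
              E.d (D.ext h' (freeMap C D.g c)) = f (freeMap C D.g c) + D.ext h' (C.d (freeMap C D.g c)) := by
            intro c hc0
            have : c = ∑ j ∈ c.support, Finsupp.single j (c j) := (Finsupp.sum_single c).symm
            rw [this]
            simp only [map_sum]
            rw [← Finset.sum_add_distrib]
            refine Finset.sum_congr rfl fun j hj => ?_
            have hlt : D.lvl j < D.lvl i := by
              by_contra hlt
              exact (Finsupp.mem_support_iff.1 hj) (hc0 j (by omega))
            have e2 : h' j = h j := by simp only [h', if_pos hlt]
            have e3 : D.ext h' (C.d (D.g j)) = D.ext h (C.d (D.g j)) :=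
              D.ext_d_congr j (fun l hl => by simp only [h', if_pos (hl.trans hlt)])
            have e4 : E.d (h' j) = f (D.g j) + D.ext h' (C.d (D.g j)) := by
              rw [e2, e3]; exact (hP j hlt).2
            rw [freeMap_single]
            generalize c j = t
            induction t using TensorProduct.induction_on with
            | zero => simp
            | add x y hx hy => simp only [map_add, hx, hy]; abel
            | tmul a b =>
              rw [sandwichT_tmul]
              simp only [ext_gen, C.dR, C.dL, E.dR, E.dL, map_add, LinearMap.add_apply, hf.2.2.1, hf.2.2.2,
                D.ext_R, D.ext_L, ext_g, e4]
              abel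
          have := gen c hc0
          rw [← hc, C.d_d, map_zero, add_zero] at this
          exact this
        obtain ⟨y, hy, hyd⟩ := hE _ _ hm1 (by rw [map_add, ← hf.2.1, hdd, z2_add_self])
        exact ⟨y, by rwa [add_assoc] at hy, hyd⟩
      have e5 : h i = hex.choose := by
        rw [hfix]
        exact dif_pos hex
      have := hex.choose_spec
      rw [← e5] at this
      exact ⟨this.1, by rw [← e1]; exact this.2⟩
  have hgr : ∀ i, h i ∈ E.gr (D.deg i + (s + 1)) := fun i => (key _ i rfl).1
  refine mem_null.2 ⟨D.ext h, D.ext_mem h hgr, fun x => ?_⟩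
  have := D.ind (p := fun x => E.d (D.ext h x) = f x + D.ext h (C.d x)) (by simp)
    (fun x y hx hy => by simp only [map_add, hx, hy]; abel) (fun i a b => by
      have e4 := (key _ i rfl).2
      simp only [ext_gen, C.dR, C.dL, E.dR, E.dL, map_add, LinearMap.add_apply, hf.2.2.1, hf.2.2.2,
                D.ext_R, D.ext_L, ext_g, e4]
      abel) x
  rw [this, add_assoc, z2_add_self, add_zero]
end CellData

theorem kproj {Q E : DGBimod A} (hQ : IsCellRetract Q) (hE : Acyc E) {s : ℤ} {f : Q.V →ₗ[ZMod 2] E.V}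
    (hf : IsBHom Q E s f) : f ∈ nullHtpSub Q E s := by
  obtain ⟨C, hC, ι, r, hι, hr, _, e⟩ := hQ
  obtain ⟨D⟩ := cellData_exists hC
  have h1 := D.kproj hE (hf.comp' hr (zero_add s))
  have h2 := null_comp_right h1 hι (zero_add s)
  have h3 : (f.comp r).comp ι = f := by rw [LinearMap.comp_assoc, e, LinearMap.comp_id]
  rwa [h3] at h2

theorem klift {Q W W' : DGBimod A} (hQ : ∀ (E : DGBimod A), Acyc E → ∀ (s : ℤ) (f : Q.V →ₗ[ZMod 2] E.V), IsBHom Q E s f → f ∈ nullHtpSub Q E s)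
  {φ : W.V →ₗ[ZMod 2] W'.V} (hφ : IsBHom W W' 0 φ) (hq : IsQIsoDeg W.V W'.V W.gr W'.gr W.d W'.d 0 φ) {s : ℤ} {g : Q.V →ₗ[ZMod 2] W'.V} (hg : IsBHom Q W' s g) :
    ∃ g', IsBHom Q W s g' ∧ g + φ.comp g' ∈ nullHtpSub Q W' s := by
  have hm : copair hφ 0 g ∈ grHomSub Q (cocone φ hφ) (s - 1) :=
    copair_mem hφ (by ring) (Submodule.zero_mem _) (isB_mem hg)
  have hB : IsBHom Q (cocone φ hφ) (s - 1) (copair hφ 0 g) := by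
    refine isB_of hm fun x => co_ext hφ ?_ ?_
    · rw [cofst_d, cofst_pair, cofst_pair]; simp
    · rw [cosnd_d, cosnd_pair, cofst_pair, cosnd_pair, hg.2.1]; simp
  obtain ⟨h, hh, e⟩ := mem_null.1 (hQ _ (acyc_cocone hφ hq) _ _ hB)
  rw [sub_add_cancel] at hh
  refine ⟨(cofst hφ).comp h, isB_of (cofst_mem hφ hh) fun x => ?_, mem_null.2 ⟨(cosnd hφ).comp h,
    cosnd_mem hφ rfl hh, fun x => ?_⟩⟩
  · have := congrArg (cofst hφ) (e x)
    rw [map_add, cofst_d, cofst_pair] at this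
    rw [LinearMap.zero_apply, add_comm] at this
    exact z2_eq_of_add this.symm
  · have := congrArg (cosnd hφ) (e x)
    rw [map_add, cosnd_d, cosnd_pair] at this
    simp only [LinearMap.add_apply, LinearMap.comp_apply, this]
    rw [show ∀ a b c : W'.V, a + b + c + a = (a + a) + (b + c) by intros; abel, z2_add_self, zero_add]

theorem kinj {Q W W' : DGBimod A} (hQ : ∀ (E : DGBimod A), Acyc E → ∀ (s : ℤ) (f : Q.V →ₗ[ZMod 2] E.V), IsBHom Q E s f → f ∈ nullHtpSub Q E s)
  {φ : W.V →ₗ[ZMod 2] W'.V} (hφ : IsBHom W W' 0 φ) (hq : IsQIsoDeg W.V W'.V W.gr W'.gr W.d W'.d 0 φ) {s : ℤ} {g : Q.V →ₗ[ZMod 2] W.V} (hg : IsBHom Q W s g) (h0 : φ.comp g ∈ nullHtpSub Q W' s) :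
    g ∈ nullHtpSub Q W s := by
  obtain ⟨h, hh, e⟩ := mem_null.1 h0
  have hm := copair_mem hφ rfl (isB_mem hg) hh
  have hB : IsBHom Q (cocone φ hφ) s (copair hφ g h) := by
    refine isB_of hm fun x => co_ext hφ ?_ ?_
    · rw [cofst_d, cofst_pair, cofst_pair, hg.2.1]
    · rw [cosnd_d, cosnd_pair, cofst_pair, cosnd_pair]
      have := e x
      rw [LinearMap.comp_apply] at this
      rw [this, add_comm, z2_add_cancel]
  obtain ⟨k, hk, e⟩ := mem_null.1 (hQ _ (acyc_cocone hφ hq) _ _ hB)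
  refine mem_null.2 ⟨_, cofst_mem hφ hk, fun x => ?_⟩
  have := congrArg (cofst hφ) (e x)
  rw [map_add, cofst_d, cofst_pair] at this
  exact this

/-- The resolution is a homotopy retract of a finite cell bimodule. -/
theorem smooth_retract {R : DGBimod A} {ρ : R.V →ₗ[ZMod 2] A.diag.V} (hres : IsResolution R A.diag ρ)
    (hs : HomSmooth A) : ∃ (C : DGBimod A) (D : CellData C), Finite D.I ∧
      ∃ (u : R.V →ₗ[ZMod 2] C.V) (v : C.V →ₗ[ZMod 2] R.V), IsBHom R C 0 u ∧ IsBHom C R 0 v ∧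
        v.comp u + LinearMap.id ∈ nullHtpSub R R 0 := by
  obtain ⟨hR, hρ, hq⟩ := hres
  obtain ⟨P, σ, ⟨C, hC, ι, r, hι, hr, hinj, e⟩, hσ, hqσ⟩ := hs
  obtain ⟨D, hD⟩ := finCellData_exists hC
  have hCk : ∀ (E : DGBimod A), Acyc E → ∀ (s : ℤ) (f : C.V →ₗ[ZMod 2] E.V), IsBHom C E s f → f ∈ nullHtpSub C E s :=
    fun E hE s f hf => D.kproj hE hf
  have hPk : ∀ (E : DGBimod A), Acyc E → ∀ (s : ℤ) (f : P.V →ₗ[ZMod 2] E.V), IsBHom P E s f → f ∈ nullHtpSub P E s := by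
    intro E hE s f hf
    have h1 := hCk E hE s _ (hf.comp' hr (zero_add s))
    have h2 := null_comp_right h1 hι (zero_add s)
    have h3 : (f.comp r).comp ι = f := by rw [LinearMap.comp_assoc, e, LinearMap.comp_id]
    rwa [h3] at h2
  have hRk : ∀ (E : DGBimod A), Acyc E → ∀ (s : ℤ) (f : R.V →ₗ[ZMod 2] E.V), IsBHom R E s f → f ∈ nullHtpSub R E s :=
    fun E hE s f hf => kproj hR hE hf
  obtain ⟨a, ha, ha'⟩ := klift hPk hρ hq hσ
  obtain ⟨b, hb, hb'⟩ := klift hRk hσ hqσ hρ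
  have hab := ha.comp' hb (zero_add 0)
  have hsum : IsBHom R R 0 (a.comp b + LinearMap.id) :=
    (bcmSub R R 0).add_mem hab (isB_id R)
  have hnull : a.comp b + LinearMap.id ∈ nullHtpSub R R 0 := by
    refine kinj hRk hρ hq hsum ?_
    have h1 := null_comp_right ha' hb (zero_add 0)
    have h2 := Submodule.add_mem _ h1 hb'
    convert h2 using 1
    ext x
    simp only [LinearMap.comp_apply, LinearMap.add_apply, map_add, LinearMap.id_apply]
    have := z2_add_self (σ (b x))
    rw [show ∀ p q s : A.diag.V, p + q + (s + p) = (p + p) + (q + s) by intros; abel, this, zero_add]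
  refine ⟨C, D, hD, ι.comp b, a.comp r, hι.comp' hb (zero_add 0), ha.comp' hr (zero_add 0), ?_⟩
  have : (a.comp r).comp (ι.comp b) = a.comp b := by
    ext x
    have := LinearMap.congr_fun e (b x)
    simp only [LinearMap.comp_apply, LinearMap.id_apply] at this ⊢
    rw [this]
  rw [this]; exact hnull
end piece9

section piece10
variable {A : DGA (ZMod 2)}

/-! ### Gluing maps over homogeneous components; the free bimodule of rank one -/

/-- glue a family of maps along a grading -/
def glue {V W : Type} [AddCommGroup V] [Module (ZMod 2) V] [AddCommGroup W] [Module (ZMod 2) W]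
    {gr : ℤ → Submodule (ZMod 2) V} (h : DirectSum.IsInternal gr) (f : ℤ → V →ₗ[ZMod 2] W) :
    V →ₗ[ZMod 2] W :=
  (DirectSum.toModule (ZMod 2) ℤ W (fun j => (f j).comp (gr j).subtype)).comp
    (LinearEquiv.ofBijective (DirectSum.coeLinearMap gr) h).symm.toLinearMap

theorem glue_apply {V W : Type} [AddCommGroup V] [Module (ZMod 2) V] [AddCommGroup W] [Module (ZMod 2) W]
    {gr : ℤ → Submodule (ZMod 2) V} (h : DirectSum.IsInternal gr) (f : ℤ → V →ₗ[ZMod 2] W)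
    {j : ℤ} {x : V} (hx : x ∈ gr j) : glue h f x = f j x := by
  simp only [glue, LinearMap.comp_apply, LinearEquiv.coe_coe, comp_symm h hx]
  rw [DirectSum.toModule_lof]
  rfl

theorem rc2_null1 {R R' M : DGBimod A} {s : ℤ} {g : R.V →ₗ[ZMod 2] R'.V}
    (hg : g ∈ nullHtpSub R R' s) {n : ℤ} {z : T2 R M} (hz : z ∈ (rc2 R M).Z n) :
    TensorProduct.map g LinearMap.id z ∈ (rc2 R' M).B (n + s) := by
  have h1 : (TensorProduct.comm (ZMod 2) R.V M.V).toLinearMap z ∈ (rc2 M R).Z (n + 0) :=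
    (rc2_swap R M).Z hz
  have h2 := (rc2_swap M R').B (rc2_null hg h1)
  rw [add_zero, add_zero] at h2
  have e : (TensorProduct.comm (ZMod 2) M.V R'.V).toLinearMap
      (TensorProduct.map LinearMap.id g ((TensorProduct.comm (ZMod 2) R.V M.V).toLinearMap z)) =
      TensorProduct.map g LinearMap.id z := by
    induction z using TensorProduct.induction_on with
    | zero => simp
    | add x y hx hy =>
      clear hz h1 h2 hx hy
      have : ∀ z : T2 R M, (TensorProduct.comm (ZMod 2) M.V R'.V).toLinearMap
          (TensorProduct.map LinearMap.id g ((TensorProduct.comm (ZMod 2) R.V M.V).toLinearMap z)) =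
          TensorProduct.map g LinearMap.id z := by
        intro z
        induction z using TensorProduct.induction_on with
        | zero => simp
        | add x y hx hy => simp only [map_add, hx, hy]
        | tmul r m => rfl
      exact this _
    | tmul r m => rfl
  rw [e] at h2
  exact h2

section AAsec
variable (A)

/-- grading on `A ⊗ A` -/
def aagr (n : ℤ) : Submodule (ZMod 2) (A.V ⊗[ZMod 2] A.V) :=
  Submodule.span (ZMod 2)
    {z | ∃ i j, ∃ r ∈ A.gr i, ∃ m ∈ A.gr j, i + j = n ∧ z = r ⊗ₜ[ZMod 2] m}

/-- differential on `A ⊗ A` -/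
def aad : A.V ⊗[ZMod 2] A.V →ₗ[ZMod 2] A.V ⊗[ZMod 2] A.V :=
  TensorProduct.map A.d LinearMap.id + TensorProduct.map LinearMap.id A.d

/-- components -/
def aac (n : ℤ) : A.V ⊗[ZMod 2] A.V →ₗ[ZMod 2] A.V ⊗[ZMod 2] A.V :=
  TensorProduct.lift (glue A.internal (fun i =>
    (LinearMap.lcomp (ZMod 2) _ (comp A.gr A.internal (n - i))).comp (TensorProduct.mk (ZMod 2) A.V A.V)))

variable {A}

theorem aa_tmul {i j n : ℤ} {x y : A.V} (hx : x ∈ A.gr i) (hy : y ∈ A.gr j) (h : i + j = n) :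
    x ⊗ₜ[ZMod 2] y ∈ aagr A n := Submodule.subset_span ⟨i, j, x, hx, y, hy, h, rfl⟩

theorem aac_tmul (n : ℤ) {i : ℤ} {x : A.V} (hx : x ∈ A.gr i) (y : A.V) :
    aac A n (x ⊗ₜ y) = x ⊗ₜ comp A.gr A.internal (n - i) y := by
  rw [aac, TensorProduct.lift.tmul, glue_apply A.internal _ hx]; rfl

theorem aad_tmul (x y : A.V) : aad A (x ⊗ₜ y) = A.d x ⊗ₜ y + x ⊗ₜ A.d y := by
  simp [aad]

theorem aa_le {n : ℤ} {S : Submodule (ZMod 2) (A.V ⊗[ZMod 2] A.V)}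
    (h : ∀ i j, i + j = n → ∀ x ∈ A.gr i, ∀ y ∈ A.gr j, x ⊗ₜ[ZMod 2] y ∈ S) : aagr A n ≤ S := by
  rw [aagr, Submodule.span_le]
  rintro _ ⟨i, j, x, hx, y, hy, e, rfl⟩
  exact h i j e x hx y hy

theorem aa_internal : DirectSum.IsInternal (aagr A) := by
  refine internal_of (aac A) ?_ ?_ ?_
  · intro n x hx
    have : aagr A n ≤ LinearMap.ker (aac A n + LinearMap.id) := by
      refine aa_le fun i j e x hx y hy => ?_
      rw [LinearMap.mem_ker, LinearMap.add_apply, aac_tmul n hx, comp_same A.internal (by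
        have : n - i = j := by omega
        rw [this]; exact hy), LinearMap.id_apply, z2_add_self]
    have h := this hx
    rw [LinearMap.mem_ker, LinearMap.add_apply, LinearMap.id_apply] at h
    exact z2_eq_of_add h
  · intro n m hnm x hx
    have : aagr A m ≤ LinearMap.ker (aac A n) := by
      refine aa_le fun i j e x hx y hy => ?_
      rw [LinearMap.mem_ker, aac_tmul n hx, comp_ne A.internal hy (by omega), TensorProduct.tmul_zero]
    exact this hx
  · intro z
    induction z using TensorProduct.induction_on with
    | zero => exact Submodule.zero_mem _
    | add x y hx hy => exact Submodule.add_mem _ hx hy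
    | tmul x y =>
      refine int_ind A.internal (p := fun x => x ⊗ₜ[ZMod 2] y ∈ _) x (by rw [TensorProduct.zero_tmul]; exact Submodule.zero_mem _) ?_ ?_
      · intro a b ha hb; rw [TensorProduct.add_tmul]; exact Submodule.add_mem _ ha hb
      · intro i x hx
        refine int_ind A.internal (p := fun y => x ⊗ₜ[ZMod 2] y ∈ _) y (by rw [TensorProduct.tmul_zero]; exact Submodule.zero_mem _) ?_ ?_
        · intro a b ha hb; rw [TensorProduct.tmul_add]; exact Submodule.add_mem _ ha hb
        · intro j y hy
          exact Submodule.mem_iSup_of_mem (i + j) (aa_tmul hx hy rfl)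

/-- a map which is linear out of `A ⊗ A` respects degrees if it does so on elementary tensors -/
theorem aa_mono {n : ℤ} {W : Type} [AddCommGroup W] [Module (ZMod 2) W] {S : Submodule (ZMod 2) W}
    (f : A.V ⊗[ZMod 2] A.V →ₗ[ZMod 2] W)
    (h : ∀ i j, i + j = n → ∀ x ∈ A.gr i, ∀ y ∈ A.gr j, f (x ⊗ₜ[ZMod 2] y) ∈ S)
    {z} (hz : z ∈ aagr A n) : f z ∈ S :=
  (aa_le (S := S.comap f) h : aagr A n ≤ S.comap f) hz

theorem aa_eq {W : Type} [AddCommGroup W] [Module (ZMod 2) W]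
    (f g : A.V ⊗[ZMod 2] A.V →ₗ[ZMod 2] W)
    (h : ∀ x y, f (x ⊗ₜ[ZMod 2] y) = g (x ⊗ₜ[ZMod 2] y)) (z) : f z = g z :=
  LinearMap.congr_fun (TensorProduct.ext' h) z

variable (A)
/-- outer left action -/
def ouL : A.V →ₗ[ZMod 2] A.V ⊗[ZMod 2] A.V →ₗ[ZMod 2] A.V ⊗[ZMod 2] A.V :=
  (LinearMap.rTensorHom A.V).comp A.mul
/-- outer right action -/
def ouR : A.V ⊗[ZMod 2] A.V →ₗ[ZMod 2] A.V →ₗ[ZMod 2] A.V ⊗[ZMod 2] A.V :=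
  ((LinearMap.lTensorHom A.V).comp A.mul.flip).flip
/-- inner left action -/
def inL : A.V →ₗ[ZMod 2] A.V ⊗[ZMod 2] A.V →ₗ[ZMod 2] A.V ⊗[ZMod 2] A.V :=
  (LinearMap.lTensorHom A.V).comp A.mul
/-- inner right action -/
def inR : A.V →ₗ[ZMod 2] A.V ⊗[ZMod 2] A.V →ₗ[ZMod 2] A.V ⊗[ZMod 2] A.V :=
  (LinearMap.rTensorHom A.V).comp A.mul.flip

variable {A}
theorem ouL_tmul (a x y : A.V) : ouL A a (x ⊗ₜ y) = A.mul a x ⊗ₜ y := rfl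
theorem ouR_tmul (a x y : A.V) : ouR A (x ⊗ₜ y) a = x ⊗ₜ A.mul y a := rfl
theorem inL_tmul (a x y : A.V) : inL A a (x ⊗ₜ y) = x ⊗ₜ A.mul a y := rfl
theorem inR_tmul (a x y : A.V) : inR A a (x ⊗ₜ y) = A.mul x a ⊗ₜ y := rfl

theorem inL_ouL (a b : A.V) (z) : inL A a (ouL A b z) = ouL A b (inL A a z) :=
  aa_eq ((inL A a).comp (ouL A b)) ((ouL A b).comp (inL A a)) (fun x y => rfl) z
theorem inL_ouR (a b : A.V) (z) : inL A a (ouR A z b) = ouR A (inL A a z) b :=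
  aa_eq ((inL A a).comp ((ouR A).flip b)) (((ouR A).flip b).comp (inL A a)) (fun x y => by
    change x ⊗ₜ A.mul a (A.mul y b) = x ⊗ₜ A.mul (A.mul a y) b
    rw [A.mul_assoc']) z
theorem inR_ouR (a b : A.V) (z) : inR A a (ouR A z b) = ouR A (inR A a z) b :=
  aa_eq ((inR A a).comp ((ouR A).flip b)) (((ouR A).flip b).comp (inR A a)) (fun x y => rfl) z
theorem inR_ouL (a b : A.V) (z) : inR A a (ouL A b z) = ouL A b (inR A a z) :=
  aa_eq ((inR A a).comp (ouL A b)) ((ouL A b).comp (inR A a)) (fun x y => by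
    change A.mul (A.mul b x) a ⊗ₜ y = A.mul b (A.mul x a) ⊗ₜ y
    rw [A.mul_assoc']) z
theorem inL_inR (a b : A.V) (z) : inL A a (inR A b z) = inR A b (inL A a z) :=
  aa_eq ((inL A a).comp (inR A b)) ((inR A b).comp (inL A a)) (fun x y => rfl) z
theorem ouL_ouR (a b : A.V) (z) : ouR A (ouL A a z) b = ouL A a (ouR A z b) :=
  aa_eq (((ouR A).flip b).comp (ouL A a)) ((ouL A a).comp ((ouR A).flip b)) (fun x y => rfl) z

theorem aad_ouL (a : A.V) (z) : aad A (ouL A a z) = ouL A (A.d a) z + ouL A a (aad A z) :=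
  aa_eq ((aad A).comp (ouL A a)) (ouL A (A.d a) + (ouL A a).comp (aad A)) (fun x y => by
    simp only [LinearMap.comp_apply, LinearMap.add_apply, ouL_tmul, aad_tmul, map_add, A.dM,
      TensorProduct.add_tmul]; abel) z
theorem aad_ouR (a : A.V) (z) : aad A (ouR A z a) = ouR A (aad A z) a + ouR A z (A.d a) :=
  aa_eq ((aad A).comp ((ouR A).flip a)) (((ouR A).flip a).comp (aad A) + (ouR A).flip (A.d a)) (fun x y => by
    simp only [LinearMap.comp_apply, LinearMap.add_apply, LinearMap.flip_apply, ouR_tmul, aad_tmul, map_add, A.dM,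
      TensorProduct.tmul_add]; abel) z
theorem aad_inL (a : A.V) (z) : aad A (inL A a z) = inL A (A.d a) z + inL A a (aad A z) :=
  aa_eq ((aad A).comp (inL A a)) (inL A (A.d a) + (inL A a).comp (aad A)) (fun x y => by
    simp only [LinearMap.comp_apply, LinearMap.add_apply, inL_tmul, aad_tmul, map_add, A.dM,
      TensorProduct.tmul_add]; abel) z
theorem aad_inR (a : A.V) (z) : aad A (inR A a z) = inR A (A.d a) z + inR A a (aad A z) :=
  aa_eq ((aad A).comp (inR A a)) (inR A (A.d a) + (inR A a).comp (aad A)) (fun x y => by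
    simp only [LinearMap.comp_apply, LinearMap.add_apply, inR_tmul, aad_tmul, map_add, A.dM,
      TensorProduct.add_tmul]; abel) z

theorem aad_aad (z) : aad A (aad A z) = 0 :=
  aa_eq ((aad A).comp (aad A)) 0 (fun x y => by
    simp only [LinearMap.comp_apply, aad_tmul, map_add, A.d_d, TensorProduct.zero_tmul, TensorProduct.tmul_zero,
      zero_add, add_zero, z2_add_self, LinearMap.zero_apply]) z

variable (A) in
/-- The free bimodule of rank one. -/
def AA : DGBimod A where
  V := A.V ⊗[ZMod 2] A.V
  gr := aagr A
  internal := aa_internal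
  d := aad A
  d_d := aad_aad
  d_gr := fun n z hz => aa_mono (aad A) (fun i j e x hx y hy => by
    rw [aad_tmul]
    exact Submodule.add_mem _ (aa_tmul (A.d_gr i x hx) hy (by omega)) (aa_tmul hx (A.d_gr j y hy) (by omega))) hz
  actL := ouL A
  actR := ouR A
  actL_one := fun z => aa_eq (ouL A A.one) LinearMap.id (fun x y => by rw [ouL_tmul, A.one_mul']; rfl) z
  actR_one := fun z => aa_eq ((ouR A).flip A.one) LinearMap.id (fun x y => by
    rw [LinearMap.flip_apply, ouR_tmul, A.mul_one']; rfl) z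
  actL_mul := fun a b z => aa_eq (ouL A (A.mul a b)) ((ouL A a).comp (ouL A b)) (fun x y => by
    rw [LinearMap.comp_apply, ouL_tmul, ouL_tmul, ouL_tmul, A.mul_assoc']) z
  actR_mul := fun z a b => aa_eq (((ouR A).flip b).comp ((ouR A).flip a)) ((ouR A).flip (A.mul a b)) (fun x y => by
    rw [LinearMap.comp_apply, LinearMap.flip_apply, LinearMap.flip_apply, LinearMap.flip_apply,
      ouR_tmul, ouR_tmul, ouR_tmul, A.mul_assoc']) z
  actLR := fun a z b => ouL_ouR a b z
  actL_gr := fun i n a ha z hz => aa_mono (ouL A a) (fun p q e x hx y hy => by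
    rw [ouL_tmul]; exact aa_tmul (A.mul_gr i p a ha x hx) hy (by omega)) hz
  actR_gr := fun n j z hz a ha => aa_mono ((ouR A).flip a) (fun p q e x hx y hy => by
    rw [LinearMap.flip_apply, ouR_tmul]; exact aa_tmul hx (A.mul_gr q j y hy a ha) (by omega)) hz
  leibnizL := fun i a _ z => by rw [np_smul]; exact aad_ouL a z
  leibnizR := fun j z _ a => by rw [np_smul]; exact aad_ouR a z

theorem inL_gr {i n : ℤ} {a : A.V} (ha : a ∈ A.gr i) {z} (hz : z ∈ aagr A n) : inL A a z ∈ aagr A (i + n) :=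
  aa_mono (inL A a) (fun p q e x hx y hy => by
    rw [inL_tmul]; exact aa_tmul hx (A.mul_gr i q a ha y hy) (by omega)) hz
theorem inR_gr {i n : ℤ} {a : A.V} (ha : a ∈ A.gr i) {z} (hz : z ∈ aagr A n) : inR A a z ∈ aagr A (n + i) :=
  aa_mono (inR A a) (fun p q e x hx y hy => by
    rw [inR_tmul]; exact aa_tmul (A.mul_gr p i x hx a ha) hy (by omega)) hz

end AAsec
end piece10

section piece11
variable {A : DGA (ZMod 2)}

/-! ### The dual of a finite cell bimodule -/

section dual

variable (A) in
/-- inner left action on the free bimodule -/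
def iL : A.V →ₗ[ZMod 2] (AA A).V →ₗ[ZMod 2] (AA A).V := inL A
variable (A) in
/-- inner right action on the free bimodule -/
def iR : A.V →ₗ[ZMod 2] (AA A).V →ₗ[ZMod 2] (AA A).V := inR A

theorem iL_L (a b : A.V) (z : (AA A).V) : iL A a ((AA A).actL b z) = (AA A).actL b (iL A a z) := inL_ouL a b z
theorem iL_R (a b : A.V) (z : (AA A).V) : iL A a ((AA A).actR z b) = (AA A).actR (iL A a z) b := inL_ouR a b z
theorem iR_L (a b : A.V) (z : (AA A).V) : iR A a ((AA A).actL b z) = (AA A).actL b (iR A a z) := inR_ouL a b z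
theorem iR_R (a b : A.V) (z : (AA A).V) : iR A a ((AA A).actR z b) = (AA A).actR (iR A a z) b := inR_ouR a b z
theorem iL_iR (a b : A.V) (z : (AA A).V) : iL A a (iR A b z) = iR A b (iL A a z) := inL_inR a b z
theorem d_iL (a : A.V) (z : (AA A).V) : (AA A).d (iL A a z) = iL A (A.d a) z + iL A a ((AA A).d z) := aad_inL a z
theorem d_iR (a : A.V) (z : (AA A).V) : (AA A).d (iR A a z) = iR A (A.d a) z + iR A a ((AA A).d z) := aad_inR a z
theorem iL_gr {i n : ℤ} {a : A.V} (ha : a ∈ A.gr i) {z : (AA A).V} (hz : z ∈ (AA A).gr n) :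
    iL A a z ∈ (AA A).gr (i + n) := inL_gr ha hz
theorem iR_gr {i n : ℤ} {a : A.V} (ha : a ∈ A.gr i) {z : (AA A).V} (hz : z ∈ (AA A).gr n) :
    iR A a z ∈ (AA A).gr (n + i) := inR_gr ha hz
theorem iL_one (z : (AA A).V) : iL A A.one z = z :=
  aa_eq (inL A A.one) LinearMap.id (fun x y => by rw [inL_tmul, A.one_mul']; rfl) z
theorem iR_one (z : (AA A).V) : iR A A.one z = z :=
  aa_eq (inR A A.one) LinearMap.id (fun x y => by rw [inR_tmul, A.mul_one']; rfl) z
theorem iL_mul (a b : A.V) (z : (AA A).V) : iL A (A.mul a b) z = iL A a (iL A b z) :=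
  aa_eq (inL A (A.mul a b)) ((inL A a).comp (inL A b)) (fun x y => by
    rw [LinearMap.comp_apply, inL_tmul, inL_tmul, inL_tmul, A.mul_assoc']) z
theorem iR_mul (a b : A.V) (z : (AA A).V) : iR A b (iR A a z) = iR A (A.mul a b) z :=
  aa_eq ((inR A b).comp (inR A a)) (inR A (A.mul a b)) (fun x y => by
    rw [LinearMap.comp_apply, inR_tmul, inR_tmul, inR_tmul, A.mul_assoc']) z

/-- Bimodule maps to the free bimodule. -/
def dualSub (C : DGBimod A) : Submodule (ZMod 2) (C.V →ₗ[ZMod 2] (AA A).V) where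
  carrier := {f | (∀ a m, f (C.actL a m) = (AA A).actL a (f m)) ∧
    (∀ m a, f (C.actR m a) = (AA A).actR (f m) a)}
  add_mem' := by
    rintro f g ⟨hf2, hf3⟩ ⟨hg2, hg3⟩
    refine ⟨fun a m => ?_, fun m a => ?_⟩
    · simp only [LinearMap.add_apply, hf2, hg2, map_add]
    · simp only [LinearMap.add_apply, hf3, hg3, map_add]
  zero_mem' := by
    refine ⟨fun a m => ?_, fun m a => ?_⟩ <;> simp
  smul_mem' := by
    rintro c f ⟨hf2, hf3⟩
    refine ⟨fun a m => ?_, fun m a => ?_⟩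
    · simp only [LinearMap.smul_apply, hf2, map_smul]
    · simp only [LinearMap.smul_apply, hf3, map_smul]

theorem dual_iL {C : DGBimod A} {f : C.V →ₗ[ZMod 2] (AA A).V} (hf : f ∈ dualSub C) (a : A.V) :
    (iL A a).comp f ∈ dualSub C := by
  refine ⟨fun b m => ?_, fun m b => ?_⟩
  · simp only [LinearMap.comp_apply, hf.1, iL_L]
  · simp only [LinearMap.comp_apply, hf.2, iL_R]

theorem dual_iR {C : DGBimod A} {f : C.V →ₗ[ZMod 2] (AA A).V} (hf : f ∈ dualSub C) (a : A.V) :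
    (iR A a).comp f ∈ dualSub C := by
  refine ⟨fun b m => ?_, fun m b => ?_⟩
  · simp only [LinearMap.comp_apply, hf.1, iR_L]
  · simp only [LinearMap.comp_apply, hf.2, iR_R]

theorem dual_d {C : DGBimod A} {f : C.V →ₗ[ZMod 2] (AA A).V} (hf : f ∈ dualSub C) :
    (AA A).d.comp f + f.comp C.d ∈ dualSub C := by
  refine ⟨fun b m => ?_, fun m b => ?_⟩
  · simp only [LinearMap.add_apply, LinearMap.comp_apply, hf.1, C.dL, (AA A).dL, map_add]
    have := z2_add_self ((AA A).actL (A.d b) (f m))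
    calc _ = ((AA A).actL (A.d b) (f m) + (AA A).actL (A.d b) (f m)) + ((AA A).actL b ((AA A).d (f m)) + (AA A).actL b (f (C.d m))) := by abel
      _ = _ := by rw [this, zero_add]
  · simp only [LinearMap.add_apply, LinearMap.comp_apply, hf.2, C.dR, (AA A).dR, map_add]
    have := z2_add_self ((AA A).actR (f m) (A.d b))
    calc _ = ((AA A).actR (f m) (A.d b) + (AA A).actR (f m) (A.d b)) + ((AA A).actR ((AA A).d (f m)) b + (AA A).actR (f (C.d m)) b) := by abel
      _ = _ := by rw [this, zero_add]

/-- grading -/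
def dualgr (C : DGBimod A) (n : ℤ) : Submodule (ZMod 2) (dualSub C) :=
  (grHomSub C (AA A) n).comap (dualSub C).subtype

variable {C : DGBimod A} (D : CellData C)

theorem dual_ext' {f g : dualSub C} (h : ∀ i, f.1 (D.g i) = g.1 (D.g i)) : f = g := by
  apply Subtype.ext
  exact LinearMap.ext (D.uniq f.2.1 f.2.2 g.2.1 g.2.2 h)

/-- extension -/
def dext (y : D.I → (AA A).V) : dualSub C := ⟨D.ext y, D.ext_L y, D.ext_R y⟩

theorem dext_g (y : D.I → (AA A).V) (i : D.I) : (dext D y).1 (D.g i) = y i := D.ext_g y i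

/-- linear version -/
def dextL : (D.I → (AA A).V) →ₗ[ZMod 2] dualSub C where
  toFun := dext D
  map_add' := fun x y => dual_ext' D fun i => by
    change (dext D (x + y)).1 (D.g i) = (dext D x).1 (D.g i) + (dext D y).1 (D.g i)
    rw [dext_g, dext_g, dext_g]; rfl
  map_smul' := fun c x => dual_ext' D fun i => by
    change (dext D (c • x)).1 (D.g i) = c • (dext D x).1 (D.g i)
    rw [dext_g, dext_g]; rfl

theorem dual_gr_of {n : ℤ} {f : dualSub C} (h : ∀ i, f.1 (D.g i) ∈ (AA A).gr (D.deg i + n)) :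
    f ∈ dualgr C n := by
  have e : f = dext D (fun i => f.1 (D.g i)) := dual_ext' D fun i => (dext_g D (fun i => f.1 (D.g i)) i).symm
  rw [e]
  exact D.ext_mem _ h

theorem dual_internal [Finite D.I] : DirectSum.IsInternal (dualgr C) := by
  classical
  have := Fintype.ofFinite D.I
  refine internal_of (fun n => (dextL D).comp (LinearMap.pi fun i =>
    (comp (AA A).gr (AA A).internal (D.deg i + n)).comp
      ((LinearMap.applyₗ (D.g i)).comp (dualSub C).subtype))) ?_ ?_ ?_
  · intro n f hf
    refine dual_ext' D fun i => ?_
    change (dext D _).1 (D.g i) = _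
    rw [dext_g]
    exact comp_same (AA A).internal (hf.1 _ _ (D.g_gr i))
  · intro n m hm f hf
    refine dual_ext' D fun i => ?_
    change (dext D _).1 (D.g i) = _
    rw [dext_g]
    exact comp_ne (AA A).internal (hf.1 _ _ (D.g_gr i)) (by omega)
  · intro f
    have e : f = ∑ i, dextL D (Pi.single i (f.1 (D.g i))) := by
      rw [← map_sum, Finset.univ_sum_single]
      exact dual_ext' D fun i => (dext_g D (fun i => f.1 (D.g i)) i).symm
    rw [e]
    refine Submodule.sum_mem _ fun i _ => ?_
    refine int_ind (AA A).internal (p := fun y => dextL D (Pi.single i y) ∈ ⨆ n, dualgr C n) (f.1 (D.g i)) ?_ ?_ ?_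
    · rw [Pi.single_zero, map_zero]; exact Submodule.zero_mem _
    · intro x y hx hy; rw [Pi.single_add, map_add]; exact Submodule.add_mem _ hx hy
    · intro n y hy
      refine Submodule.mem_iSup_of_mem (n - D.deg i) (dual_gr_of D fun j => ?_)
      change (dext D _).1 (D.g j) ∈ _
      rw [dext_g]
      by_cases hj : j = i
      · subst hj; rw [Pi.single_eq_same]
        have : D.deg j + (n - D.deg j) = n := by omega
        rw [this]; exact hy
      · rw [Pi.single_eq_of_ne hj]; exact Submodule.zero_mem _

/-- The dual bimodule. -/
def dual [Finite D.I] : DGBimod A where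
  V := dualSub C
  gr := dualgr C
  internal := dual_internal D
  d :=
    { toFun := fun f => ⟨(AA A).d.comp f.1 + f.1.comp C.d, dual_d f.2⟩
      map_add' := fun f g => Subtype.ext (LinearMap.ext fun x => by
        change (AA A).d (f.1 x + g.1 x) + (f.1 (C.d x) + g.1 (C.d x)) =
          ((AA A).d (f.1 x) + f.1 (C.d x)) + ((AA A).d (g.1 x) + g.1 (C.d x))
        rw [map_add]; abel)
      map_smul' := fun c f => Subtype.ext (LinearMap.ext fun x => by
        change (AA A).d (c • f.1 x) + (c • f.1 (C.d x)) = c • ((AA A).d (f.1 x) + f.1 (C.d x))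
        rw [map_smul, smul_add]) }
  d_d := fun f => Subtype.ext (LinearMap.ext fun x => by
    change (AA A).d ((AA A).d (f.1 x) + f.1 (C.d x)) + ((AA A).d (f.1 (C.d x)) + f.1 (C.d (C.d x))) = 0
    rw [map_add, (AA A).d_d, C.d_d, map_zero, zero_add, add_zero, z2_add_self])
  d_gr := fun n f hf => by
    refine ⟨fun i x hx => ?_, (dual_d f.2).1, (dual_d f.2).2⟩
    change (AA A).d (f.1 x) + f.1 (C.d x) ∈ _
    refine Submodule.add_mem _ ?_ ?_
    · have := (AA A).d_gr _ _ (hf.1 i x hx)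
      rwa [add_sub_assoc] at this
    · have := hf.1 _ _ (C.d_gr i x hx)
      have e : i - 1 + n = i + (n - 1) := by omega
      rwa [e] at this
  actL := LinearMap.mk₂ (ZMod 2) (fun a f => ⟨(iL A a).comp f.1, dual_iL f.2 a⟩)
    (fun a b f => Subtype.ext (LinearMap.ext fun x => by
      change iL A (a + b) (f.1 x) = iL A a (f.1 x) + iL A b (f.1 x)
      rw [map_add, LinearMap.add_apply]))
    (fun c a f => Subtype.ext (LinearMap.ext fun x => by
      change iL A (c • a) (f.1 x) = c • iL A a (f.1 x)
      rw [map_smul, LinearMap.smul_apply]))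
    (fun a f g => Subtype.ext (LinearMap.ext fun x => by
      change iL A a (f.1 x + g.1 x) = iL A a (f.1 x) + iL A a (g.1 x)
      rw [map_add]))
    (fun c a f => Subtype.ext (LinearMap.ext fun x => by
      change iL A a (c • f.1 x) = c • iL A a (f.1 x)
      rw [map_smul]))
  actR := LinearMap.mk₂ (ZMod 2) (fun f a => ⟨(iR A a).comp f.1, dual_iR f.2 a⟩)
    (fun f g a => Subtype.ext (LinearMap.ext fun x => by
      change iR A a (f.1 x + g.1 x) = iR A a (f.1 x) + iR A a (g.1 x)
      rw [map_add]))
    (fun c f a => Subtype.ext (LinearMap.ext fun x => by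
      change iR A a (c • f.1 x) = c • iR A a (f.1 x)
      rw [map_smul]))
    (fun f a b => Subtype.ext (LinearMap.ext fun x => by
      change iR A (a + b) (f.1 x) = iR A a (f.1 x) + iR A b (f.1 x)
      rw [map_add, LinearMap.add_apply]))
    (fun c f a => Subtype.ext (LinearMap.ext fun x => by
      change iR A (c • a) (f.1 x) = c • iR A a (f.1 x)
      rw [map_smul, LinearMap.smul_apply]))
  actL_one := fun f => Subtype.ext (LinearMap.ext fun x => iL_one (f.1 x))
  actR_one := fun f => Subtype.ext (LinearMap.ext fun x => iR_one (f.1 x))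
  actL_mul := fun a b f => Subtype.ext (LinearMap.ext fun x => iL_mul a b (f.1 x))
  actR_mul := fun f a b => Subtype.ext (LinearMap.ext fun x => iR_mul a b (f.1 x))
  actLR := fun a f b => Subtype.ext (LinearMap.ext fun x => (iL_iR a b (f.1 x)).symm)
  actL_gr := fun i n a ha f hf => by
    refine ⟨fun j x hx => ?_, (dual_iL f.2 a).1, (dual_iL f.2 a).2⟩
    have := iL_gr ha (hf.1 j x hx)
    have e : i + (j + n) = j + (i + n) := by omega
    rwa [e] at this
  actR_gr := fun n i f hf a ha => by
    refine ⟨fun j x hx => ?_, (dual_iR f.2 a).1, (dual_iR f.2 a).2⟩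
    have := iR_gr ha (hf.1 j x hx)
    rwa [add_assoc] at this
  leibnizL := fun i a _ f => by
    rw [np_smul]
    refine Subtype.ext (LinearMap.ext fun x => ?_)
    change (AA A).d (iL A a (f.1 x)) + iL A a (f.1 (C.d x)) =
      iL A (A.d a) (f.1 x) + iL A a ((AA A).d (f.1 x) + f.1 (C.d x))
    rw [d_iL, map_add, add_assoc]
  leibnizR := fun j f _ a => by
    rw [np_smul]
    refine Subtype.ext (LinearMap.ext fun x => ?_)
    change (AA A).d (iR A a (f.1 x)) + iR A a (f.1 (C.d x)) =
      iR A a ((AA A).d (f.1 x) + f.1 (C.d x)) + iR A (A.d a) (f.1 x)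
    rw [d_iR, map_add]; abel

end dual
end piece11

section piece12
variable {A : DGA (ZMod 2)}

section dual2
variable {C : DGBimod A} (D : CellData C)

theorem A_d_one : A.d A.one = 0 := by
  have h := A.dM A.one A.one
  rw [A.one_mul', A.mul_one', A.one_mul'] at h
  simpa using h

variable (A) in
/-- the generator of the free bimodule -/
def o11 : (AA A).V := A.one ⊗ₜ[ZMod 2] A.one

theorem o11_d : (AA A).d (o11 A) = 0 := by
  change aad A (A.one ⊗ₜ[ZMod 2] A.one) = 0
  rw [aad_tmul, A_d_one, TensorProduct.zero_tmul, TensorProduct.tmul_zero, add_zero]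

variable (A) in
/-- the flip -/
def swA : A.V ⊗[ZMod 2] A.V →ₗ[ZMod 2] A.V ⊗[ZMod 2] A.V :=
  (TensorProduct.comm (ZMod 2) A.V A.V).toLinearMap

theorem swA_tmul (a b : A.V) : swA A (a ⊗ₜ b) = b ⊗ₜ a := rfl
theorem swA_swA (z) : swA A (swA A z) = z :=
  aa_eq ((swA A).comp (swA A)) LinearMap.id (fun _ _ => rfl) z

open Classical in
/-- dual generators -/
def es [Finite D.I] (i : D.I) : (dual D).V := dext D (Pi.single i (o11 A))

/-- evaluation of an element of the dual on an element of the cell bimodule -/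
def dev [Finite D.I] (x : C.V) : (dual D).V →ₗ[ZMod 2] A.V ⊗[ZMod 2] A.V :=
  (LinearMap.applyₗ x).comp (dualSub C).subtype

theorem dev_L [Finite D.I] (x : C.V) (a : A.V) (f : (dual D).V) :
    dev D x ((dual D).actL a f) = inL A a (dev D x f) := rfl
theorem dev_R [Finite D.I] (x : C.V) (a : A.V) (f : (dual D).V) :
    dev D x ((dual D).actR f a) = inR A a (dev D x f) := rfl
theorem dev_d [Finite D.I] (x : C.V) (f : (dual D).V) :
    dev D x ((dual D).d f) = aad A (dev D x f) + dev D (C.d x) f := rfl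
theorem dev_add [Finite D.I] (x y : C.V) (f : (dual D).V) : dev D (x + y) f = dev D x f + dev D y f :=
  map_add f.1 x y
theorem dev_zero [Finite D.I] (f : (dual D).V) : dev D 0 f = 0 := map_zero f.1
theorem dev_xL [Finite D.I] (x : C.V) (a : A.V) (f : (dual D).V) :
    dev D (C.actL a x) f = ouL A a (dev D x f) := f.2.1 a x
theorem dev_xR [Finite D.I] (x : C.V) (a : A.V) (f : (dual D).V) :
    dev D (C.actR x a) f = ouR A (dev D x f) a := f.2.2 x a
theorem dev_ext [Finite D.I] {f f' : (dual D).V} (h : ∀ i, dev D (D.g i) f = dev D (D.g i) f') : f = f' :=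
  dual_ext' D h

theorem dev_es_same [Finite D.I] (i : D.I) : dev D (D.g i) (es D i) = A.one ⊗ₜ[ZMod 2] A.one := by
  classical
  have := dext_g D (Pi.single i (o11 A)) i
  rw [Pi.single_eq_same] at this
  exact this
theorem dev_es_ne [Finite D.I] {i j : D.I} (h : j ≠ i) : dev D (D.g j) (es D i) = 0 := by
  classical
  have := dext_g D (Pi.single i (o11 A)) j
  rw [Pi.single_eq_of_ne h] at this
  exact this

theorem dev_es_d [Finite D.I] (i j : D.I) : dev D (D.g j) ((dual D).d (es D i)) = dev D (C.d (D.g j)) (es D i) := by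
  rw [dev_d]
  by_cases h : j = i
  · subst h
    rw [dev_es_same]
    have : aad A (A.one ⊗ₜ[ZMod 2] A.one) = 0 := o11_d
    rw [this, zero_add]
  · rw [dev_es_ne D h, map_zero, zero_add]

theorem freeMap_dev [Finite D.I] (c : D.I →₀ (A.V ⊗[ZMod 2] A.V)) (j : D.I) :
    dev D (D.g j) (freeMap (dual D) (es D) c) = swA A (c j) := by
  classical
  induction c using Finsupp.induction_linear with
  | zero => rw [map_zero, map_zero]; exact (map_zero (swA A)).symm
  | add f g h h' => rw [map_add, map_add, h, h', Finsupp.add_apply, map_add]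
  | single i z =>
    rw [freeMap_single]
    induction z using TensorProduct.induction_on with
    | zero => rw [map_zero, map_zero, Finsupp.single_zero]; exact (map_zero (swA A)).symm
    | add f g h h' => rw [map_add, map_add, h, h', Finsupp.single_add, Finsupp.add_apply, map_add]
    | tmul a b =>
      rw [sandwichT_tmul, dev_R, dev_L]
      by_cases h : j = i
      · subst h
        rw [dev_es_same, Finsupp.single_eq_same, inL_tmul, inR_tmul, swA_tmul, A.mul_one', A.one_mul']
      · rw [dev_es_ne D h, Finsupp.single_eq_of_ne h, map_zero, map_zero, map_zero]

theorem es_free [Finite D.I] (c : D.I →₀ (A.V ⊗[ZMod 2] A.V)) (i : D.I) :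
    dev D (freeMap C D.g c) (es D i) = c i := by
  classical
  induction c using Finsupp.induction_linear with
  | zero => rw [map_zero, dev_zero]; rfl
  | add f g h h' => rw [map_add, dev_add, h, h', Finsupp.add_apply]
  | single j z =>
    rw [freeMap_single]
    induction z using TensorProduct.induction_on with
    | zero => rw [map_zero, dev_zero, Finsupp.single_zero]; rfl
    | add f g h h' => rw [map_add, dev_add, h, h', Finsupp.single_add, Finsupp.add_apply]
    | tmul a b =>
      rw [sandwichT_tmul, dev_xR, dev_xL]
      by_cases h : j = i
      · subst h
        rw [dev_es_same, Finsupp.single_eq_same, ouL_tmul, ouR_tmul, A.mul_one', A.one_mul']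
      · rw [dev_es_ne D h, Finsupp.single_eq_of_ne (Ne.symm h), map_zero, map_zero, LinearMap.zero_apply]

/-- The structure constants of the differential of the dual. -/
def cc [Finite D.I] (f : (dual D).V) : D.I →₀ (A.V ⊗[ZMod 2] A.V) :=
  Finsupp.equivFunOnFinite.symm fun j => swA A (dev D (D.g j) f)

theorem cc_free [Finite D.I] (f : (dual D).V) : freeMap (dual D) (es D) (cc D f) = f :=
  dev_ext D fun i => by rw [freeMap_dev, cc, Finsupp.equivFunOnFinite_symm_apply_apply, swA_swA]

theorem es_gr [Finite D.I] (i : D.I) : es D i ∈ (dual D).gr (- D.deg i) := by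
  refine dual_gr_of D (f := es D i) fun j => ?_
  change dev D (D.g j) (es D i) ∈ aagr A _
  by_cases h : j = i
  · subst h
    rw [dev_es_same]
    exact aa_tmul A.one_gr A.one_gr (by omega)
  · rw [dev_es_ne D h]; exact Submodule.zero_mem _

/-- The dual is a finite cell bimodule. -/
def dualCell [Finite D.I] : CellData (dual D) where
  I := D.I
  g := es D
  deg := fun i => - D.deg i
  lvl := fun i => (@Finset.univ D.I (Fintype.ofFinite D.I)).sup D.lvl - D.lvl i
  g_gr := es_gr D
  bij := by
    refine ⟨?_, fun f => ⟨cc D f, cc_free D f⟩⟩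
    intro c c' h
    ext j
    have h1 := freeMap_dev D c j
    rw [h, freeMap_dev] at h1
    rw [← swA_swA (c j), ← h1, swA_swA]
  tri := fun i => by
    refine ⟨cc D ((dual D).d (es D i)), (cc_free D _).symm, fun j hj => ?_⟩
    have h1 := Finset.le_sup (f := D.lvl) (@Finset.mem_univ _ (Fintype.ofFinite D.I) i)
    have h2 := Finset.le_sup (f := D.lvl) (@Finset.mem_univ _ (Fintype.ofFinite D.I) j)
    obtain ⟨c, hc, hc'⟩ := D.tri j
    rw [cc, Finsupp.equivFunOnFinite_symm_apply_apply, dev_es_d, hc, es_free, hc' i (by omega), map_zero]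

theorem nf2_coef [Finite D.I] (M : DGBimod A) (x : C.V) (m : M.V) (i : D.I) :
    nf2 D M (x ⊗ₜ m) i = sandwichT M m (swA A (dev D x (es D i))) := by
  classical
  refine D.ind (p := fun x => nf2 D M (x ⊗ₜ m) i = sandwichT M m (swA A (dev D x (es D i)))) ?_ ?_ ?_ x
  · rw [TensorProduct.zero_tmul, map_zero, dev_zero, map_zero, map_zero]; rfl
  · intro x y hx hy
    rw [TensorProduct.add_tmul, map_add, Finsupp.add_apply, hx, hy, dev_add, map_add, map_add]
  · intro j a b
    rw [nf2_gen, dev_xR, dev_xL]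
    by_cases h : j = i
    · subst h
      rw [dev_es_same, Finsupp.single_eq_same, ouL_tmul, ouR_tmul, A.mul_one', A.one_mul', swA_tmul, sandwichT_tmul]
    · rw [dev_es_ne D h, Finsupp.single_eq_of_ne (Ne.symm h), map_zero, map_zero, LinearMap.zero_apply, map_zero, map_zero]

theorem sandwichT_add (M : DGBimod A) (m m' : M.V) (z) :
    sandwichT M (m + m') z = sandwichT M m z + sandwichT M m' z :=
  aa_eq (sandwichT M (m + m')) (sandwichT M m + sandwichT M m') (fun a b => by
    rw [LinearMap.add_apply, sandwichT_tmul, sandwichT_tmul, sandwichT_tmul, map_add, map_add, LinearMap.add_apply]) z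

theorem freeMap_fin {I : Type} [Fintype I] (M : DGBimod A) (g : I → M.V) (c) :
    freeMap M g c = ∑ j, sandwichT M (g j) (c j) := by
  rw [freeMap, Finsupp.lsum_apply, Finsupp.sum_fintype]
  intro i; rw [map_zero]

theorem nf2_d [Finite D.I] (M : DGBimod A) (w : CW D M) (i : D.I) :
    nf2 D M (d2 C M (sig D M w)) i = freeMap M w (cc D ((dual D).d (es D i))) + M.d (w i) := by
  classical
  have := Fintype.ofFinite D.I
  induction w using Finsupp.induction_linear with
  | zero =>
    have : sandwichT M 0 = 0 := by
      refine LinearMap.ext fun z => ?_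
      have := sandwichT_add M 0 0 z
      rw [add_zero] at this
      simpa using this
    simp [freeMap_fin, this]
  | add f g h h' =>
    rw [map_add, map_add, map_add, Finsupp.add_apply, h, h', freeMap_fin, freeMap_fin, freeMap_fin,
      Finsupp.add_apply, map_add]
    simp only [Finsupp.add_apply, sandwichT_add, Finset.sum_add_distrib]
    abel
  | single j m =>
    have h0 : sandwichT M 0 = 0 := by
      refine LinearMap.ext fun z => ?_
      have := sandwichT_add M 0 0 z
      rw [add_zero] at this
      simpa using this
    rw [sig_single, d2_tmul, map_add, Finsupp.add_apply, nf2_coef, nf2_coef, freeMap_fin,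
      Finset.sum_eq_single j, Finsupp.single_eq_same]
    · congr 1
      · rw [cc, Finsupp.equivFunOnFinite_symm_apply_apply, dev_es_d]
      · by_cases h : j = i
        · subst h
          rw [dev_es_same, Finsupp.single_eq_same, swA_tmul, sandwichT_tmul, M.actL_one, M.actR_one]
        · rw [dev_es_ne D h, Finsupp.single_eq_of_ne (Ne.symm h), map_zero, map_zero, map_zero]
    · intro b _ hb
      rw [Finsupp.single_eq_of_ne hb, h0, LinearMap.zero_apply]
    · intro h; exact absurd (Finset.mem_univ _) h

/-- The canonical element. -/
def canw [Finite D.I] : CW D (dual D) := Finsupp.equivFunOnFinite.symm (es D)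

def can [Finite D.I] : T2 C (dual D) := sig D (dual D) (canw D)

theorem canw_apply [Finite D.I] (i : D.I) : canw D i = es D i := rfl

theorem nf2_zero {M : DGBimod A} {z : T2 C M} (h : nf2 D M z = 0) : z ∈ rel2 C M := by
  have := sig_nf2 D M z
  rwa [h, map_zero, add_zero] at this

theorem can_Z [Finite D.I] : can D ∈ (rc2 C (dual D)).Z 0 := by
  refine ⟨Submodule.mem_sup_left (sig_gr D (dual D) fun i => ?_), nf2_zero D (Finsupp.ext fun i => ?_)⟩
  · rw [canw_apply, zero_sub]; exact es_gr D i
  · rw [can, nf2_d]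
    have : freeMap (dual D) (canw D) (cc D ((dual D).d (es D i))) = (dual D).d (es D i) := cc_free D _
    rw [this, canw_apply, z2_add_self]; rfl

theorem map_sig {M M' : DGBimod A} (η : M.V →ₗ[ZMod 2] M'.V) (w : CW D M) :
    TensorProduct.map LinearMap.id η (sig D M w) = sig D M' (Finsupp.mapRange.linearMap η w) := by
  induction w using Finsupp.induction_linear with
  | zero => simp
  | add f g h h' => rw [map_add, map_add, h, h', map_add, map_add]
  | single j m => rw [sig_single, Finsupp.mapRange.linearMap_apply, Finsupp.mapRange_single, sig_single]; rfl

/-- Every Hochschild cycle comes from a map out of the dual. -/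
theorem repr_C [Finite D.I] {M : DGBimod A} {k : ℤ} {y : T2 C M} (hy : y ∈ (rc2 C M).Z k) :
    ∃ η, IsBHom (dual D) M k η ∧ y + TensorProduct.map LinearMap.id η (can D) ∈ rel2 C M := by
  obtain ⟨y', hy', hdy, hyy⟩ := (rc2 C M).Z_rep hy
  let w := nf2 D M y'
  have hw : y' + sig D M w ∈ rel2 C M := sig_nf2 D M y'
  have hdw : nf2 D M (d2 C M (sig D M w)) = 0 := by
    have h1 : d2 C M (y' + sig D M w) ∈ rel2 C M := d2_rel hw
    rw [map_add] at h1
    have h2 := Submodule.add_mem _ hdy h1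
    apply nf2_rel
    have e : d2 C M y' + (d2 C M y' + d2 C M (sig D M w)) = d2 C M (sig D M w) := z2_add_cancel _ _
    have h3 : d2 C M y' + (d2 C M y' + d2 C M (sig D M w)) ∈ rel2 C M := h2
    rwa [e] at h3
  have hwg : w ∈ cwgr D M k := nf2_gr D M hy'
  let η := (dualCell D).ext (E := M) w
  have hη : ∀ i, η (es D i) = w i := fun i => (dualCell D).ext_g (E := M) w i
  have hηm : η ∈ grHomSub (dual D) M k := (dualCell D).ext_mem _ (fun i => by
    have := hwg i
    have e : k - D.deg i = (dualCell D).deg i + k := by change _ = - D.deg i + k; omega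
    rwa [e] at this)
  have hd : ∀ i : D.I, η ((dual D).d (es D i)) = M.d (η (es D i)) := by
    intro i
    have h1 : nf2 D M (d2 C M (sig D M w)) i = 0 := DFunLike.congr_fun hdw i
    have h3 := nf2_d D M w i
    rw [h1] at h3
    have h2 := z2_eq_of_add h3.symm
    rw [hη, ← h2]
    conv_lhs => rw [← cc_free D ((dual D).d (es D i))]
    have := (dualCell D).e_symm_free (cc D ((dual D).d (es D i)))
    exact congrArg (freeMap M w) this
  refine ⟨η, isB_of hηm ((dualCell D).chain_of_gen hηm.2.1 hηm.2.2 hd), ?_⟩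
  · have e : TensorProduct.map LinearMap.id η (can D) = sig D M w := by
      rw [can, map_sig]
      congr 1
      ext i
      rw [Finsupp.mapRange.linearMap_apply, Finsupp.mapRange_apply, canw_apply, hη]
    rw [e]
    have e2 : y + sig D M w = (y + y') + (y' + sig D M w) := by
      rw [add_assoc, z2_add_cancel]
    rw [e2]
    exact Submodule.add_mem _ hyy hw

end dual2
end piece12

section piece13
variable {A : DGA (ZMod 2)}

section pushing
variable {M M' M'' : DGBimod A}

/-- functoriality of Hochschild chains in the coefficient -/
abbrev ps (R : DGBimod A) {M M' : DGBimod A} (g : M.V →ₗ[ZMod 2] M'.V) : T2 R M →ₗ[ZMod 2] T2 R M' :=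
  TensorProduct.map LinearMap.id g

theorem ps_map (R : DGBimod A) {s : ℤ} {g : M.V →ₗ[ZMod 2] M'.V} (hg : IsBHom M M' s g) :
    RC.Map (rc2 R M) (rc2 R M') s (ps R g) := rc2_map (isB_id R) hg (zero_add s)

theorem ps_comp (R : DGBimod A) (g : M'.V →ₗ[ZMod 2] M''.V) (f : M.V →ₗ[ZMod 2] M'.V) (z : T2 R M) :
    ps R (g.comp f) z = ps R g (ps R f z) := by
  induction z using TensorProduct.induction_on with
  | zero => simp
  | add x y hx hy => rw [map_add, map_add, map_add, hx, hy]
  | tmul r m => rfl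

theorem ps_add (R : DGBimod A) (g f : M.V →ₗ[ZMod 2] M'.V) (z : T2 R M) :
    ps R (g + f) z = ps R g z + ps R f z := by
  induction z using TensorProduct.induction_on with
  | zero => simp
  | add x y hx hy => rw [map_add, map_add, map_add, hx, hy]; abel
  | tmul r m => exact TensorProduct.tmul_add _ _ _

theorem ps_id (R : DGBimod A) (z : T2 R M) : ps R (LinearMap.id : M.V →ₗ[ZMod 2] M.V) z = z := by
  rw [ps, TensorProduct.map_id]; rfl

/-- first-variable functoriality -/
abbrev pf {R R' : DGBimod A} (M : DGBimod A) (g : R.V →ₗ[ZMod 2] R'.V) : T2 R M →ₗ[ZMod 2] T2 R' M :=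
  TensorProduct.map g LinearMap.id

theorem pf_map {R R' : DGBimod A} (M : DGBimod A) {s : ℤ} {g : R.V →ₗ[ZMod 2] R'.V} (hg : IsBHom R R' s g) :
    RC.Map (rc2 R M) (rc2 R' M) s (pf M g) := rc2_map hg (isB_id M) (add_zero s)

theorem pf_ps {R R' : DGBimod A} (f : R.V →ₗ[ZMod 2] R'.V) (g : M.V →ₗ[ZMod 2] M'.V) (z : T2 R M) :
    pf M' f (ps R g z) = ps R' g (pf M f z) := by
  induction z using TensorProduct.induction_on with
  | zero => simp
  | add x y hx hy => rw [map_add, map_add, map_add, map_add, hx, hy]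
  | tmul r m => rfl

theorem pf_comp_add {R R' : DGBimod A} (f : R.V →ₗ[ZMod 2] R'.V) (g : R'.V →ₗ[ZMod 2] R.V) (z : T2 R M) :
    pf M (g.comp f + LinearMap.id) z = pf M g (pf M f z) + z := by
  induction z using TensorProduct.induction_on with
  | zero => simp
  | add x y hx hy => rw [map_add, map_add, map_add, hx, hy]; abel
  | tmul r m => exact TensorProduct.add_tmul _ _ _
end pushing

/-- A bimodule representing the Hochschild functor. -/
structure Rep (R N : DGBimod A) (θ : T2 R N) : Prop where
  Z : θ ∈ (rc2 R N).Z 0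
  proj : ∀ (E : DGBimod A), Acyc E → ∀ s f, IsBHom N E s f → f ∈ nullHtpSub N E s
  repr : ∀ (M : DGBimod A) (k : ℤ) (y : T2 R M), y ∈ (rc2 R M).Z k →
    ∃ η, IsBHom N M k η ∧ y + ps R η θ ∈ (rc2 R M).B k

theorem rep_exists {R C : DGBimod A} (D : CellData C) [Finite D.I] {u v} (hu : IsBHom R C 0 u) (hv : IsBHom C R 0 v)
    (huv : v.comp u + LinearMap.id ∈ nullHtpSub R R 0) : Rep R (dual D) (pf (dual D) v (can D)) where
  Z := by simpa using (pf_map (dual D) hv).Z (can_Z D)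
  proj := fun E hE s f hf => (dualCell D).kproj hE hf
  repr := by
    intro M k y hy
    have h1 : pf M u y ∈ (rc2 C M).Z k := by simpa using (pf_map M hu).Z hy
    obtain ⟨η, hη, h2⟩ := repr_C D h1
    refine ⟨η, hη, ?_⟩
    have h3 : pf M v (pf M u y + ps C η (can D)) ∈ rel2 R M := (pf_map M hv).N _ h2
    have h4 : pf M (v.comp u + LinearMap.id) y ∈ (rc2 R M).B k := by
      have := rc2_null1 huv hy
      rwa [add_zero] at this
    rw [pf_comp_add] at h4
    rw [map_add, pf_ps] at h3
    have h5 := Submodule.add_mem _ h4 ((rc2 R M).N_le_B k h3)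
    have e : pf M v (pf M u y) + y + (pf M v (pf M u y) + ps R η (pf (dual D) v (can D)))
      = y + ps R η (pf (dual D) v (can D)) := by
      rw [show pf M v (pf M u y) + y + (pf M v (pf M u y) + ps R η (pf (dual D) v (can D)))
        = pf M v (pf M u y) + (pf M v (pf M u y) + (y + ps R η (pf (dual D) v (can D)))) by abel, z2_add_cancel]
    have h6 : pf M v (pf M u y) + y + (pf M v (pf M u y) + ps R η (pf (dual D) v (can D))) ∈ (rc2 R M).B k := h5
    rwa [e] at h6

section reps
variable {R N : DGBimod A} {θ : T2 R N} (hN : Rep R N θ)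

theorem acyc_F (hN : Rep R N θ) {E : DGBimod A} (hE : Acyc E) (k : ℤ) : (rc2 R E).Z k ≤ (rc2 R E).B k := by
  intro y hy
  obtain ⟨η, hη, h⟩ := hN.repr E k y hy
  have h1 : ps R η θ ∈ (rc2 R E).B k := by
    have := rc2_null (hN.proj E hE k η hη) hN.Z
    rwa [zero_add] at this
  have h2 : y + ps R η θ + ps R η θ ∈ (rc2 R E).B k := Submodule.add_mem _ h h1
  rwa [add_assoc, z2_add_self, add_zero] at h2

/-- first inclusion into the cocone -/
def coinl {W W' : DGBimod A} {φ : W.V →ₗ[ZMod 2] W'.V} (hφ : IsBHom W W' 0 φ) :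
    W.V →ₗ[ZMod 2] (cocone φ hφ).V := LinearMap.inl _ _ _
/-- second inclusion into the cocone -/
def coinr {W W' : DGBimod A} {φ : W.V →ₗ[ZMod 2] W'.V} (hφ : IsBHom W W' 0 φ) :
    W'.V →ₗ[ZMod 2] (cocone φ hφ).V := LinearMap.inr _ _ _

theorem coinl_mem {W W' : DGBimod A} {φ : W.V →ₗ[ZMod 2] W'.V} (hφ : IsBHom W W' 0 φ) :
    coinl hφ ∈ grHomSub W (cocone φ hφ) 0 :=
  ⟨fun i x hx => ⟨by rw [add_zero]; exact hx, Submodule.zero_mem _⟩,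
    fun a m => Prod.ext rfl (map_zero (W'.actL a)).symm,
    fun m a => Prod.ext rfl (by change 0 = W'.actR 0 a; rw [map_zero, LinearMap.zero_apply])⟩

theorem coinr_isB {W W' : DGBimod A} {φ : W.V →ₗ[ZMod 2] W'.V} (hφ : IsBHom W W' 0 φ) :
    IsBHom W' (cocone φ hφ) (-1) (coinr hφ) :=
  ⟨fun i x hx => ⟨Submodule.zero_mem _, by
      change x ∈ W'.gr (i + -1 + 1)
      rwa [neg_add_cancel_right]⟩,
    fun x => Prod.ext (map_zero W.d).symm (by change W'.d x = φ 0 + W'.d x; simp),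
    fun a m => Prod.ext (map_zero (W.actL a)).symm rfl,
    fun m a => Prod.ext (by change 0 = W.actR 0 a; rw [map_zero, LinearMap.zero_apply]) rfl⟩

theorem coinl_d {W W' : DGBimod A} {φ : W.V →ₗ[ZMod 2] W'.V} (hφ : IsBHom W W' 0 φ) (x : W.V) :
    (cocone φ hφ).d (coinl hφ x) = coinl hφ (W.d x) + coinr hφ (φ x) :=
  Prod.ext (by change W.d x = W.d x + 0; simp) (by change φ x + W'.d 0 = 0 + φ x; simp)

theorem d2_coinl (R : DGBimod A) {W W' : DGBimod A} {φ : W.V →ₗ[ZMod 2] W'.V} (hφ : IsBHom W W' 0 φ) (z : T2 R W) :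
    d2 R (cocone φ hφ) (ps R (coinl hφ) z) = ps R (coinl hφ) (d2 R W z) + ps R (coinr hφ) (ps R φ z) := by
  induction z using TensorProduct.induction_on with
  | zero => simp
  | add x y hx hy => simp only [map_add] at hx hy ⊢; rw [hx, hy]; abel
  | tmul r m =>
    rw [TensorProduct.map_tmul, d2_tmul, d2_tmul, coinl_d, map_add, TensorProduct.tmul_add]
    exact (add_assoc _ _ _).symm

theorem co_exact (R : DGBimod A) {W W' : DGBimod A} {φ : W.V →ₗ[ZMod 2] W'.V} (hφ : IsBHom W W' 0 φ) {k : ℤ} {y : T2 R W}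
    (hy : y ∈ (rc2 R W).Z k) (hB : ps R φ y ∈ (rc2 R W').B k) :
    ∃ κ ∈ (rc2 R (cocone φ hφ)).Z k, ps R (cofst hφ) κ = y := by
  obtain ⟨v, hv, h⟩ := (rc2 R W').mem_B.1 hB
  refine ⟨ps R (coinl hφ) y + ps R (coinr hφ) v, ⟨Submodule.add_mem _ ?_ ?_, ?_⟩, ?_⟩
  · obtain ⟨a, ha, b, hb, e⟩ := Submodule.mem_sup.1 hy.1
    rw [← e, map_add]
    refine Submodule.add_mem_sup ?_ ?_
    · have := gr2_map (R := R) (R' := R) (s := 0) (t := 0) (f := LinearMap.id) (fun i x hx => by rw [add_zero]; exact hx) (coinl_mem hφ).1 (add_zero 0) ha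
      rwa [add_zero] at this
    · exact rel2_map (fun _ _ => rfl) (fun _ _ => rfl) (coinl_mem hφ).2.1 (coinl_mem hφ).2.2 hb
  · refine Submodule.mem_sup_left ?_
    have := gr2_map (R := R) (R' := R) (s := 0) (t := -1) (f := LinearMap.id) (fun i x hx => by rw [add_zero]; exact hx) (coinr_isB hφ).1 (zero_add _) hv
    rwa [add_neg_cancel_right] at this
  · change d2 R (cocone φ hφ) (ps R (coinl hφ) y + ps R (coinr hφ) v) ∈ rel2 R (cocone φ hφ)
    have h1 : d2 R (cocone φ hφ) (ps R (coinr hφ) v) = ps R (coinr hφ) (d2 R W' v) :=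
      (d2_map (f := LinearMap.id) (fun _ => rfl) (coinr_isB hφ).2.1 v).symm
    rw [map_add, d2_coinl, h1, add_assoc, ← map_add]
    refine Submodule.add_mem _ ?_ ?_
    · exact rel2_map (fun _ _ => rfl) (fun _ _ => rfl) (coinl_mem hφ).2.1 (coinl_mem hφ).2.2 hy.2
    · exact rel2_map (fun _ _ => rfl) (fun _ _ => rfl) (coinr_isB hφ).2.2.1 (coinr_isB hφ).2.2.2 h
  · rw [map_add, ← ps_comp, ← ps_comp]
    have e1 : (cofst hφ).comp (coinl hφ) = LinearMap.id := rfl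
    have e2 : (cofst hφ).comp (coinr hφ) = 0 := rfl
    rw [e1, e2, ps_id, ps, TensorProduct.map_zero_right, LinearMap.zero_apply, add_zero]

theorem qiso_inj (hN : Rep R N θ) {W W' : DGBimod A} {φ : W.V →ₗ[ZMod 2] W'.V} (hφ : IsBHom W W' 0 φ)
    (hq : IsQIsoDeg W.V W'.V W.gr W'.gr W.d W'.d 0 φ) {k : ℤ} {y : T2 R W}
    (hy : y ∈ (rc2 R W).Z k) (hB : ps R φ y ∈ (rc2 R W').B k) : y ∈ (rc2 R W).B k := by
  obtain ⟨κ, hκ, e⟩ := co_exact R hφ hy hB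
  have := acyc_F hN (acyc_cocone hφ hq) k hκ
  have := (ps_map R (cofst_isB hφ)).B this
  rwa [e, add_zero] at this

theorem R_piFormal (hN : Rep R N θ) (ρ : R.V →ₗ[ZMod 2] A.diag.V) (hres : IsResolution R A.diag ρ)
    (hdiag : PiFormalBimod R A.diag) : PiFormalBimod R R := by
  have h1 := tateOK_of_retract hres.1 R
  have h2 := tateOK_of_retract hres.1 A.diag
  rw [piFormal_iff R R h1]
  refine TD.collapse_of_inj (tateHom h1 h2 hres.2.1) ((piFormal_iff R A.diag h2).1 hdiag) ?_
  intro k z hz hd hv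
  apply (rc2 R R).mem_B.1
  refine qiso_inj hN hres.2.1 hres.2.2 ⟨Submodule.mem_sup_left hz, hd⟩ ((rc2 R A.diag).mem_B.2 ?_)
  obtain ⟨v, hv, h⟩ := hv
  rw [add_zero] at hv
  exact ⟨v, hv, h⟩
end reps
end piece13

section piece14
variable {A : DGA (ZMod 2)}

section finiteness
variable {C : DGBimod A} (D : CellData C)

theorem nf2_top [Finite D.I] (M : DGBimod A) (w : CW D M) (i : D.I)
    (h : ∀ j, D.lvl i < D.lvl j → w j = 0) : nf2 D M (d2 C M (sig D M w)) i = M.d (w i) := by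
  classical
  have := Fintype.ofFinite D.I
  rw [nf2_d, freeMap_fin]
  have : ∑ j, sandwichT M (w j) (cc D ((dual D).d (es D i)) j) = 0 := by
    refine Finset.sum_eq_zero fun j _ => ?_
    by_cases hj : D.lvl i < D.lvl j
    · rw [h j hj]
      have e := sandwichT_add M 0 0 (cc D ((dual D).d (es D i)) j)
      rw [add_zero] at e
      rw [e, z2_add_self]
    · obtain ⟨c, hc, hc'⟩ := D.tri j
      rw [cc, Finsupp.equivFunOnFinite_symm_apply_apply, dev_es_d, hc, es_free, hc' i (by omega), map_zero, map_zero]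
  rw [this, zero_add]

theorem cell_FD_aux [Finite D.I] (M : DGBimod A) (hM : ∀ n, M.rc.FD n) (s : ℤ) (l : ℕ) :
    ∃ U : Submodule (ZMod 2) (T2 C M), Module.Finite (ZMod 2) U ∧
      ∀ w ∈ cwgr D M s, (∀ i, l ≤ D.lvl i → w i = 0) → d2 C M (sig D M w) ∈ rel2 C M →
        sig D M w ∈ U ⊔ (rc2 C M).B s := by
  classical
  have hft := Fintype.ofFinite D.I
  induction l with
  | zero =>
    refine ⟨⊥, inferInstance, fun w _ h _ => ?_⟩
    have : w = 0 := Finsupp.ext fun i => h i (Nat.zero_le _)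
    rw [this, map_zero]; exact Submodule.zero_mem _
  | succ l ih =>
    obtain ⟨U, hU, hUs⟩ := ih
    let S : Submodule (ZMod 2) (CW D M) :=
      { carrier := {w | w ∈ cwgr D M s ∧ (∀ i, l + 1 ≤ D.lvl i → w i = 0) ∧ d2 C M (sig D M w) ∈ rel2 C M}
        zero_mem' := ⟨Submodule.zero_mem _, fun _ _ => rfl, by rw [map_zero, map_zero]; exact Submodule.zero_mem _⟩
        add_mem' := fun {w w'} h h' => ⟨Submodule.add_mem _ h.1 h'.1, fun i hi => by
          rw [Finsupp.add_apply, h.2.1 i hi, h'.2.1 i hi, add_zero], by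
          rw [map_add, map_add]; exact Submodule.add_mem _ h.2.2 h'.2.2⟩
        smul_mem' := fun c w h => ⟨Submodule.smul_mem _ _ h.1, fun i hi => by
          rw [Finsupp.smul_apply, h.2.1 i hi, smul_zero], by
          rw [map_smul, map_smul]; exact Submodule.smul_mem _ _ h.2.2⟩ }
    let W : Submodule (ZMod 2) (CW D M) := ⨅ i : {i : D.I // D.lvl i = l},
      Submodule.comap (Finsupp.lapply i.1) (M.rc.B (s - D.deg i.1))
    choose V hV hVZ using hM
    let U1 : Submodule (ZMod 2) (CW D M) := ⨆ i : D.I, (V (s - D.deg i)).map (Finsupp.lsingle i)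
    have hU1 : Module.Finite (ZMod 2) U1 := by
      have : ∀ i : D.I, Module.Finite (ZMod 2) ((V (s - D.deg i)).map (Finsupp.lsingle (M := M.V) (R := ZMod 2) i)) :=
        fun i => RC.fin_map _ _ (hV _)
      exact Submodule.finite_iSup _
    have htop : ∀ w ∈ S, ∀ i : D.I, D.lvl i = l → M.d (w i) = 0 := by
      intro w hw i hi
      rw [← nf2_top D M w i (fun j hj => hw.2.1 j (by omega)), nf2_rel D M hw.2.2]; rfl
    have hS : S ≤ U1 ⊔ W := by
      intro w hw
      have : ∀ i : D.I, ∃ v ∈ V (s - D.deg i), D.lvl i = l → w i + v ∈ M.rc.B (s - D.deg i) := by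
        intro i
        by_cases hi : D.lvl i = l
        · have h1 : w i ∈ M.rc.Z (s - D.deg i) :=
            ⟨Submodule.mem_sup_left (hw.1 i), by change M.d (w i) ∈ (⊥ : Submodule (ZMod 2) M.V); rw [htop w hw i hi]; exact Submodule.zero_mem _⟩
          obtain ⟨v, hv, b, hb, e⟩ := Submodule.mem_sup.1 (hVZ _ h1)
          refine ⟨v, hv, fun _ => ?_⟩
          rw [← e, add_comm v b, add_assoc, z2_add_self, add_zero]; exact hb
        · exact ⟨0, Submodule.zero_mem _, fun h => absurd h hi⟩
      choose v hv hvB using this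
      let u : CW D M := ∑ i, Finsupp.single i (v i)
      have hu : u ∈ U1 := Submodule.sum_mem _ fun i _ =>
        Submodule.mem_iSup_of_mem i ⟨v i, hv i, rfl⟩
      have hui : ∀ i, u i = v i := by
        intro i
        simp only [u, Finsupp.finsetSum_apply, Finsupp.single_apply]
        simp
      have e : w = u + (w + u) := by rw [add_comm w u, z2_add_cancel]
      rw [e]
      refine Submodule.add_mem_sup hu ?_
      rw [Submodule.mem_iInf]
      rintro ⟨i, hi⟩
      change (w + u) i ∈ M.rc.B (s - D.deg i)
      rw [Finsupp.add_apply, hui]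
      exact hvB i hi
    obtain ⟨U', hU'S, hU', hSU⟩ := RC.fin_choose hU1 hS
    refine ⟨U'.map (sig D M) ⊔ U, RC.fin_sup (RC.fin_map _ _ hU') hU, ?_⟩
    intro w h1 h2 h3
    have hw : w ∈ S := ⟨h1, h2, h3⟩
    obtain ⟨u, hu, w1, ⟨hw1, hw1S⟩, rfl⟩ := Submodule.mem_sup.1 (hSU hw)
    rw [map_add]
    refine Submodule.add_mem _ (Submodule.mem_sup_left (Submodule.mem_sup_left ⟨u, hu, rfl⟩)) ?_
    have : ∀ i : D.I, ∃ b ∈ M.gr (s + 1 - D.deg i), (D.lvl i = l → w1 i = M.d b) ∧ (D.lvl i ≠ l → b = 0) := by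
      intro i
      by_cases hi : D.lvl i = l
      · have := (Submodule.mem_iInf _).1 hw1 ⟨i, hi⟩
        obtain ⟨b, hb, hbe⟩ := M.rc.mem_B.1 this
        refine ⟨b, ?_, fun _ => z2_eq_of_add hbe, fun h => absurd hi h⟩
        have e : s + 1 - D.deg i = s - D.deg i + 1 := by ring
        rw [e]; exact hb
      · exact ⟨0, Submodule.zero_mem _, fun h => absurd h hi, fun _ => rfl⟩
    choose b hb hb1 hb2 using this
    let β : CW D M := Finsupp.equivFunOnFinite.symm b
    have hβg : β ∈ cwgr D M (s + 1) := fun i => hb i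
    have hβi : ∀ i, β i = b i := fun i => rfl
    let w' := nf2 D M (d2 C M (sig D M β))
    have hdw' : d2 C M (sig D M β) + sig D M w' ∈ rel2 C M := sig_nf2 D M _
    have hw'g : w' ∈ cwgr D M s := by
      have := nf2_gr D M (d2_gr (sig_gr D M hβg))
      rwa [add_sub_cancel_right] at this
    have hw'i : ∀ i, l ≤ D.lvl i → w' i = M.d (b i) := fun i hi =>
      nf2_top D M β i (fun j hj => by rw [hβi]; exact hb2 j (by omega))
    have hd' : d2 C M (sig D M w') ∈ rel2 C M := by
      have := d2_rel hdw'
      rwa [map_add, d2_d2, zero_add] at this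
    have hkey : sig D M (w1 + w') ∈ U ⊔ (rc2 C M).B s := by
      apply hUs
      · exact Submodule.add_mem _ hw1S.1 hw'g
      · intro i hi
        rw [Finsupp.add_apply, hw'i i hi]
        by_cases h : D.lvl i = l
        · rw [hb1 i h, z2_add_self]
        · rw [hw1S.2.1 i (by omega), hb2 i h, map_zero, add_zero]
      · rw [map_add, map_add]; exact Submodule.add_mem _ hw1S.2.2 hd'
    have hB : sig D M w' ∈ (rc2 C M).B s := by
      refine (rc2 C M).mem_B.2 ⟨sig D M β, sig_gr D M hβg, ?_⟩
      change sig D M w' + d2 C M (sig D M β) ∈ rel2 C M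
      rw [add_comm]; exact hdw'
    have e : sig D M w1 = sig D M (w1 + w') + sig D M w' := by
      rw [map_add, add_assoc, z2_add_self, add_zero]
    rw [e, sup_assoc]
    exact Submodule.mem_sup_right (Submodule.add_mem _ hkey (Submodule.mem_sup_right hB))

theorem cell_FD [Finite D.I] (M : DGBimod A) (hM : ∀ n, M.rc.FD n) (s : ℤ) : (rc2 C M).FD s := by
  classical
  have := Fintype.ofFinite D.I
  obtain ⟨U, hU, h⟩ := cell_FD_aux D M hM s (Finset.univ.sup D.lvl + 1)
  refine ⟨U, hU, fun z hz => ?_⟩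
  obtain ⟨y, hy, hdy, hzy⟩ := (rc2 C M).Z_rep hz
  have h1 : y + sig D M (nf2 D M y) ∈ rel2 C M := sig_nf2 D M y
  have h2 := h (nf2 D M y) (nf2_gr D M hy) (fun i hi => by
    have := Finset.le_sup (f := D.lvl) (Finset.mem_univ i)
    omega) (by
    have := Submodule.add_mem _ hdy (d2_rel h1)
    have e : d2 C M y + d2 C M (y + sig D M (nf2 D M y)) = d2 C M (sig D M (nf2 D M y)) := by
      rw [map_add, z2_add_cancel]
    rw [← e]; exact this)
  have e : z = sig D M (nf2 D M y) + ((z + y) + (y + sig D M (nf2 D M y))) := by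
    rw [add_assoc z y, z2_add_cancel, add_comm z, z2_add_cancel]
  rw [e]
  exact Submodule.add_mem _ h2 (Submodule.mem_sup_right ((rc2 C M).N_le_B s (Submodule.add_mem _ hzy h1)))

/-- homotopy retracts of finite cell bimodules -/
theorem retract_FD [Finite D.I] {R : DGBimod A} {u v} (hu : IsBHom R C 0 u) (hv : IsBHom C R 0 v)
    (huv : v.comp u + LinearMap.id ∈ nullHtpSub R R 0) (M : DGBimod A) (hM : ∀ n, M.rc.FD n) (s : ℤ) :
    (rc2 R M).FD s := by
  refine RC.FD_retract (E' := rc2 C M) (s := 0) (f := pf M u) (g := pf M v) (fun x hx => (pf_map M hu).Z hx) (fun x hx => ?_) (fun x hx => ?_) (cell_FD D M hM _)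
  · have := (pf_map M hv).B hx
    simpa using this
  · have := rc2_null1 huv hx (M := M)
    rw [add_zero] at this
    rw [← pf_comp_add]; exact this

theorem R_FD {R : DGBimod A} {ρ : R.V →ₗ[ZMod 2] A.diag.V} (hρ : IsBHom R A.diag 0 ρ)
    (hq : IsQIsoDeg R.V A.diag.V R.gr A.diag.gr R.d A.diag.d 0 ρ) (hp : HomProper A) (n : ℤ) : R.rc.FD n := by
  have h1 : A.diag.rc.FD n := (RC.FD_iff n).2 (hp.1 n)
  obtain ⟨V, hV, hZ⟩ := h1
  -- image of cycles
  have hc : (R.rc.Z n).map ρ ≤ V ⊔ A.diag.rc.B n := by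
    rintro _ ⟨x, hx, rfl⟩
    apply hZ
    have hm : RC.Map R.rc A.diag.rc 0 ρ := RC.Map.mk' hρ.1 (fun x hx => by
      rw [(Submodule.mem_bot _).1 hx, map_zero]; exact Submodule.zero_mem _) hρ.2.1
    simpa using hm.Z hx
  obtain ⟨U, hUZ, hU, hZU⟩ := RC.fin_choose hV hc
  -- lift U
  have : ∃ U' : Submodule (ZMod 2) R.V, Module.Finite (ZMod 2) U' ∧ U' ≤ R.rc.Z n ∧ U ≤ U'.map ρ := by
    obtain ⟨t, ht⟩ := (Module.Finite.iff_fg.1 hU)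
    have h1 : ∀ x ∈ t, ∃ y ∈ R.rc.Z n, ρ y = x := fun x hx => hUZ (by rw [← ht]; exact Submodule.subset_span hx)
    choose! y hy1 hy2 using h1
    classical
    refine ⟨Submodule.span _ (t.image y), Module.Finite.span_finset _ _, ?_, ?_⟩
    · rw [Submodule.span_le]
      intro x hx
      simp only [Finset.coe_image, Set.mem_image] at hx
      obtain ⟨z, hz, rfl⟩ := hx
      exact hy1 z hz
    · rw [← ht, Submodule.span_le]
      intro x hx
      exact ⟨y x, Submodule.subset_span (by simpa using ⟨x, hx, rfl⟩), hy2 x hx⟩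
  obtain ⟨U', hU'f, hU'Z, hU'⟩ := this
  refine ⟨U', hU'f, fun x hx => ?_⟩
  obtain ⟨w, hw, b, hb, e⟩ := Submodule.mem_sup.1 (hZU ⟨x, hx, rfl⟩)
  obtain ⟨y, hy, rfl⟩ := hU' hw
  have hxy : x + y ∈ R.rc.Z n := Submodule.add_mem _ hx (hU'Z hy)
  have hb' : ρ (x + y) ∈ A.diag.rc.B n := by
    rw [map_add, ← e, add_comm (ρ y) b, add_assoc, z2_add_self, add_zero]; exact hb.1
  obtain ⟨c, hc, hce⟩ := A.diag.rc.mem_B.1 hb'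
  have hxg : x + y ∈ R.gr n := by
    have := hxy.1
    rwa [sup_bot_eq] at this
  obtain ⟨z, hz, hze⟩ := (hq n).2 (x + y) hxg hxy.2 ⟨c, by simpa using hc, (z2_eq_of_add hce).symm ▸ rfl⟩
  have e : x = y + (x + y) := by rw [add_comm x y, z2_add_cancel]
  rw [e]
  refine Submodule.add_mem_sup hy ?_
  rw [← hze]
  exact R.rc.d_mem_B (Submodule.mem_sup_left hz)

/-- finiteness via the swap -/
theorem swap_FD {R N : DGBimod A} {s : ℤ} (h : (rc2 N R).FD s) : (rc2 R N).FD s := by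
  refine RC.FD_retract (E' := rc2 N R) (s := 0) (f := (TensorProduct.comm (ZMod 2) R.V N.V).toLinearMap)
    (g := (TensorProduct.comm (ZMod 2) N.V R.V).toLinearMap) (fun x hx => (rc2_swap R N).Z hx) (fun x hx => ?_) (fun x hx => ?_) (by rwa [add_zero])
  · simpa using (rc2_swap N R).B hx
  · have e : (TensorProduct.comm (ZMod 2) N.V R.V) ((TensorProduct.comm (ZMod 2) R.V N.V) x) = x :=
      TensorProduct.comm_comm _ _ _ _
    have : (TensorProduct.comm (ZMod 2) N.V R.V) ((TensorProduct.comm (ZMod 2) R.V N.V) x) + x = (0 : T2 R N) := by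
      rw [e]; exact z2_add_self x
    change (TensorProduct.comm (ZMod 2) N.V R.V) ((TensorProduct.comm (ZMod 2) R.V N.V) x) + x ∈ (rc2 R N).B s
    rw [this]; exact Submodule.zero_mem _
end finiteness
end piece14

section piece15
variable {A : DGA (ZMod 2)}

/-! ### The graded dual -/

section gd
variable (R : DGBimod A)

/-- functionals vanishing on almost all homogeneous components -/
def gdSub : Submodule (ZMod 2) (R.V →ₗ[ZMod 2] ZMod 2) where
  carrier := {f | ∃ u : Finset ℤ, ∀ m ∉ u, ∀ x ∈ R.gr m, f x = 0}
  zero_mem' := ⟨∅, fun _ _ _ _ => rfl⟩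
  add_mem' := by
    classical
    rintro f g ⟨u, hu⟩ ⟨v, hv⟩
    refine ⟨u ∪ v, fun m hm x hx => ?_⟩
    rw [Finset.mem_union, not_or] at hm
    rw [LinearMap.add_apply, hu m hm.1 x hx, hv m hm.2 x hx, add_zero]
  smul_mem' := by
    rintro c f ⟨u, hu⟩
    exact ⟨u, fun m hm x hx => by rw [LinearMap.smul_apply, hu m hm x hx, smul_zero]⟩

/-- degree `n` functionals -/
def gdgr (n : ℤ) : Submodule (ZMod 2) (gdSub R) where
  carrier := {f | ∀ m, m ≠ -n → ∀ x ∈ R.gr m, f.1 x = 0}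
  zero_mem' := fun _ _ _ _ => rfl
  add_mem' := by
    intro f g hf hg m hm x hx
    change f.1 x + g.1 x = 0
    rw [hf m hm x hx, hg m hm x hx, add_zero]
  smul_mem' := by
    intro c f hf m hm x hx
    change c • f.1 x = 0
    rw [hf m hm x hx, smul_zero]

variable {R}
theorem gd_ext {f g : gdSub R} (h : ∀ x, f.1 x = g.1 x) : f = g := Subtype.ext (LinearMap.ext h)

/-- a functional of a single degree -/
theorem gd_single {f : R.V →ₗ[ZMod 2] ZMod 2} (n : ℤ) (h : ∀ m, m ≠ n → ∀ x ∈ R.gr m, f x = 0) : f ∈ gdSub R :=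
  ⟨{n}, fun m hm x hx => h m (by simpa using hm) x hx⟩

theorem gd_hom_eq {f g : R.V →ₗ[ZMod 2] ZMod 2} (h : ∀ m, ∀ x ∈ R.gr m, f x = g x) : f = g :=
  LinearMap.ext fun x => int_ind R.internal (p := fun x => f x = g x) x (by rw [map_zero, map_zero])
    (fun x y hx hy => by rw [map_add, map_add, hx, hy]) h

variable (R) in
/-- projection to a degree -/
def gdc (n : ℤ) : gdSub R →ₗ[ZMod 2] gdSub R where
  toFun := fun f => ⟨f.1.comp (comp R.gr R.internal (-n)), gd_single (-n) fun m hm x hx => by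
    rw [LinearMap.comp_apply, comp_ne _ hx hm, map_zero]⟩
  map_add' := fun f g => rfl
  map_smul' := fun c f => rfl

theorem gd_internal : DirectSum.IsInternal (gdgr R) := by
  classical
  refine internal_of (gdc R) ?_ ?_ ?_
  · intro n f hf
    refine Subtype.ext (gd_hom_eq fun m x hx => ?_)
    change f.1 (comp R.gr R.internal (-n) x) = f.1 x
    by_cases h : m = -n
    · subst h; rw [comp_same _ hx]
    · rw [comp_ne _ hx h, map_zero, hf m h x hx]
  · intro n n' hn f hf
    refine Subtype.ext (gd_hom_eq fun m x hx => ?_)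
    change f.1 (comp R.gr R.internal (-n) x) = 0
    by_cases h : m = -n
    · subst h; rw [comp_same _ hx]; exact hf (-n) (by omega) x hx
    · rw [comp_ne _ hx h, map_zero]
  · rintro ⟨f, u, hu⟩
    have e : (⟨f, u, hu⟩ : gdSub R) = ∑ m ∈ u, gdc R (-m) ⟨f, u, hu⟩ := by
      refine Subtype.ext (gd_hom_eq fun m x hx => ?_)
      rw [Submodule.coe_sum, LinearMap.sum_apply]
      change f x = ∑ i ∈ u, f (comp R.gr R.internal (- -i) x)
      by_cases hm : m ∈ u
      · rw [Finset.sum_eq_single m]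
        · rw [neg_neg, comp_same _ hx]
        · intro b _ hb; rw [neg_neg, comp_ne _ hx hb.symm, map_zero]
        · intro h; exact absurd hm h
      · rw [hu m hm x hx]
        symm
        refine Finset.sum_eq_zero fun i hi => ?_
        rw [neg_neg, comp_ne _ hx (fun h => hm (h ▸ hi)), map_zero]
    rw [e]
    refine Submodule.sum_mem _ fun m _ => Submodule.mem_iSup_of_mem (-m) fun m' hm' x hx => ?_
    change f (comp R.gr R.internal (- -m) x) = 0
    rw [comp_ne _ hx hm', map_zero]

theorem gd_cL {f : R.V →ₗ[ZMod 2] ZMod 2} (hf : f ∈ gdSub R) (a : A.V) : f.comp (R.actR.flip a) ∈ gdSub R := by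
  classical
  refine int_ind A.internal (p := fun a => f.comp (R.actR.flip a) ∈ gdSub R) a ?_ ?_ ?_
  · rw [map_zero, LinearMap.comp_zero]; exact Submodule.zero_mem _
  · intro x y hx hy; rw [map_add, LinearMap.comp_add]; exact Submodule.add_mem _ hx hy
  · intro i a ha
    obtain ⟨u, hu⟩ := hf
    refine ⟨u.image (fun m => m - i), fun m hm x hx => ?_⟩
    refine hu (m + i) (fun h => hm ?_) _ (R.actR_gr m i x hx a ha)
    exact Finset.mem_image.2 ⟨m + i, h, by ring⟩

theorem gd_cR {f : R.V →ₗ[ZMod 2] ZMod 2} (hf : f ∈ gdSub R) (a : A.V) : f.comp (R.actL a) ∈ gdSub R := by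
  classical
  refine int_ind A.internal (p := fun a => f.comp (R.actL a) ∈ gdSub R) a ?_ ?_ ?_
  · rw [map_zero, LinearMap.comp_zero]; exact Submodule.zero_mem _
  · intro x y hx hy; rw [map_add, LinearMap.comp_add]; exact Submodule.add_mem _ hx hy
  · intro i a ha
    obtain ⟨u, hu⟩ := hf
    refine ⟨u.image (fun m => m - i), fun m hm x hx => ?_⟩
    refine hu (i + m) (fun h => hm ?_) _ (R.actL_gr i m a ha x hx)
    exact Finset.mem_image.2 ⟨i + m, h, by ring⟩

theorem gd_cd {f : R.V →ₗ[ZMod 2] ZMod 2} (hf : f ∈ gdSub R) : f.comp R.d ∈ gdSub R := by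
  classical
  obtain ⟨u, hu⟩ := hf
  refine ⟨u.image (fun m => m + 1), fun m hm x hx => ?_⟩
  refine hu (m - 1) (fun h => hm ?_) _ (R.d_gr m x hx)
  exact Finset.mem_image.2 ⟨m - 1, h, by ring⟩

variable (R) in
/-- The graded dual. -/
def gd : DGBimod A where
  V := gdSub R
  gr := gdgr R
  internal := gd_internal
  d := { toFun := fun f => ⟨f.1.comp R.d, gd_cd f.2⟩, map_add' := fun _ _ => rfl, map_smul' := fun _ _ => rfl }
  d_d := fun f => gd_ext fun x => by
    change f.1 (R.d (R.d x)) = 0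
    rw [R.d_d, map_zero]
  d_gr := fun i f hf m hm x hx => hf (m - 1) (by omega) _ (R.d_gr m x hx)
  actL := LinearMap.mk₂ (ZMod 2) (fun a f => (⟨f.1.comp (R.actR.flip a), gd_cL f.2 a⟩ : gdSub R))
    (fun a b f => gd_ext fun x => by
      change f.1 (R.actR x (a + b)) = f.1 (R.actR x a) + f.1 (R.actR x b)
      rw [map_add, map_add])
    (fun c a f => gd_ext fun x => by
      change f.1 (R.actR x (c • a)) = c • f.1 (R.actR x a)
      rw [map_smul, map_smul])
    (fun a f g => rfl) (fun c a f => rfl)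
  actR := LinearMap.mk₂ (ZMod 2) (fun f a => (⟨f.1.comp (R.actL a), gd_cR f.2 a⟩ : gdSub R))
    (fun f g a => rfl) (fun c f a => rfl)
    (fun f a b => gd_ext fun x => by
      change f.1 (R.actL (a + b) x) = f.1 (R.actL a x) + f.1 (R.actL b x)
      rw [map_add, LinearMap.add_apply, map_add])
    (fun c f a => gd_ext fun x => by
      change f.1 (R.actL (c • a) x) = c • f.1 (R.actL a x)
      rw [map_smul, LinearMap.smul_apply, map_smul])
  actL_one := fun f => gd_ext fun x => by
    change f.1 (R.actR x A.one) = f.1 x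
    rw [R.actR_one]
  actR_one := fun f => gd_ext fun x => by
    change f.1 (R.actL A.one x) = f.1 x
    rw [R.actL_one]
  actL_mul := fun a b f => gd_ext fun x => by
    change f.1 (R.actR x (A.mul a b)) = f.1 (R.actR (R.actR x a) b)
    rw [R.actR_mul]
  actR_mul := fun f a b => gd_ext fun x => by
    change f.1 (R.actL a (R.actL b x)) = f.1 (R.actL (A.mul a b) x)
    rw [R.actL_mul]
  actLR := fun a f b => gd_ext fun x => by
    change f.1 (R.actR (R.actL b x) a) = f.1 (R.actL b (R.actR x a))
    rw [R.actLR]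
  actL_gr := fun i j a ha f hf m hm x hx => hf (m + i) (by omega) _ (R.actR_gr m i x hx a ha)
  actR_gr := fun i j f hf a ha m hm x hx => hf (j + m) (by omega) _ (R.actL_gr j m a ha x hx)
  leibnizL := fun i a ha f => by
    rw [np_smul]
    refine gd_ext fun x => ?_
    change f.1 (R.actR (R.d x) a) = f.1 (R.actR x (A.d a)) + f.1 (R.d (R.actR x a))
    rw [R.dR, map_add, add_comm (f.1 (R.actR (R.d x) a)), z2_add_cancel]
  leibnizR := fun j f hf a => by
    rw [np_smul]
    refine gd_ext fun x => ?_
    change f.1 (R.actL a (R.d x)) = f.1 (R.d (R.actL a x)) + f.1 (R.actL (A.d a) x)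
    rw [R.dL, map_add, add_comm _ (f.1 (R.actL (A.d a) x)), z2_add_cancel]

/-- evaluation -/
def gdev (R : DGBimod A) : (gd R).V →ₗ[ZMod 2] R.V →ₗ[ZMod 2] ZMod 2 := (gdSub R).subtype

theorem gdev_d (f : (gd R).V) (x : R.V) : gdev R ((gd R).d f) x = gdev R f (R.d x) := rfl
theorem gdev_L (a : A.V) (f : (gd R).V) (x : R.V) : gdev R ((gd R).actL a f) x = gdev R f (R.actR x a) := rfl
theorem gdev_R (a : A.V) (f : (gd R).V) (x : R.V) : gdev R ((gd R).actR f a) x = gdev R f (R.actL a x) := rfl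
theorem gdev_ext {f g : (gd R).V} (h : ∀ m, ∀ x ∈ R.gr m, gdev R f x = gdev R g x) : f = g :=
  Subtype.ext (gd_hom_eq h)
theorem gdev_gr {n : ℤ} {f : (gd R).V} : f ∈ (gd R).gr n ↔ ∀ m, m ≠ -n → ∀ x ∈ R.gr m, gdev R f x = 0 := Iff.rfl
end gd

/-- finiteness from finitely many functionals -/
theorem fin_ker {T W : Type} [AddCommGroup T] [Module (ZMod 2) T] [AddCommGroup W] [Module (ZMod 2) W]
    (g : T →ₗ[ZMod 2] W) (hW : Module.Finite (ZMod 2) W) {Z B : Submodule (ZMod 2) T}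
    (h : ∀ z ∈ Z, g z = 0 → z ∈ B) : ∃ V : Submodule (ZMod 2) T, Module.Finite (ZMod 2) V ∧ Z ≤ V ⊔ B := by
  have hfr : Module.Finite (ZMod 2) (LinearMap.range g) := inferInstance
  obtain ⟨σ, hσ⟩ := LinearMap.exists_rightInverse_of_surjective g.rangeRestrict
    (LinearMap.range_eq_top.2 g.surjective_rangeRestrict)
  have hZ : Z ≤ LinearMap.range σ ⊔ LinearMap.ker g := by
    intro z _
    have e : z = σ (g.rangeRestrict z) + (z - σ (g.rangeRestrict z)) := by abel
    rw [e]
    refine Submodule.add_mem_sup ⟨_, rfl⟩ ?_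
    have h1 : g.rangeRestrict (σ (g.rangeRestrict z)) = g.rangeRestrict z := LinearMap.congr_fun hσ _
    have h2 : g (σ (g.rangeRestrict z)) = g z := congrArg Subtype.val h1
    rw [LinearMap.mem_ker, map_sub, h2, sub_self]
  obtain ⟨U, hUZ, hU, hZU⟩ := RC.fin_choose (inferInstance : Module.Finite (ZMod 2) (LinearMap.range σ)) hZ
  refine ⟨U, hU, hZU.trans (sup_le_sup_left (fun z hz => h z hz.2 hz.1) _)⟩

theorem factor_ker {V W : Type} [AddCommGroup V] [Module (ZMod 2) V] [AddCommGroup W] [Module (ZMod 2) W]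
    (d : V →ₗ[ZMod 2] W) (f : V →ₗ[ZMod 2] ZMod 2) (h : ∀ x, d x = 0 → f x = 0) :
    ∃ μ : W →ₗ[ZMod 2] ZMod 2, ∀ x, μ (d x) = f x := by
  obtain ⟨σ, hσ⟩ := LinearMap.exists_rightInverse_of_surjective d.rangeRestrict
    (LinearMap.range_eq_top.2 d.surjective_rangeRestrict)
  obtain ⟨μ, hμ⟩ := LinearMap.exists_extend (f.comp σ)
  refine ⟨μ, fun x => ?_⟩
  have h0 : μ (d x) = f (σ (d.rangeRestrict x)) := LinearMap.congr_fun hμ (d.rangeRestrict x)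
  have h1 : d.rangeRestrict (σ (d.rangeRestrict x)) = d.rangeRestrict x := LinearMap.congr_fun hσ _
  have h2 : d (σ (d.rangeRestrict x)) = d x := congrArg Subtype.val h1
  have h3 := h (σ (d.rangeRestrict x) - x) (by rw [map_sub, h2, sub_self])
  rw [map_sub, sub_eq_zero] at h3
  rw [h0, h3]

theorem comp_d {R : DGBimod A} (n : ℤ) (x : R.V) :
    comp R.gr R.internal n (R.d x) = R.d (comp R.gr R.internal (n + 1) x) := by
  refine int_ind R.internal (p := fun x => comp R.gr R.internal n (R.d x) = R.d (comp R.gr R.internal (n + 1) x)) x ?_ ?_ ?_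
  · simp
  · intro x y hx hy; simp only [map_add, hx, hy]
  · intro i x hx
    by_cases h : i = n + 1
    · subst h
      have := R.d_gr _ x hx
      rw [add_sub_cancel_right] at this
      rw [comp_same _ hx, comp_same _ this]
    · rw [comp_ne _ hx h, comp_ne _ (R.d_gr _ x hx) (by omega), map_zero]

theorem gd_FD {R : DGBimod A} (hR : ∀ n, R.rc.FD n) (n : ℤ) : (gd R).rc.FD n := by
  obtain ⟨V, hV, hZV⟩ := hR (-n)
  let res : (gd R).V →ₗ[ZMod 2] (V →ₗ[ZMod 2] ZMod 2) := (LinearMap.lcomp (ZMod 2) (ZMod 2) V.subtype).comp (gdev R)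
  refine fin_ker (T := (gd R).V) res inferInstance ?_
  intro f hf h0
  have hfg : f ∈ (gd R).gr n := by
    have := hf.1
    rwa [sup_bot_eq] at this
  have hfd : (gd R).d f = 0 := hf.2
  have hfd' : ∀ x, gdev R f (R.d x) = 0 := fun x => by rw [← gdev_d, hfd]; rfl
  have hfV : ∀ x ∈ V, gdev R f x = 0 := fun x hx => LinearMap.congr_fun h0 ⟨x, hx⟩
  have hfZ : ∀ x ∈ R.rc.Z (-n), gdev R f x = 0 := by
    intro x hx
    obtain ⟨v, hv, b, hb, rfl⟩ := Submodule.mem_sup.1 (hZV hx)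
    obtain ⟨y, hy, hye⟩ := R.rc.mem_B.1 hb
    rw [map_add, hfV v hv, z2_eq_of_add hye, zero_add]
    exact hfd' y
  have hfc : ∀ x, gdev R f x = gdev R f (comp R.gr R.internal (-n) x) := by
    intro x
    refine int_ind R.internal (p := fun x => gdev R f x = gdev R f (comp R.gr R.internal (-n) x)) x ?_ ?_ ?_
    · simp
    · intro x y hx hy; simp only [map_add]; rw [← hx, ← hy]
    · intro m x hx
      by_cases h : m = -n
      · subst h; rw [comp_same _ hx]
      · rw [comp_ne _ hx h, map_zero]; exact gdev_gr.1 hfg m h x hx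
  obtain ⟨μ0, hμ0⟩ := factor_ker R.d (gdev R f) (fun x hx => by
    rw [hfc]
    apply hfZ
    refine ⟨Submodule.mem_sup_left (comp_mem _ _ _), ?_⟩
    change R.d (comp R.gr R.internal (-n) x) ∈ (⊥ : Submodule (ZMod 2) R.V)
    have := comp_d (-n - 1) x
    rw [hx, map_zero, sub_add_cancel] at this
    rw [← this]; exact Submodule.zero_mem _)
  let μ : (gd R).V := (⟨μ0.comp (comp R.gr R.internal (-n - 1)), gd_single (-n - 1) fun m hm x hx => by
    rw [LinearMap.comp_apply, comp_ne _ hx hm, map_zero]⟩ : gdSub R)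
  have hμ : ∀ x, gdev R μ x = μ0 (comp R.gr R.internal (-n - 1) x) := fun _ => rfl
  refine (gd R).rc.mem_B.2 ⟨μ, gdev_gr.2 fun m hm x hx => ?_, ?_⟩
  · rw [hμ, comp_ne _ hx (by omega), map_zero]
  · change f + (gd R).d μ ∈ (⊥ : Submodule (ZMod 2) (gd R).V)
    have : (gd R).d μ = f := by
      refine gdev_ext fun m x hx => ?_
      rw [gdev_d, hμ, comp_d, hμ0, sub_add_cancel, ← hfc]
    rw [this, z2_add_self]; exact Submodule.zero_mem _
end piece15

section piece16
variable {A : DGA (ZMod 2)}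

/-! ### Finiteness of Hochschild homology of the inverse dualizing bimodule -/

theorem quot_fin {T : Type} [AddCommGroup T] [Module (ZMod 2) T] {Z B : Submodule (ZMod 2) T}
    (h : Module.Finite (ZMod 2) (↥Z ⧸ Submodule.comap Z.subtype B)) :
    ∃ U : Submodule (ZMod 2) T, U ≤ Z ∧ Module.Finite (ZMod 2) U ∧ Z ≤ U ⊔ B := by
  obtain ⟨g, hg⟩ := LinearMap.exists_rightInverse_of_surjective
    (Submodule.mkQ (Submodule.comap Z.subtype B)) (Submodule.range_mkQ _)
  refine ⟨LinearMap.range (Z.subtype.comp g), ?_, inferInstance, ?_⟩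
  · rintro _ ⟨y, rfl⟩; exact (g y).2
  intro z hz
  set y := Submodule.mkQ (Submodule.comap Z.subtype B) ⟨z, hz⟩ with hy
  have e : z = (g y : T) + (z - (g y : T)) := by abel
  rw [e]
  refine Submodule.add_mem_sup ⟨y, rfl⟩ ?_
  have h1 := LinearMap.congr_fun hg y
  have h2 : (Submodule.comap Z.subtype B).mkQ ⟨z, hz⟩ =
    (Submodule.comap Z.subtype B).mkQ (g y) := h1.symm
  exact (Submodule.Quotient.eq (Submodule.comap Z.subtype B)).1 h2

theorem htpy_fin {X N : DGBimod A} {s : ℤ} (h : Module.Finite (ZMod 2) (HtpyHom X N s)) :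
    ∃ U : Submodule (ZMod 2) (X.V →ₗ[ZMod 2] N.V), U ≤ bcmSub X N s ∧ Module.Finite (ZMod 2) U ∧
      bcmSub X N s ≤ U ⊔ nullHtpSub X N s :=
  quot_fin h

section pairing
variable (R X : DGBimod A)

/-- the pairing of maps into the graded dual with Hochschild chains -/
def gpair : (X.V →ₗ[ZMod 2] (gd R).V) →ₗ[ZMod 2] T2 R X →ₗ[ZMod 2] ZMod 2 where
  toFun := fun g => TensorProduct.lift ((gdev R).comp g).flip
  map_add' := fun g h => by
    apply TensorProduct.ext'
    intro r x; rfl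
  map_smul' := fun c g => by
    apply TensorProduct.ext'
    intro r x; rfl

variable {R X}
theorem gpair_tmul (g : X.V →ₗ[ZMod 2] (gd R).V) (r : R.V) (x : X.V) : gpair R X g (r ⊗ₜ x) = gdev R (g x) r := rfl

theorem gpair_rel {g : X.V →ₗ[ZMod 2] (gd R).V} (hL : ∀ a m, g (X.actL a m) = (gd R).actL a (g m))
    (hR : ∀ m a, g (X.actR m a) = (gd R).actR (g m) a) {z : T2 R X} (hz : z ∈ rel2 R X) : gpair R X g z = 0 := by
  have : rel2 R X ≤ LinearMap.ker (gpair R X g) := by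
    apply rel2_le
    · intro r a m
      rw [LinearMap.mem_ker, map_add, gpair_tmul, gpair_tmul, hL, gdev_L, z2_add_self]
    · intro r a m
      rw [LinearMap.mem_ker, map_add, gpair_tmul, gpair_tmul, hR, gdev_R, z2_add_self]
  exact this hz

theorem gpair_null {s : ℤ} {g : X.V →ₗ[ZMod 2] (gd R).V} (hg : g ∈ nullHtpSub X (gd R) s) {z : T2 R X}
    (hz : d2 R X z ∈ rel2 R X) : gpair R X g z = 0 := by
  obtain ⟨h, hh, e⟩ := mem_null.1 hg
  rw [← gpair_rel hh.2.1 hh.2.2 hz]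
  clear hz
  induction z using TensorProduct.induction_on with
  | zero => simp
  | add x y hx hy => rw [map_add, map_add, map_add, hx, hy]
  | tmul r x =>
    rw [d2_tmul, map_add, gpair_tmul, gpair_tmul, gpair_tmul, e, map_add, LinearMap.add_apply, gdev_d]

/-- the map to the graded dual given by a functional on Hochschild chains -/
def gcur0 (R X : DGBimod A) (s : ℤ) (Ψ : T2 R X →ₗ[ZMod 2] ZMod 2) (j : ℤ) : X.V →ₗ[ZMod 2] gdSub R :=
    { toFun := fun x => ⟨(Ψ.comp ((TensorProduct.mk (ZMod 2) R.V X.V).flip x)).comp (comp R.gr R.internal (s - j)),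
        gd_single (s - j) fun m hm r hr => by rw [LinearMap.comp_apply, comp_ne _ hr hm, map_zero]⟩
      map_add' := fun x y => gd_ext fun r => by
        change Ψ (_ ⊗ₜ (x + y)) = Ψ (_ ⊗ₜ x) + Ψ (_ ⊗ₜ y)
        rw [TensorProduct.tmul_add, map_add]
      map_smul' := fun c x => gd_ext fun r => by
        change Ψ (_ ⊗ₜ (c • x)) = c • Ψ (_ ⊗ₜ x)
        rw [TensorProduct.tmul_smul, map_smul] }

/-- the family above, with values in the bimodule -/
def gcur1 (R X : DGBimod A) (s : ℤ) (Ψ : T2 R X →ₗ[ZMod 2] ZMod 2) (j : ℤ) : X.V →ₗ[ZMod 2] (gd R).V :=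
  gcur0 R X s Ψ j

/-- the glued family -/
def gcurry (R X : DGBimod A) (s : ℤ) (Ψ : T2 R X →ₗ[ZMod 2] ZMod 2) : X.V →ₗ[ZMod 2] (gd R).V :=
  glue X.internal (gcur1 R X s Ψ)

theorem gcurry_apply (s : ℤ) (Ψ : T2 R X →ₗ[ZMod 2] ZMod 2) {j : ℤ} {x : X.V} (hx : x ∈ X.gr j) (r : R.V) :
    gdev R (gcurry R X s Ψ x) r = Ψ (comp R.gr R.internal (s - j) r ⊗ₜ x) := by
  have h := glue_apply X.internal (gcur1 R X s Ψ) hx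
  rw [gcurry, h]; rfl

theorem gcurry_same (s : ℤ) (Ψ : T2 R X →ₗ[ZMod 2] ZMod 2) {i j : ℤ} {x : X.V} (hx : x ∈ X.gr j) {r : R.V}
    (hr : r ∈ R.gr i) (h : i + j = s) : gdev R (gcurry R X s Ψ x) r = Ψ (r ⊗ₜ x) := by
  have e : i = s - j := by omega
  subst e
  rw [gcurry_apply s Ψ hx, comp_same _ hr]

theorem gcurry_ne (s : ℤ) (Ψ : T2 R X →ₗ[ZMod 2] ZMod 2) {i j : ℤ} {x : X.V} (hx : x ∈ X.gr j) {r : R.V}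
    (hr : r ∈ R.gr i) (h : i + j ≠ s) : gdev R (gcurry R X s Ψ x) r = 0 := by
  rw [gcurry_apply s Ψ hx, comp_ne _ hr (by omega), TensorProduct.zero_tmul, map_zero]

theorem gcurry_isB (s : ℤ) {Ψ : T2 R X →ₗ[ZMod 2] ZMod 2} (hΨ : (rc2 R X).B s ≤ LinearMap.ker Ψ) :
    IsBHom X (gd R) (-s) (gcurry R X s Ψ) := by
  have hrel : ∀ z ∈ rel2 R X, Ψ z = 0 := fun z hz => hΨ ((rc2 R X).N_le_B s hz)
  refine ⟨?_, ?_, ?_, ?_⟩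
  · intro j x hx
    refine gdev_gr.2 fun m hm r hr => gcurry_ne s Ψ hx hr (by omega)
  · intro x
    refine int_ind X.internal (p := fun x => gcurry R X s Ψ (X.d x) = (gd R).d (gcurry R X s Ψ x)) x (by simp)
      (fun x y hx hy => by simp only [map_add, hx, hy]) ?_
    intro j x hx
    refine gdev_ext fun m r hr => ?_
    rw [gdev_d]
    by_cases h : m + j = s + 1
    · rw [gcurry_same s Ψ (X.d_gr j x hx) hr (by omega), gcurry_same s Ψ hx (R.d_gr m r hr) (by omega)]
      apply z2_eq_of_add
      rw [← map_add, add_comm, ← d2_tmul]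
      exact hΨ ((rc2 R X).d_mem_B (Submodule.mem_sup_left (tmul_gr2 hr hx h)))
    · rw [gcurry_ne s Ψ (X.d_gr j x hx) hr (by omega), gcurry_ne s Ψ hx (R.d_gr m r hr) (by omega)]
  · intro a x
    refine int_ind X.internal (p := fun x => gcurry R X s Ψ (X.actL a x) = (gd R).actL a (gcurry R X s Ψ x)) x (by simp)
      (fun x y hx hy => by simp only [map_add, hx, hy]) ?_
    intro j x hx
    refine int_ind A.internal (p := fun a => gcurry R X s Ψ (X.actL a x) = (gd R).actL a (gcurry R X s Ψ x)) a (by simp)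
      (fun x y hx hy => by simp only [map_add, LinearMap.add_apply, hx, hy]) ?_
    intro i a ha
    refine gdev_ext fun m r hr => ?_
    rw [gdev_L]
    by_cases h : m + i + j = s
    · rw [gcurry_same s Ψ (X.actL_gr i j a ha x hx) hr (by omega), gcurry_same s Ψ hx (R.actR_gr m i r hr a ha) (by omega)]
      symm
      apply z2_eq_of_add
      rw [← map_add]
      exact hrel _ (rel2_R _ _ _)
    · rw [gcurry_ne s Ψ (X.actL_gr i j a ha x hx) hr (by omega), gcurry_ne s Ψ hx (R.actR_gr m i r hr a ha) (by omega)]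
  · intro x a
    refine int_ind X.internal (p := fun x => gcurry R X s Ψ (X.actR x a) = (gd R).actR (gcurry R X s Ψ x) a) x (by simp)
      (fun x y hx hy => by simp only [map_add, LinearMap.add_apply, hx, hy]) ?_
    intro j x hx
    refine int_ind A.internal (p := fun a => gcurry R X s Ψ (X.actR x a) = (gd R).actR (gcurry R X s Ψ x) a) a (by simp)
      (fun x y hx hy => by simp only [map_add, hx, hy]) ?_
    intro i a ha
    refine gdev_ext fun m r hr => ?_
    rw [gdev_R]
    by_cases h : m + i + j = s
    · rw [gcurry_same s Ψ (X.actR_gr j i x hx a ha) hr (by omega), gcurry_same s Ψ hx (R.actL_gr i m a ha r hr) (by omega)]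
      symm
      apply z2_eq_of_add
      rw [← map_add]
      exact hrel _ (rel2_L _ _ _)
    · rw [gcurry_ne s Ψ (X.actR_gr j i x hx a ha) hr (by omega), gcurry_ne s Ψ hx (R.actL_gr i m a ha r hr) (by omega)]

theorem gpair_curry (s : ℤ) (Ψ : T2 R X →ₗ[ZMod 2] ZMod 2) {z : T2 R X} (hz : z ∈ gr2 R X s) :
    gpair R X (gcurry R X s Ψ) z = Ψ z := by
  have : gr2 R X s ≤ LinearMap.ker (gpair R X (gcurry R X s Ψ) - Ψ) := by
    rw [gr2, Submodule.span_le]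
    rintro _ ⟨i, j, r, hr, x, hx, e, rfl⟩
    rw [SetLike.mem_coe, LinearMap.mem_ker, LinearMap.sub_apply, gpair_tmul, gcurry_same s Ψ hx hr e, sub_self]
  have := this hz
  rwa [LinearMap.mem_ker, LinearMap.sub_apply, sub_eq_zero] at this

theorem X_FD {s : ℤ} (h : Module.Finite (ZMod 2) (HtpyHom X (gd R) (-s))) : (rc2 R X).FD s := by
  obtain ⟨U, hUb, hU, hbU⟩ := htpy_fin h
  let ev : T2 R X →ₗ[ZMod 2] (U →ₗ[ZMod 2] ZMod 2) := ((gpair R X).comp U.subtype).flip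
  refine fin_ker (T := T2 R X) ev inferInstance ?_
  intro z hz h0
  by_contra hzB
  obtain ⟨Ψ, hΨz, hΨ⟩ := Submodule.exists_le_ker_of_notMem hzB
  have hg := gcurry_isB s hΨ
  obtain ⟨g, hgU, n, hn, e⟩ := Submodule.mem_sup.1 (hbU hg)
  have h1 : gpair R X g z = 0 := LinearMap.congr_fun h0 ⟨g, hgU⟩
  have h2 : gpair R X n z = 0 := gpair_null hn hz.2
  have h3 : gpair R X (gcurry R X s Ψ) z = 0 := by
    rw [← e, map_add, LinearMap.add_apply, h1, h2, add_zero]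
  apply hΨz
  rw [← h3]
  obtain ⟨a, ha, b, hb, rfl⟩ := Submodule.mem_sup.1 hz.1
  have hb' : Ψ b = 0 := hΨ ((rc2 R X).N_le_B s hb)
  rw [map_add, map_add, gpair_curry s Ψ ha, gpair_rel hg.2.2.1 hg.2.2.2 hb, hb']
end pairing
end piece16

section piece17
set_option linter.unusedSectionVars false
set_option linter.unusedVariables false
set_option linter.unusedSimpArgs false
variable {A : DGA (ZMod 2)}

/-! ### Counting dimensions -/

/-- map induced on subquotients -/
def qmap {T T' : Type} [AddCommGroup T] [Module (ZMod 2) T] [AddCommGroup T'] [Module (ZMod 2) T']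
    (Z B : Submodule (ZMod 2) T) (Z' B' : Submodule (ZMod 2) T') (f : T →ₗ[ZMod 2] T')
    (hZ : ∀ z ∈ Z, f z ∈ Z') (hB : ∀ z ∈ Z, z ∈ B → f z ∈ B') :
    (↥Z ⧸ Submodule.comap Z.subtype B) →ₗ[ZMod 2] (↥Z' ⧸ Submodule.comap Z'.subtype B') :=
  Submodule.mapQ (Submodule.comap Z.subtype B) (Submodule.comap Z'.subtype B') (f.restrict hZ)
    (fun z hz => hB z.1 z.2 hz)

theorem qmap_surj {T T' : Type} [AddCommGroup T] [Module (ZMod 2) T] [AddCommGroup T'] [Module (ZMod 2) T']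
    {Z B : Submodule (ZMod 2) T} {Z' B' : Submodule (ZMod 2) T'} {f : T →ₗ[ZMod 2] T'}
    {hZ : ∀ z ∈ Z, f z ∈ Z'} {hB : ∀ z ∈ Z, z ∈ B → f z ∈ B'} :
    Function.Surjective (qmap Z B Z' B' f hZ hB) ↔ ∀ y ∈ Z', ∃ z ∈ Z, y + f z ∈ B' := by
  constructor
  · intro h y hy
    obtain ⟨q, hq⟩ := h (Submodule.Quotient.mk ⟨y, hy⟩)
    obtain ⟨z, rfl⟩ := Submodule.Quotient.mk_surjective _ q
    refine ⟨z.1, z.2, ?_⟩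
    have := (Submodule.Quotient.eq (Submodule.comap Z'.subtype B')).1 hq.symm
    rw [← z2_sub]
    exact this
  · intro h q
    obtain ⟨y, rfl⟩ := Submodule.Quotient.mk_surjective _ q
    obtain ⟨z, hz, hyz⟩ := h y.1 y.2
    refine ⟨Submodule.Quotient.mk ⟨z, hz⟩, ?_⟩
    symm
    refine (Submodule.Quotient.eq (Submodule.comap Z'.subtype B')).2 ?_
    rw [← z2_sub] at hyz
    exact hyz

theorem qmap_inj {T T' : Type} [AddCommGroup T] [Module (ZMod 2) T] [AddCommGroup T'] [Module (ZMod 2) T']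
    {Z B : Submodule (ZMod 2) T} {Z' B' : Submodule (ZMod 2) T'} {f : T →ₗ[ZMod 2] T'}
    {hZ : ∀ z ∈ Z, f z ∈ Z'} {hB : ∀ z ∈ Z, z ∈ B → f z ∈ B'} (h : ∀ z ∈ Z, f z ∈ B' → z ∈ B) :
    Function.Injective (qmap Z B Z' B' f hZ hB) := by
  rw [injective_iff_map_eq_zero]
  intro q hq
  obtain ⟨z, rfl⟩ := Submodule.Quotient.mk_surjective _ q
  refine (Submodule.Quotient.mk_eq_zero _).2 (h z.1 z.2 ?_)
  exact (Submodule.Quotient.mk_eq_zero (Submodule.comap Z'.subtype B')).1 hq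

theorem qmap_zero {T T' T'' : Type} [AddCommGroup T] [Module (ZMod 2) T] [AddCommGroup T'] [Module (ZMod 2) T']
    [AddCommGroup T''] [Module (ZMod 2) T'']
    {Z B : Submodule (ZMod 2) T} {Z' B' : Submodule (ZMod 2) T'} {Z'' B'' : Submodule (ZMod 2) T''}
    {f : T →ₗ[ZMod 2] T'} {f' : T' →ₗ[ZMod 2] T''}
    {hZ : ∀ z ∈ Z, f z ∈ Z'} {hB : ∀ z ∈ Z, z ∈ B → f z ∈ B'}
    {hZ' : ∀ z ∈ Z', f' z ∈ Z''} {hB' : ∀ z ∈ Z', z ∈ B' → f' z ∈ B''}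
    (h : ∀ z ∈ Z, f' (f z) ∈ B'') (q) :
    qmap Z' B' Z'' B'' f' hZ' hB' (qmap Z B Z' B' f hZ hB q) = 0 := by
  obtain ⟨z, rfl⟩ := Submodule.Quotient.mk_surjective _ q
  exact (Submodule.Quotient.mk_eq_zero (Submodule.comap Z''.subtype B'')).2 (h z.1 z.2)

theorem qmap_exact {T T' T'' : Type} [AddCommGroup T] [Module (ZMod 2) T] [AddCommGroup T'] [Module (ZMod 2) T']
    [AddCommGroup T''] [Module (ZMod 2) T'']
    {Z B : Submodule (ZMod 2) T} {Z' B' : Submodule (ZMod 2) T'} {Z'' B'' : Submodule (ZMod 2) T''}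
    {f : T →ₗ[ZMod 2] T'} {f' : T' →ₗ[ZMod 2] T''}
    {hZ : ∀ z ∈ Z, f z ∈ Z'} {hB : ∀ z ∈ Z, z ∈ B → f z ∈ B'}
    {hZ' : ∀ z ∈ Z', f' z ∈ Z''} {hB' : ∀ z ∈ Z', z ∈ B' → f' z ∈ B''}
    (h : ∀ z ∈ Z', f' z ∈ B'' → ∃ y ∈ Z, f y = z) (q)
    (hq : qmap Z' B' Z'' B'' f' hZ' hB' q = 0) : ∃ p, qmap Z B Z' B' f hZ hB p = q := by
  obtain ⟨z, rfl⟩ := Submodule.Quotient.mk_surjective _ q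
  obtain ⟨y, hy, e⟩ := h z.1 z.2 ((Submodule.Quotient.mk_eq_zero (Submodule.comap Z''.subtype B'')).1 hq)
  refine ⟨Submodule.Quotient.mk ⟨y, hy⟩, ?_⟩
  have e2 : f.restrict hZ ⟨y, hy⟩ = z := Subtype.ext e
  exact congrArg (Submodule.Quotient.mk (p := Submodule.comap Z'.subtype B')) e2

theorem count_surj {HK HX HN FK FX FN : Type} [AddCommGroup HK] [Module (ZMod 2) HK]
    [AddCommGroup HX] [Module (ZMod 2) HX] [AddCommGroup HN] [Module (ZMod 2) HN]
    [AddCommGroup FK] [Module (ZMod 2) FK] [AddCommGroup FX] [Module (ZMod 2) FX]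
    [AddCommGroup FN] [Module (ZMod 2) FN]
    (eK : HK ≃ₗ[ZMod 2] FK) (eX : HX ≃ₗ[ZMod 2] FX) (eN : HN ≃ₗ[ZMod 2] FN)
    (hX : Module.Finite (ZMod 2) FX) (hN : Module.Finite (ZMod 2) FN)
    (a : HK →ₗ[ZMod 2] HX) (b : HX →ₗ[ZMod 2] HN) (ha : Function.Injective a)
    (hb : Function.Surjective b) (hab : ∀ x, b (a x) = 0)
    (a' : FK →ₗ[ZMod 2] FX) (b' : FX →ₗ[ZMod 2] FN) (hab' : ∀ x, b' x = 0 → ∃ y, a' y = x) :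
    Function.Surjective b' := by
  have hHX : Module.Finite (ZMod 2) HX := Module.Finite.equiv eX.symm
  have hHK : Module.Finite (ZMod 2) HK := Module.Finite.of_injective a ha
  have hFK : Module.Finite (ZMod 2) FK := Module.Finite.equiv eK
  have h1 := LinearMap.finrank_range_add_finrank_ker b
  rw [LinearMap.range_eq_top.2 hb, finrank_top] at h1
  have h2 := LinearMap.finrank_range_add_finrank_ker b'
  have h3 : Module.finrank (ZMod 2) HK ≤ Module.finrank (ZMod 2) (LinearMap.ker b) := by
    rw [← LinearMap.finrank_range_of_inj ha]
    apply Submodule.finrank_mono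
    rintro _ ⟨x, rfl⟩
    exact hab x
  have h4 : Module.finrank (ZMod 2) (LinearMap.ker b') ≤ Module.finrank (ZMod 2) FK := by
    refine le_trans (Submodule.finrank_mono ?_) (LinearMap.finrank_range_le a')
    intro x hx
    exact hab' x hx
  rw [eX.finrank_eq, eN.finrank_eq] at h1
  rw [eK.finrank_eq] at h3
  rw [← LinearMap.range_eq_top]
  apply Submodule.eq_top_of_finrank_eq
  apply le_antisymm (Submodule.finrank_le _)
  omega

/-! ### Finite sums of shifts -/
section pw
variable {ι : Type} [Fintype ι] [DecidableEq ι] (X : DGBimod A) (s : ι → ℤ)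

/-- finite direct sum of shifts of a bimodule -/
def pw : DGBimod A where
  V := ι → X.V
  gr := fun n => Submodule.pi Set.univ (fun i => X.gr (n - s i))
  internal := by
    refine internal_of (fun n => LinearMap.pi fun i => (comp X.gr X.internal (n - s i)).comp (LinearMap.proj i)) ?_ ?_ ?_
    · intro n v hv
      funext i
      exact comp_same _ (hv i trivial)
    · intro n m hnm v hv
      funext i
      exact comp_ne _ (hv i trivial) (by omega)
    · intro v
      rw [← Finset.univ_sum_single v]
      refine Submodule.sum_mem _ fun i _ => ?_
      refine int_ind X.internal (p := fun x => LinearMap.single (ZMod 2) (fun _ => X.V) i x ∈ _) (v i)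
        (by rw [map_zero]; exact Submodule.zero_mem _) ?_ ?_
      · intro x y hx hy; rw [map_add]; exact Submodule.add_mem _ hx hy
      · intro j x hx
        refine Submodule.mem_iSup_of_mem (j + s i) ?_
        intro i' _
        change (Pi.single i x : ι → X.V) i' ∈ X.gr (j + s i - s i')
        by_cases h : i' = i
        · subst h; rw [Pi.single_eq_same, add_sub_cancel_right]; exact hx
        · rw [Pi.single_eq_of_ne h]; exact Submodule.zero_mem _
  d := LinearMap.pi fun i => X.d.comp (LinearMap.proj i)
  d_d := fun v => funext fun i => X.d_d (v i)
  d_gr := fun n v hv i _ => by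
    have := X.d_gr _ _ (hv i trivial)
    rw [sub_right_comm] at this
    exact this
  actL := LinearMap.mk₂ (ZMod 2) (fun a v i => X.actL a (v i))
    (fun a b m => by funext i; simp) (fun c a m => by funext i; simp) (fun a m m' => by funext i; simp)
    (fun c a m => by funext i; simp)
  actR := LinearMap.mk₂ (ZMod 2) (fun v a i => X.actR (v i) a)
    (fun a b m => by funext i; simp) (fun c a m => by funext i; simp) (fun a m m' => by funext i; simp)
    (fun c a m => by funext i; simp)
  actL_one := fun m => funext fun i => X.actL_one _
  actR_one := fun m => funext fun i => X.actR_one _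
  actL_mul := fun a b m => funext fun i => X.actL_mul _ _ _
  actR_mul := fun a b m => funext fun i => X.actR_mul _ _ _
  actLR := fun a b m => funext fun i => X.actLR _ _ _
  actL_gr := fun p q a ha m hm i _ => by
    have := X.actL_gr p _ a ha _ (hm i trivial)
    rw [← add_sub_assoc] at this; exact this
  actR_gr := fun p q m hm a ha i _ => by
    have := X.actR_gr _ q _ (hm i trivial) a ha
    rw [sub_add_eq_add_sub] at this; exact this
  leibnizL := fun j a ha m => by
    rw [np_smul]
    exact funext fun i => X.dL a (m i)
  leibnizR := fun j m hm a => by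
    rw [np_smul]
    exact funext fun i => X.dR (m i) a

/-- inclusion -/
def pwi (i : ι) : X.V →ₗ[ZMod 2] (pw X s).V := LinearMap.single (ZMod 2) (fun _ => X.V) i
/-- projection -/
def pwp (i : ι) : (pw X s).V →ₗ[ZMod 2] X.V := LinearMap.proj i

theorem pwp_isB (i : ι) : IsBHom (pw X s) X (-s i) (pwp X s i) :=
  ⟨fun n v hv => hv i trivial, fun _ => rfl, fun _ _ => rfl, fun _ _ => rfl⟩

theorem pw_ext {v w : (pw X s).V} (h : ∀ i, pwp X s i v = pwp X s i w) : v = w := funext h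

theorem pwp_same (i : ι) (x : X.V) : pwp X s i (pwi X s i x) = x :=
  Pi.single_eq_same (M := fun _ => X.V) i x
theorem pwp_ne {i j : ι} (h : j ≠ i) (x : X.V) : pwp X s j (pwi X s i x) = 0 :=
  Pi.single_eq_of_ne (M := fun _ => X.V) h x
theorem pwp_i (i j : ι) (x : X.V) : pwp X s j (pwi X s i x) = if j = i then x else 0 := by
  split_ifs with h
  · subst h; exact pwp_same X s j x
  · exact pwp_ne X s h x

theorem pwi_isB (i : ι) : IsBHom X (pw X s) (s i) (pwi X s i) := by
  refine ⟨fun n x hx j _ => ?_, fun x => pw_ext X s fun j => ?_, fun a x => pw_ext X s fun j => ?_,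
    fun x a => pw_ext X s fun j => ?_⟩
  · change pwp X s j (pwi X s i x) ∈ X.gr (n + s i - s j)
    rw [pwp_i]
    split_ifs with h
    · subst h; rw [add_sub_cancel_right]; exact hx
    · exact Submodule.zero_mem _
  · rw [(pwp_isB X s j).2.1, pwp_i, pwp_i]
    split_ifs <;> simp
  · rw [(pwp_isB X s j).2.2.1, pwp_i, pwp_i]
    split_ifs <;> simp
  · rw [(pwp_isB X s j).2.2.2, pwp_i, pwp_i]
    split_ifs <;> simp

theorem pw_sum (v : (pw X s).V) : ∑ i, pwi X s i (pwp X s i v) = v :=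
  Finset.univ_sum_single (M := fun _ : ι => X.V) v

theorem ps_sum (R : DGBimod A) {M M' : DGBimod A} (g : ι → M.V →ₗ[ZMod 2] M'.V) (z : T2 R M) :
    ps R (∑ i, g i) z = ∑ i, ps R (g i) z := by
  have h : ps R (∑ i, g i) = ∑ i, ps R (g i) := by
    apply TensorProduct.ext'
    intro r m
    rw [LinearMap.sum_apply]
    simp only [ps, TensorProduct.map_tmul, LinearMap.sum_apply, LinearMap.id_apply, TensorProduct.tmul_sum]
  rw [h, LinearMap.sum_apply]

theorem pw_ps (R : DGBimod A) (z : T2 R (pw X s)) : ∑ i, ps R (pwi X s i) (ps R (pwp X s i) z) = z := by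
  have h : ∑ i, (pwi X s i).comp (pwp X s i) = LinearMap.id := by
    ext v : 1
    rw [LinearMap.sum_apply]
    exact pw_sum X s v
  calc ∑ i, ps R (pwi X s i) (ps R (pwp X s i) z) = ps R (∑ i, (pwi X s i).comp (pwp X s i)) z := by
        rw [ps_sum]; exact Finset.sum_congr rfl fun i _ => (ps_comp R _ _ _).symm
    _ = z := by rw [h, ps_id]

theorem pw_FD (R : DGBimod A) (h : ∀ n, (rc2 R X).FD n) (n : ℤ) : (rc2 R (pw X s)).FD n := by
  choose V hV hZ using h
  refine ⟨⨆ i, Submodule.map (ps R (pwi X s i)) (V (n + -s i)), ?_, ?_⟩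
  · have : ∀ i, Module.Finite (ZMod 2) (Submodule.map (ps R (pwi X s i)) (V (n + -s i))) := fun i =>
      RC.fin_map _ _ (hV _)
    exact Submodule.finite_iSup _
  intro z hz
  rw [← pw_ps X s R z]
  refine Submodule.sum_mem _ fun i _ => ?_
  obtain ⟨u, hu, b, hb, e⟩ := Submodule.mem_sup.1 (hZ _ ((ps_map R (pwp_isB X s i)).Z hz))
  have hb2 := (ps_map R (pwi_isB X s i)).B hb
  have e1 : n + -s i + s i = n := by ring
  rw [e1] at hb2
  rw [← e, map_add]
  exact Submodule.add_mem_sup (Submodule.mem_iSup_of_mem i ⟨u, hu, rfl⟩) hb2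

/-- the map out of a sum of shifts -/
def pwo {N : DGBimod A} (x : ι → X.V →ₗ[ZMod 2] N.V) : (pw X s).V →ₗ[ZMod 2] N.V :=
  ∑ i, (x i).comp (pwp X s i)

theorem pwo_i {N : DGBimod A} (x : ι → X.V →ₗ[ZMod 2] N.V) (i : ι) (v : X.V) :
    pwo X s x (pwi X s i v) = x i v := by
  rw [pwo, LinearMap.sum_apply, Finset.sum_eq_single i]
  · rw [LinearMap.comp_apply, pwp_same]
  · intro j _ h
    rw [LinearMap.comp_apply, pwp_ne X s h, map_zero]
  · intro h; exact absurd (Finset.mem_univ i) h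

theorem pwo_isB {N : DGBimod A} {x : ι → X.V →ₗ[ZMod 2] N.V} (hx : ∀ i, IsBHom X N (s i) (x i)) :
    IsBHom (pw X s) N 0 (pwo X s x) := by
  have : pwo X s x ∈ bcmSub (pw X s) N 0 := by
    refine Submodule.sum_mem _ fun i _ => ?_
    exact IsBHom.comp' (hx i) (pwp_isB X s i) (by ring)
  exact this
end pw
end piece17

section piece18
variable {A : DGA (ZMod 2)}

/-! ### Generating the universal class -/

theorem co_inj {X W N : DGBimod A} {β : W.V →ₗ[ZMod 2] N.V} (hβ : IsBHom W N 0 β)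
    (hs : ∀ b, IsBHom X N 1 b → ∃ c, IsBHom X W 1 c ∧ b + β.comp c ∈ nullHtpSub X N 1)
    {g : X.V →ₗ[ZMod 2] (cocone β hβ).V} (hg : IsBHom X (cocone β hβ) 0 g)
    (hn : (cofst hβ).comp g ∈ nullHtpSub X W 0) : g ∈ nullHtpSub X (cocone β hβ) 0 := by
  obtain ⟨h, hh, e⟩ := mem_null.1 hn
  have hb : IsBHom X N 1 ((cosnd hβ).comp g + β.comp h) := by
    refine isB_of (Submodule.add_mem _ (cosnd_mem hβ (by ring) (isB_mem hg))
      (mem_comp (isB_mem hβ) hh (by ring))) ?_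
    intro x
    have e1 := e x
    rw [LinearMap.comp_apply] at e1
    simp only [LinearMap.add_apply, LinearMap.comp_apply, hg.2.1, cosnd_d, e1, map_add]
    rw [← hβ.2.1]
    have : β (W.d (h x)) + β (h (X.d x)) + N.d (cosnd hβ (g x)) + β (h (X.d x))
      = N.d (cosnd hβ (g x)) + β (W.d (h x)) + (β (h (X.d x)) + β (h (X.d x))) := by abel
    rw [this, z2_add_self, add_zero]
  obtain ⟨c, hc, hcn⟩ := hs _ hb
  obtain ⟨h', hh', e'⟩ := mem_null.1 hcn
  refine mem_null.2 ⟨copair hβ (h + c) h', copair_mem hβ (by ring) (Submodule.add_mem _ hh (isB_mem hc)) hh', ?_⟩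
  intro x
  apply co_ext hβ
  · have e1 := e x
    rw [LinearMap.comp_apply] at e1
    rw [map_add, cofst_d, cofst_pair, cofst_pair, e1, LinearMap.add_apply, LinearMap.add_apply, map_add, hc.2.1]
    have : W.d (h x) + W.d (c x) + (h (X.d x) + W.d (c x)) = W.d (h x) + h (X.d x) + (W.d (c x) + W.d (c x)) := by abel
    rw [this, z2_add_self, add_zero]
  · have e1 := e' x
    simp only [LinearMap.add_apply, LinearMap.comp_apply] at e1
    rw [map_add, cosnd_d, cofst_pair, cosnd_pair, cosnd_pair, add_assoc, ← e1, LinearMap.add_apply, map_add]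
    have : β (h x) + β (c x) + (cosnd hβ (g x) + β (h x) + β (c x))
      = cosnd hβ (g x) + (β (h x) + β (h x)) + (β (c x) + β (c x)) := by abel
    rw [this, z2_add_self, z2_add_self, add_zero, add_zero]

theorem pw_gen (R X N : DGBimod A) {ι : Type} [Fintype ι] [DecidableEq ι] (s : ι → ℤ)
    (hX : ∀ n, (rc2 R X).FD n) (hN : (rc2 R N).FD 0)
    (e : ∀ M, Nonempty (HtpyHom X M 0 ≃ₗ[ZMod 2] HH R M 0))
    (x : ι → X.V →ₗ[ZMod 2] N.V) (hx : ∀ i, IsBHom X N (s i) (x i))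
    (h0 : ∀ b, IsBHom X N 0 b → ∃ c, IsBHom X (pw X s) 0 c ∧ b + (pwo X s x).comp c ∈ nullHtpSub X N 0)
    (h1 : ∀ b, IsBHom X N 1 b → ∃ c, IsBHom X (pw X s) 1 c ∧ b + (pwo X s x).comp c ∈ nullHtpSub X N 1)
    {θ : T2 R N} (hθ : θ ∈ (rc2 R N).Z 0) :
    ∃ w ∈ (rc2 R (pw X s)).Z 0, θ + ps R (pwo X s x) w ∈ (rc2 R N).B 0 := by
  have hβ := pwo_isB X s hx
  obtain ⟨eK⟩ := e (cocone (pwo X s x) hβ)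
  obtain ⟨eX⟩ := e (pw X s)
  obtain ⟨eN⟩ := e N
  have hmZ := fun z hz => (ps_map R hβ).Z (n := 0) (x := z) hz
  have hmB := fun z (_ : z ∈ (rc2 R (pw X s)).Z 0) hz => (ps_map R hβ).B (n := 0) (x := z) hz
  have hcZ := fun z hz => (ps_map R (cofst_isB hβ)).Z (n := 0) (x := z) hz
  have hcB := fun z (_ : z ∈ (rc2 R (cocone (pwo X s x) hβ)).Z 0) hz =>
    (ps_map R (cofst_isB hβ)).B (n := 0) (x := z) hz
  simp only [add_zero] at hmZ hmB hcZ hcB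
  let b' := qmap ((rc2 R (pw X s)).Z 0) ((rc2 R (pw X s)).B 0) ((rc2 R N).Z 0) ((rc2 R N).B 0)
    (ps R (pwo X s x)) hmZ hmB
  let a' := qmap ((rc2 R (cocone (pwo X s x) hβ)).Z 0) ((rc2 R (cocone (pwo X s x) hβ)).B 0)
    ((rc2 R (pw X s)).Z 0) ((rc2 R (pw X s)).B 0) (ps R (cofst hβ)) hcZ hcB
  let b := qmap (bcmSub X (pw X s) 0) (nullHtpSub X (pw X s) 0) (bcmSub X N 0) (nullHtpSub X N 0)
    (LinearMap.llcomp (ZMod 2) X.V (pw X s).V N.V (pwo X s x))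
    (fun z hz => IsBHom.comp' hβ hz (by ring)) (fun z _ hz => null_comp_left hβ hz (by ring))
  let a := qmap (bcmSub X (cocone (pwo X s x) hβ) 0) (nullHtpSub X (cocone (pwo X s x) hβ) 0)
    (bcmSub X (pw X s) 0) (nullHtpSub X (pw X s) 0)
    (LinearMap.llcomp (ZMod 2) X.V (cocone (pwo X s x) hβ).V (pw X s).V (cofst hβ))
    (fun z hz => IsBHom.comp' (cofst_isB hβ) hz (by ring)) (fun z _ hz => null_comp_left (cofst_isB hβ) hz (by ring))
  have key : Function.Surjective b' := by
    refine count_surj eK eX eN ((RC.FD_iff 0).1 (pw_FD X s R hX 0)) ((RC.FD_iff 0).1 hN) a b ?_ ?_ ?_ a' b' ?_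
    · exact qmap_inj fun z hz h => co_inj hβ h1 hz h
    · exact qmap_surj.2 h0
    · refine fun q => qmap_zero (fun z hz => ?_) q
      refine mem_null.2 ⟨(cosnd hβ).comp z, cosnd_mem hβ (by ring) (isB_mem hz), fun y => ?_⟩
      change pwo X s x (cofst hβ (z y)) = N.d (cosnd hβ (z y)) + cosnd hβ (z (X.d y))
      rw [hz.2.1, cosnd_d, add_comm, add_assoc, z2_add_self, add_zero]
    · exact fun q hq => qmap_exact (fun z hz h => co_exact R hβ hz h) q hq
  exact qmap_surj.1 key θ hθ

theorem theta_gen (R X N : DGBimod A) (hX : ∀ n, (rc2 R X).FD n) (hN : (rc2 R N).FD 0)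
    (e : ∀ M, Nonempty (HtpyHom X M 0 ≃ₗ[ZMod 2] HH R M 0))
    (f0 : Module.Finite (ZMod 2) (HtpyHom X N 0)) (f1 : Module.Finite (ZMod 2) (HtpyHom X N 1))
    {θ : T2 R N} (hθ : θ ∈ (rc2 R N).Z 0) :
    ∃ (ι : Type) (_ : Fintype ι) (s : ι → ℤ) (x : ι → X.V →ₗ[ZMod 2] N.V) (φ : ι → T2 R X),
      (∀ i, IsBHom X N (s i) (x i)) ∧ (∀ i, φ i ∈ (rc2 R X).Z (-s i)) ∧
      θ + ∑ i, ps R (x i) (φ i) ∈ (rc2 R N).B 0 := by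
  classical
  obtain ⟨U0, hU0, hf0, hb0⟩ := htpy_fin f0
  obtain ⟨U1, hU1, hf1, hb1⟩ := htpy_fin f1
  have i0 : Finite U0 := Module.finite_of_finite (ZMod 2)
  have i1 : Finite U1 := Module.finite_of_finite (ZMod 2)
  have : Fintype U0 := Fintype.ofFinite U0
  have : Fintype U1 := Fintype.ofFinite U1
  let s : U0 ⊕ U1 → ℤ := Sum.elim (fun _ => 0) (fun _ => 1)
  let x : U0 ⊕ U1 → (X.V →ₗ[ZMod 2] N.V) := Sum.elim (fun u => u.1) (fun u => u.1)
  have hx : ∀ i, IsBHom X N (s i) (x i) := by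
    rintro (u | u)
    · exact hU0 u.2
    · exact hU1 u.2
  have k0 : ∀ b, IsBHom X N 0 b → ∃ c, IsBHom X (pw X s) 0 c ∧ b + (pwo X s x).comp c ∈ nullHtpSub X N 0 := by
    intro b hb
    obtain ⟨u, hu, n, hn, rfl⟩ := Submodule.mem_sup.1 (hb0 hb)
    refine ⟨pwi X s (Sum.inl ⟨u, hu⟩), pwi_isB X s (Sum.inl ⟨u, hu⟩), ?_⟩
    have e1 : (pwo X s x).comp (pwi X s (Sum.inl ⟨u, hu⟩)) = u := LinearMap.ext fun v => pwo_i X s x _ v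
    rw [e1, add_comm, z2_add_cancel]; exact hn
  have k1 : ∀ b, IsBHom X N 1 b → ∃ c, IsBHom X (pw X s) 1 c ∧ b + (pwo X s x).comp c ∈ nullHtpSub X N 1 := by
    intro b hb
    obtain ⟨u, hu, n, hn, rfl⟩ := Submodule.mem_sup.1 (hb1 hb)
    refine ⟨pwi X s (Sum.inr ⟨u, hu⟩), pwi_isB X s (Sum.inr ⟨u, hu⟩), ?_⟩
    have e1 : (pwo X s x).comp (pwi X s (Sum.inr ⟨u, hu⟩)) = u := LinearMap.ext fun v => pwo_i X s x _ v
    rw [e1, add_comm, z2_add_cancel]; exact hn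
  obtain ⟨w, hw, hθw⟩ := pw_gen R X N s hX hN e x hx k0 k1 hθ
  refine ⟨U0 ⊕ U1, inferInstance, s, x, fun i => ps R (pwp X s i) w, hx, fun i => ?_, ?_⟩
  · have := (ps_map R (pwp_isB X s i)).Z hw
    rw [zero_add] at this; exact this
  · rw [pwo, ps_sum] at hθw
    simp only [ps_comp] at hθw
    exact hθw
end piece18

section piece19
variable {A : DGA (ZMod 2)}

/-! ### Conclusion -/

/-- classes having a good homogeneous representative -/
def GoodZ (R M : DGBimod A) (h : TateOK R M) (k : ℤ) (y : T2 R M) : Prop :=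
  ∃ z ∈ gr2 R M k, (tateTD R M h).Good k z ∧ y + z ∈ (rc2 R M).B k

theorem GoodZ.add {R M : DGBimod A} {h : TateOK R M} {k : ℤ} {y y' : T2 R M}
    (hy : GoodZ R M h k y) (hy' : GoodZ R M h k y') : GoodZ R M h k (y + y') := by
  obtain ⟨z, hz, hg, hb⟩ := hy
  obtain ⟨z', hz', hg', hb'⟩ := hy'
  refine ⟨z + z', Submodule.add_mem _ hz hz', TD.Good.add (E := tateTD R M h) hz hz' hg hg', ?_⟩
  have e : y + y' + (z + z') = (y + z) + (y' + z') := by abel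
  rw [e]
  exact Submodule.add_mem _ hb hb'

theorem GoodZ.of_B {R M : DGBimod A} {h : TateOK R M} {k : ℤ} {y : T2 R M}
    (hy : y ∈ (rc2 R M).B k) : GoodZ R M h k y := by
  have h0 : (0 : T2 R M) ∈ gr2 R M k := Submodule.zero_mem _
  refine ⟨0, h0, TD.good_rel (E := tateTD R M h) h0 (Submodule.zero_mem (rel2 R M)), ?_⟩
  rw [add_zero]; exact hy

theorem GoodZ.comb {R M : DGBimod A} {h : TateOK R M} {k : ℤ} {y T S : T2 R M}
    (h1 : y + T ∈ (rc2 R M).B k) (h2 : T + S ∈ (rc2 R M).B k) (h3 : GoodZ R M h k S) : GoodZ R M h k y := by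
  have h4 := GoodZ.add (GoodZ.add (GoodZ.of_B (h := h) h1) (GoodZ.of_B h2)) h3
  have : y + T + (T + S) + S = y + (T + T) + (S + S) := by abel
  rwa [this, z2_add_self, z2_add_self, add_zero, add_zero] at h4

theorem GoodZ.good {R M : DGBimod A} {h : TateOK R M} {k : ℤ} {y : T2 R M}
    (hy : GoodZ R M h k y) (hyg : y ∈ gr2 R M k) : (tateTD R M h).Good k y := by
  obtain ⟨z, hz, hg, hb⟩ := hy
  obtain ⟨v, hv, hr⟩ := (rc2 R M).mem_B.1 hb
  have hr' : y + z + d2 R M v ∈ rel2 R M := hr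
  have hdv : d2 R M v ∈ gr2 R M k := by
    have := d2_gr (R := R) (M := M) hv
    rw [add_sub_cancel_right] at this; exact this
  have h1 : y + z + d2 R M v ∈ gr2 R M k := Submodule.add_mem _ (Submodule.add_mem _ hyg hz) hdv
  have g1 := TD.good_rel (E := tateTD R M h) h1 hr'
  have g2 := TD.good_cycle (E := tateTD R M h) hdv (d2_d2 v)
  have g3 := TD.Good.add (E := tateTD R M h) h1 hdv g1 g2
  have g4 := TD.Good.add (E := tateTD R M h) (Submodule.add_mem _ h1 hdv) hz g3 hg
  have e : y + z + d2 R M v + d2 R M v + z = y := by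
    have : y + z + d2 R M v + d2 R M v + z = y + (z + z) + (d2 R M v + d2 R M v) := by abel
    rw [this, z2_add_self, z2_add_self, add_zero, add_zero]
  have g5 : (tateTD R M h).Good k (y + z + d2 R M v + d2 R M v + z : T2 R M) := g4
  rwa [e] at g5

theorem GoodZ.push {R M M' : DGBimod A} (h : TateOK R M) (h' : TateOK R M') (hc : PiFormalBimod R M)
    {s k l : ℤ} {g : M.V →ₗ[ZMod 2] M'.V} (hg : IsBHom M M' s g) {y : T2 R M} (hy : y ∈ (rc2 R M).Z k)
    (e : k + s = l) : GoodZ R M' h' l (ps R g y) := by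
  subst e
  obtain ⟨z, hz, hdz, hyz⟩ := (rc2 R M).Z_rep hy
  have h1 : (tateTD R M h).Good k z := TD.good_of_collapse ((piFormal_iff R M h).1 hc) hz hdz
  have h2 := (tateHom h h' hg).good h1
  refine ⟨ps R g z, (tateHom h h' hg).f2_gr _ _ hz, h2, ?_⟩
  rw [← map_add]
  exact (ps_map R hg).B ((rc2 R M).N_le_B k hyz)

theorem main_aux (R : DGBimod A) (ρ : R.V →ₗ[ZMod 2] A.diag.V)
    (hres : IsResolution R A.diag ρ) (hsmooth : HomSmooth A) (hproper : HomProper A) (Ab : DGBimod A)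
    (e : ∀ (M : DGBimod A) (s : ℤ), Nonempty (HtpyHom Ab M s ≃ₗ[ZMod 2] HH R M s))
    (hdiag : PiFormalBimod R A.diag) (M : DGBimod A) (hM : IsNeutral R Ab M) : PiFormalBimod R M := by
  obtain ⟨C, D, hD, u, v, hu, hv, huv⟩ := smooth_retract hres hsmooth
  have hrep := rep_exists D hu hv huv
  have hRfd : ∀ n, R.rc.FD n := R_FD hres.2.1 hres.2.2 hproper
  have hRR := R_piFormal hrep ρ hres hdiag
  have hD' : Finite (dualCell D).I := hD
  have hNfd : ∀ n, (rc2 R (dual D)).FD n := fun n => swap_FD (cell_FD (dualCell D) R hRfd n)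
  have hHom : ∀ (W : DGBimod A) (n : ℤ), (rc2 R W).FD n → Module.Finite (ZMod 2) (HtpyHom Ab W n) := by
    intro W n h
    obtain ⟨f⟩ := e W n
    have : Module.Finite (ZMod 2) (HH R W n) := (RC.FD_iff n).1 h
    exact Module.Finite.equiv f.symm
  have hX : ∀ n, (rc2 R Ab).FD n := fun n =>
    X_FD (hHom _ _ (retract_FD D hu hv huv (gd R) (gd_FD hRfd) (-n)))
  obtain ⟨ι, _, s, x, φ, hx, hφ, hθ⟩ := theta_gen R Ab (dual D) hX (hNfd 0) (fun W => e W 0)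
    (hHom _ _ (hNfd 0)) (hHom _ _ (hNfd 1)) hrep.Z
  obtain ⟨d, f, hf, hneu⟩ := hM
  have tR := tateOK_of_retract hres.1 R
  have tM := tateOK_of_retract hres.1 M
  rw [piFormal_iff R M tM]
  refine TD.collapse_of_good ?_
  intro k y hy hdy
  have hyZ : y ∈ (rc2 R M).Z k := ⟨Submodule.mem_sup_left hy, hdy⟩
  refine GoodZ.good (h := tM) ?_ hy
  obtain ⟨η, hη, hyη⟩ := hrep.repr M k y hyZ
  have h1 := (ps_map R hη).B hθ
  rw [zero_add, map_add, map_sum] at h1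
  have hsum : GoodZ R M tM k (∑ i, ps R η (ps R (x i) (φ i))) := by
    refine Finset.sum_induction _ (GoodZ R M tM k) (fun _ _ => GoodZ.add) (GoodZ.of_B (Submodule.zero_mem _)) ?_
    intro i _
    have hc : IsBHom Ab M (s i + k) (η.comp (x i)) := IsBHom.comp' hη (hx i) rfl
    have ed : s i + k = s i + k - d + d := by ring
    rw [ed] at hc
    obtain ⟨g, hg, hn⟩ := (hneu (s i + k - d)).2 _ hc
    have h2 := rc2_null (R := R) hn (hφ i)
    have h3 : ps R g (ps R f (φ i)) + ps R (η.comp (x i) - g.comp f) (φ i) = ps R η (ps R (x i) (φ i)) := by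
      rw [z2_sub, ps_add, ps_comp, ps_comp, add_comm, add_assoc, z2_add_self, add_zero]
    rw [← h3]
    refine GoodZ.add (GoodZ.push tR tM hRR hg ((ps_map R hf).Z (hφ i)) (by ring)) (GoodZ.of_B ?_)
    rw [show -s i + (s i + k - d + d) = k by ring] at h2
    exact h2
  exact GoodZ.comb hyη h1 hsum
end piece19

/-- **Proposition 3.21.** Let `A` be homologically smooth and proper, over `𝔽₂`. If the
operations `d^{2i}`, `i ≥ 2`, vanish on `HH_*(A)` (i.e. the diagonal bimodule is `π`-formal),
then every neutral dg `(A,A)`-bimodule is `π`-formal. -/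
theorem neutral_of_diag_pi_formal
    (A : DGA (ZMod 2)) (R : DGBimod A) (ρ : R.V →ₗ[ZMod 2] A.diag.V)
    (hres : IsResolution R A.diag ρ)
    (hsmooth : HomSmooth A) (hproper : HomProper A)
    (Ab : DGBimod A)
    (e : ∀ (M : DGBimod A) (s : ℤ), Nonempty (HtpyHom Ab M s ≃ₗ[ZMod 2] HH R M s))
    (hdiag : PiFormalBimod R A.diag) :
    ∀ M : DGBimod A, IsNeutral R Ab M → PiFormalBimod R M := by
  exact main_aux R ρ hres hsmooth hproper Ab e hdiag
end LT
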